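/- arXiv:1105.2709 — 3 statements merged into one kernel-verified Lean document; each statement's English description precedes it below -/
import Mathlib

section
/- Let ρ be a non-separable PPT state of rank 4 on ℂ^3 ⊗ ℂ^3. Then there exist five product vectors φ_1 ⊗ ψ_1, …, φ_5 ⊗ ψ_5 in the kernel of ρ that span the (five-dimensional) kernel of ρ, and no nonzero product vector f ⊗ g is orthogonal to all five of them; i.e., the kernel of ρ contains a minimal general Unextendible Product Basis, and in particular the range of ρ contains no nonzero product vector. -/
open scoped ComplexConjugate ComplexOrder

/-- The standard Hermitian inner product, conjugate-linear in the first argument. -/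
noncomputable def hinner {α : Type*} [Fintype α] (x y : α → ℂ) : ℂ :=
  ∑ a, conj (x a) * y a

/-- The product vector `φ ⊗ ψ` in `ℂ^n ⊗ ℂ^m`, identified with `Fin n × Fin m → ℂ`. -/
noncomputable def prodVec {n m : ℕ} (φ : Fin n → ℂ) (ψ : Fin m → ℂ) :
    Fin n × Fin m → ℂ :=
  fun p => φ p.1 * ψ p.2

/-- The partial transpose with respect to the first subsystem:
`ρ^{T1}((i,j),(k,l)) = ρ((k,j),(i,l))`. -/
noncomputable def pt {n m : ℕ} (ρ : Matrix (Fin n × Fin m) (Fin n × Fin m) ℂ) :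
    Matrix (Fin n × Fin m) (Fin n × Fin m) ℂ :=
  Matrix.of fun a b => ρ (b.1, a.2) (a.1, b.2)

/-- `ρ` is separable if it is a finite sum of projections `z z^*` onto product vectors. -/
def Separable {n m : ℕ} (ρ : Matrix (Fin n × Fin m) (Fin n × Fin m) ℂ) : Prop :=
  ∃ (k : ℕ) (φ : Fin k → Fin n → ℂ) (ψ : Fin k → Fin m → ℂ),
    ρ = ∑ t, Matrix.vecMulVec (prodVec (φ t) (ψ t)) (star (prodVec (φ t) (ψ t)))

open Matrix
open scoped Kronecker

/-- A state whose partial transpose is positive semidefinite as well. -/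
def IsPPT {n m : ℕ} (ρ : Matrix (Fin n × Fin m) (Fin n × Fin m) ℂ) : Prop :=
  ρ.PosSemidef ∧ (pt ρ).PosSemidef

/-- The (not necessarily invertible) local transformation `(P ⊗ Q)ᴴ ρ (P ⊗ Q)`. -/
noncomputable def loc {n m n' m' : ℕ} (P : Matrix (Fin n) (Fin n') ℂ)
    (Q : Matrix (Fin m) (Fin m') ℂ)
    (ρ : Matrix (Fin n × Fin m) (Fin n × Fin m) ℂ) :
    Matrix (Fin n' × Fin m') (Fin n' × Fin m') ℂ :=
  (P ⊗ₖ Q)ᴴ * ρ * (P ⊗ₖ Q)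

/-- Exchange of the two tensor factors. -/
def swp {n m : ℕ} (ρ : Matrix (Fin n × Fin m) (Fin n × Fin m) ℂ) :
    Matrix (Fin m × Fin n) (Fin m × Fin n) ℂ :=
  ρ.submatrix Prod.swap Prod.swap

section Basic

variable {n m n' m' n'' m'' : ℕ}

@[simp] lemma pt_apply (ρ : Matrix (Fin n × Fin m) (Fin n × Fin m) ℂ) (a b : Fin n × Fin m) :
    pt ρ a b = ρ (b.1, a.2) (a.1, b.2) := rfl

@[simp] lemma pt_pt (ρ : Matrix (Fin n × Fin m) (Fin n × Fin m) ℂ) : pt (pt ρ) = ρ := rfl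

lemma IsPPT.pt {ρ : Matrix (Fin n × Fin m) (Fin n × Fin m) ℂ} (h : IsPPT ρ) : IsPPT (pt ρ) :=
  ⟨h.2, h.1⟩

lemma loc_apply (P : Matrix (Fin n) (Fin n') ℂ) (Q : Matrix (Fin m) (Fin m') ℂ)
    (ρ : Matrix (Fin n × Fin m) (Fin n × Fin m) ℂ) (a b : Fin n' × Fin m') :
    loc P Q ρ a b = ∑ k, ∑ l, ∑ i, ∑ j,
      star (P i a.1 * Q j a.2) * ρ (i, j) (k, l) * (P k b.1 * Q l b.2) := by
  simp [loc, Matrix.mul_apply, Fintype.sum_prod_type, Finset.sum_mul]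

lemma pt_loc (P : Matrix (Fin n) (Fin n') ℂ) (Q : Matrix (Fin m) (Fin m') ℂ)
    (ρ : Matrix (Fin n × Fin m) (Fin n × Fin m) ℂ) :
    pt (loc P Q ρ) = loc (P.map star) Q (pt ρ) := by
  ext a b
  simp only [pt_apply, loc_apply, Matrix.map_apply]
  have h : ∀ F : Fin n → Fin m → Fin n → Fin m → ℂ,
      ∑ k, ∑ l, ∑ i, ∑ j, F k l i j = ∑ i, ∑ l, ∑ k, ∑ j, F k l i j := by
    intro F
    rw [Finset.sum_comm, Finset.sum_congr rfl fun l _ => Finset.sum_comm, Finset.sum_comm]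
  rw [h]
  refine Finset.sum_congr rfl fun _ _ => Finset.sum_congr rfl fun _ _ =>
    Finset.sum_congr rfl fun _ _ => Finset.sum_congr rfl fun _ _ => ?_
  simp only [star_mul', star_star]
  ring

lemma IsPPT.loc {ρ : Matrix (Fin n × Fin m) (Fin n × Fin m) ℂ} (h : IsPPT ρ)
    (P : Matrix (Fin n) (Fin n') ℂ) (Q : Matrix (Fin m) (Fin m') ℂ) : IsPPT (loc P Q ρ) :=
  ⟨h.1.conjTranspose_mul_mul_same _, by rw [pt_loc]; exact h.2.conjTranspose_mul_mul_same _⟩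

lemma loc_loc (P : Matrix (Fin n) (Fin n') ℂ) (Q : Matrix (Fin m) (Fin m') ℂ)
    (P' : Matrix (Fin n') (Fin n'') ℂ) (Q' : Matrix (Fin m') (Fin m'') ℂ)
    (ρ : Matrix (Fin n × Fin m) (Fin n × Fin m) ℂ) :
    loc P' Q' (loc P Q ρ) = loc (P * P') (Q * Q') ρ := by
  simp only [loc, Matrix.mul_kronecker_mul, Matrix.conjTranspose_mul, Matrix.mul_assoc]

@[simp] lemma loc_one (ρ : Matrix (Fin n × Fin m) (Fin n × Fin m) ℂ) : loc 1 1 ρ = ρ := by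
  simp [loc]

lemma kronecker_mulVec_prodVec (P : Matrix (Fin n) (Fin n') ℂ) (Q : Matrix (Fin m) (Fin m') ℂ)
    (φ : Fin n' → ℂ) (ψ : Fin m' → ℂ) :
    (P ⊗ₖ Q) *ᵥ prodVec φ ψ = prodVec (P *ᵥ φ) (Q *ᵥ ψ) := by
  ext a
  simp only [prodVec, Matrix.mulVec, dotProduct, Fintype.sum_prod_type, Matrix.kroneckerMap_apply,
    Finset.sum_mul_sum]
  exact Finset.sum_congr rfl fun _ _ => Finset.sum_congr rfl fun _ _ => by ring

lemma separable_prodVec (φ : Fin n → ℂ) (ψ : Fin m → ℂ) :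
    Separable (vecMulVec (prodVec φ ψ) (star (prodVec φ ψ))) :=
  ⟨1, fun _ => φ, fun _ => ψ, by simp⟩

lemma separable_zero : Separable (0 : Matrix (Fin n × Fin m) (Fin n × Fin m) ℂ) :=
  ⟨0, fun _ => 0, fun _ => 0, by simp⟩

lemma Separable.add {ρ σ : Matrix (Fin n × Fin m) (Fin n × Fin m) ℂ} (h : Separable ρ)
    (h' : Separable σ) : Separable (ρ + σ) := by
  obtain ⟨k, φ, ψ, rfl⟩ := h
  obtain ⟨k', φ', ψ', rfl⟩ := h'
  exact ⟨k + k', Fin.append φ φ', Fin.append ψ ψ', by simp [Fin.sum_univ_add]⟩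

lemma separable_sum {ι : Type*} (s : Finset ι) (f : ι → Matrix (Fin n × Fin m) (Fin n × Fin m) ℂ)
    (h : ∀ i ∈ s, Separable (f i)) : Separable (∑ i ∈ s, f i) :=
  Finset.sum_induction f Separable (fun _ _ => Separable.add) separable_zero h

lemma Separable.smul {ρ : Matrix (Fin n × Fin m) (Fin n × Fin m) ℂ} (h : Separable ρ) {c : ℝ}
    (hc : 0 ≤ c) : Separable ((c : ℂ) • ρ) := by
  obtain ⟨k, φ, ψ, rfl⟩ := h
  refine ⟨k, fun t => (Real.sqrt c : ℂ) • φ t, ψ, ?_⟩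
  rw [Finset.smul_sum]
  refine Finset.sum_congr rfl fun t _ => ?_
  ext a b
  have : (c : ℂ) = Real.sqrt c * Real.sqrt c := by
    rw [← Complex.ofReal_mul, Real.mul_self_sqrt hc]
  simp only [Matrix.smul_apply, vecMulVec_apply, prodVec, Pi.smul_apply, Pi.star_apply, smul_eq_mul,
    star_mul', Complex.star_def, Complex.conj_ofReal]
  rw [this]
  ring

lemma Separable.loc {ρ : Matrix (Fin n × Fin m) (Fin n × Fin m) ℂ} (h : Separable ρ)
    (P : Matrix (Fin n) (Fin n') ℂ) (Q : Matrix (Fin m) (Fin m') ℂ) : Separable (loc P Q ρ) := by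
  obtain ⟨k, φ, ψ, rfl⟩ := h
  refine ⟨k, fun t => Pᴴ *ᵥ φ t, fun t => Qᴴ *ᵥ ψ t, ?_⟩
  simp only [_root_.loc, Matrix.mul_sum, Matrix.sum_mul]
  refine Finset.sum_congr rfl fun t _ => ?_
  rw [Matrix.mul_vecMulVec, Matrix.vecMulVec_mul, ← kronecker_mulVec_prodVec,
    Matrix.conjTranspose_kronecker, Matrix.star_mulVec, Matrix.conjTranspose_kronecker,
    Matrix.conjTranspose_conjTranspose, Matrix.conjTranspose_conjTranspose]

lemma Separable.of_loc {ρ : Matrix (Fin n × Fin m) (Fin n × Fin m) ℂ}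
    {P : Matrix (Fin n) (Fin n) ℂ} {Q : Matrix (Fin m) (Fin m) ℂ} (hP : IsUnit P) (hQ : IsUnit Q)
    (h : Separable (_root_.loc P Q ρ)) : Separable ρ := by
  obtain ⟨P', hP'⟩ := hP.exists_right_inv
  obtain ⟨Q', hQ'⟩ := hQ.exists_right_inv
  simpa [loc_loc, hP', hQ'] using h.loc P' Q'

lemma Separable.pt {ρ : Matrix (Fin n × Fin m) (Fin n × Fin m) ℂ} (h : Separable ρ) :
    Separable (pt ρ) := by
  obtain ⟨k, φ, ψ, rfl⟩ := h
  refine ⟨k, fun t => star (φ t), ψ, ?_⟩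
  ext a b
  simp only [pt_apply, Matrix.sum_apply, vecMulVec_apply, prodVec, Pi.star_apply, star_mul',
    star_star]
  exact Finset.sum_congr rfl fun _ _ => by ring

lemma Separable.swp {ρ : Matrix (Fin n × Fin m) (Fin n × Fin m) ℂ} (h : Separable ρ) :
    Separable (swp ρ) := by
  obtain ⟨k, φ, ψ, rfl⟩ := h
  refine ⟨k, ψ, φ, ?_⟩
  ext a b
  simp only [_root_.swp, Matrix.submatrix_apply, Matrix.sum_apply, vecMulVec_apply, prodVec,
    Pi.star_apply, star_mul', Prod.fst_swap, Prod.snd_swap]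
  exact Finset.sum_congr rfl fun _ _ => by ring

lemma IsPPT.swp {ρ : Matrix (Fin n × Fin m) (Fin n × Fin m) ℂ} (h : IsPPT ρ) : IsPPT (swp ρ) :=
  ⟨h.1.submatrix _, (h.2.submatrix Prod.swap).transpose⟩

end Basic

/-- A positive semidefinite matrix with a vanishing diagonal entry has a vanishing row. -/
lemma Matrix.PosSemidef.apply_eq_zero {ι : Type*} [Fintype ι] [DecidableEq ι]
    {A : Matrix ι ι ℂ} (hA : A.PosSemidef) {i : ι} (h : A i i = 0) (j : ι) : A i j = 0 := by
  have h1 := hA.dotProduct_mulVec_zero_iff (Pi.single i 1)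
  have : A *ᵥ Pi.single i 1 = 0 := h1.1 (by simp [h])
  have h2 := congrFun this j
  simp only [mulVec_single_one, col_apply, Pi.zero_apply] at h2
  rw [← hA.1.apply i j, h2, star_zero]

section Reduction

variable {n m : ℕ}

lemma loc_one_apply {m' : ℕ} (Q : Matrix (Fin m) (Fin m') ℂ)
    (ρ : Matrix (Fin n × Fin m) (Fin n × Fin m) ℂ) (a b : Fin n × Fin m') :
    loc 1 Q ρ a b = ∑ l, ∑ j, star (Q j a.2) * ρ (a.1, j) (b.1, l) * Q l b.2 := by
  rw [loc_apply, Finset.sum_comm]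
  refine Finset.sum_congr rfl fun l _ => ?_
  rw [Finset.sum_eq_single b.1 (fun k _ hk => by simp [hk]) (by simp),
    Finset.sum_eq_single a.1 (fun k _ hk => by simp [hk]) (by simp)]
  simp

/-- For a PPT state, a product vector in the kernel gives strong orthogonality relations. -/
lemma IsPPT.apply_eq_zero {ρ : Matrix (Fin n × Fin m) (Fin n × Fin m) ℂ} (h : IsPPT ρ)
    {i : Fin n} {j : Fin m} (h0 : ρ (i, j) (i, j) = 0) (k : Fin n) (l : Fin m) :
    ρ (k, j) (i, l) = 0 :=
  h.2.apply_eq_zero (i := (i, j)) h0 (k, l)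

/-- If the block of `ρ` over the first basis vector of the second factor has rank at most one,
then `ρ` is a product state plus a PPT state of smaller size. -/
lemma separable_of_block_of_forall
    (H : ∀ σ : Matrix (Fin n × Fin m) (Fin n × Fin m) ℂ, IsPPT σ → Separable σ)
    {ρ : Matrix (Fin n × Fin (m + 1)) (Fin n × Fin (m + 1)) ℂ} (h : IsPPT ρ) (i₁ : Fin n)
    (h0 : ∀ i, i ≠ i₁ → ρ (i, 0) (i, 0) = 0) : Separable ρ := by
  classical
  set g := ρ (i₁, 0) (i₁, 0) with hg
  have g0 : 0 ≤ g := h.1.diag_nonneg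
  have herm : ∀ a b, star (ρ a b) = ρ b a := fun a b => h.1.1.apply b a
  set r : Fin (m + 1) → ℂ := fun j => if j = 0 then 1 else ρ (i₁, 0) (i₁, j) / g with hr
  have har : ∀ j, ρ (i₁, 0) (i₁, j) = g * r j := by
    intro j
    by_cases hj : j = 0
    · simp [hr, hj, hg]
    · by_cases hg0 : g = 0
      · rw [hg0, zero_mul, h.1.apply_eq_zero (i := (i₁, 0)) hg0]
      · simp only [hr, hj, if_false]
        field_simp
  have hz : ∀ i k l, ¬ (i = i₁ ∧ k = i₁) → ρ (i, 0) (k, l) = 0 := by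
    intro i k l hik
    by_cases hi : i = i₁
    · exact h.apply_eq_zero (h0 k fun hk => hik ⟨hi, hk⟩) i l
    · exact h.1.apply_eq_zero (i := (i, 0)) (h0 i hi) (k, l)
  set R : Matrix (Fin (m + 1)) (Fin (m + 1)) ℂ := Matrix.of fun j l =>
    (if j = l then 1 else 0) - (if j = 0 then r l else 0) with hR
  set S : Matrix (Fin m) (Fin (m + 1)) ℂ := Matrix.of fun j l =>
    if l = j.succ then 1 else 0 with hS
  have hRS : R = R.submatrix id Fin.succ * S := by
    ext j l
    simp only [Matrix.mul_apply, hS, Matrix.of_apply, Matrix.submatrix_apply, id, mul_ite, mul_one,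
      mul_zero]
    refine Fin.cases ?_ (fun l => ?_) l
    · by_cases hj : j = 0 <;> simp [hR, hr, hj, (Fin.succ_ne_zero _).symm]
    · simp [Fin.succ_inj]
  have key : ρ = loc 1 R ρ + ((g.re : ℝ) : ℂ) •
      vecMulVec (prodVec (Pi.single i₁ 1) (star r)) (star (prodVec (Pi.single i₁ 1) (star r))) := by
    have hgre : ((g.re : ℝ) : ℂ) = g := (Complex.eq_re_of_ofReal_le g0).symm
    rw [hgre]
    ext ⟨i, j⟩ ⟨k, l⟩
    have e1 : loc 1 R ρ (i, j) (k, l) = ρ (i, j) (k, l) - star (r j) * ρ (i, 0) (k, l)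
        - ρ (i, j) (k, 0) * r l + star (r j) * ρ (i, 0) (k, 0) * r l := by
      rw [loc_one_apply]
      simp only [hR, Matrix.of_apply, star_sub, sub_mul, mul_sub, Finset.sum_sub_distrib]
      simp only [apply_ite star, star_one, star_zero, ite_mul, mul_ite, mul_one, one_mul, zero_mul,
        mul_zero]
      simp
      ring
    rw [Matrix.add_apply, e1]
    by_cases hik : i = i₁ ∧ k = i₁
    · rw [hik.1, hik.2]
      have e2 : ρ (i₁, j) (i₁, 0) = g * star (r j) := by
        rw [← herm, har, star_mul', (IsSelfAdjoint.of_nonneg g0).star_eq]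
      rw [har, e2, ← hg]
      simp [vecMulVec_apply, prodVec]
      ring
    · have e2 : ρ (i, j) (k, 0) = 0 := by
        rw [← herm, hz k i j fun h => hik ⟨h.2, h.1⟩, star_zero]
      rw [hz i k l hik, hz i k 0 hik, e2]
      have : (Pi.single i₁ 1 : Fin n → ℂ) i * star ((Pi.single i₁ 1 : Fin n → ℂ) k) = 0 := by
        by_cases h1 : i = i₁
        · have h2 : k ≠ i₁ := fun h => hik ⟨h1, h⟩
          simp [Pi.single_apply, h2]
        · simp [Pi.single_apply, h1]
      have e3 : vecMulVec (prodVec (Pi.single i₁ 1) (star r))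
          (star (prodVec (Pi.single i₁ 1) (star r))) (i, j) (k, l) = 0 := by
        calc _ = ((Pi.single i₁ 1 : Fin n → ℂ) i * star ((Pi.single i₁ 1 : Fin n → ℂ) k)) *
              (star (r j) * r l) := by simp [vecMulVec_apply, prodVec]; ring
          _ = 0 := by rw [this, zero_mul]
      rw [Matrix.smul_apply, e3]
      simp
  have : loc 1 R ρ = loc (1 : Matrix (Fin n) (Fin n) ℂ) S (loc 1 (R.submatrix id Fin.succ) ρ) := by
    rw [loc_loc, ← hRS, Matrix.mul_one]
  have hs : Separable (loc (1 : Matrix (Fin n) (Fin n) ℂ) R ρ) := this ▸ (H _ (h.loc _ _)).loc _ _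
  have := hs.add ((separable_prodVec (Pi.single i₁ 1) (star r)).smul (Complex.nonneg_iff.1 g0).1)
  rwa [← key] at this

end Reduction

/-- A linearly independent family of vectors extends to an invertible matrix. -/
lemma exists_isUnit_col {n k : ℕ} (hk : k ≤ n) {v : Fin k → Fin n → ℂ}
    (hv : LinearIndependent ℂ v) :
    ∃ P : Matrix (Fin n) (Fin n) ℂ, IsUnit P ∧ ∀ i : Fin k, P.col (Fin.castLE hk i) = v i := by
  obtain ⟨d, hd⟩ := Nat.exists_eq_add_of_le hk
  induction d generalizing k with
  | zero =>
    obtain rfl : n = k := by simpa using hd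
    exact ⟨(Matrix.of v)ᵀ, linearIndependent_cols_iff_isUnit.1 hv, fun i => rfl⟩
  | succ d ih =>
    obtain ⟨x, hx⟩ := exists_linearIndependent_snoc_of_lt_finrank hv (by simp; omega)
    obtain ⟨P, hP, h⟩ := ih (by omega) hx (by omega)
    refine ⟨P, hP, fun i => ?_⟩
    simpa using h i.castSucc

lemma loc_apply_eq_dotProduct {n m n' m' : ℕ} (P : Matrix (Fin n) (Fin n') ℂ)
    (Q : Matrix (Fin m) (Fin m') ℂ) (ρ : Matrix (Fin n × Fin m) (Fin n × Fin m) ℂ)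
    (a b : Fin n' × Fin m') :
    loc P Q ρ a b =
      star (prodVec (P.col a.1) (Q.col a.2)) ⬝ᵥ ρ *ᵥ prodVec (P.col b.1) (Q.col b.2) := by
  simp only [loc_apply, dotProduct, mulVec, Fintype.sum_prod_type, prodVec, Pi.star_apply,
    Matrix.col_apply, Finset.mul_sum]
  have h : ∀ F : Fin n → Fin m → Fin n → Fin m → ℂ,
      ∑ k, ∑ l, ∑ i, ∑ j, F k l i j = ∑ i, ∑ j, ∑ k, ∑ l, F k l i j := by
    intro F
    simp only [← Fintype.sum_prod_type']
    have : ∑ x : (Fin n × Fin m) × (Fin n × Fin m), F x.1.1 x.1.2 x.2.1 x.2.2 =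
      ∑ x : (Fin n × Fin m) × (Fin n × Fin m), F x.2.1 x.2.2 x.1.1 x.1.2 :=
        Fintype.sum_equiv (Equiv.prodComm _ _) _ _ fun _ => rfl
    simpa [Fintype.sum_prod_type] using this
  rw [h]
  refine Finset.sum_congr rfl fun _ _ => Finset.sum_congr rfl fun _ _ =>
    Finset.sum_congr rfl fun _ _ => Finset.sum_congr rfl fun _ _ => ?_
  ring

section Spectral

variable {ι : Type*} [Fintype ι] [DecidableEq ι]

lemma Matrix.IsHermitian.exists_diagonal {A : Matrix ι ι ℂ} (hA : A.IsHermitian) :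
    ∃ U : Matrix ι ι ℂ, Uᴴ * U = 1 ∧ U * Uᴴ = 1 ∧
      A = U * diagonal (fun i => (hA.eigenvalues i : ℂ)) * Uᴴ := by
  refine ⟨hA.eigenvectorUnitary, Unitary.coe_star_mul_self _, Unitary.coe_mul_star_self _, ?_⟩
  conv_lhs => rw [hA.spectral_theorem]
  rfl

lemma Matrix.PosSemidef.exists_factor {A : Matrix ι ι ℂ} (hA : A.PosSemidef) :
    ∃ X : Matrix (Fin A.rank) ι ℂ, A = Xᴴ * X := by
  obtain ⟨U, -, -, h⟩ := hA.1.exists_diagonal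
  set d := hA.1.eigenvalues with hd
  have hd0 : ∀ i, 0 ≤ d i := hA.eigenvalues_nonneg
  let e : Fin A.rank ≃ {i // d i ≠ 0} :=
    (Fintype.equivFinOfCardEq hA.1.rank_eq_card_non_zero_eigs.symm).symm
  refine ⟨Matrix.of fun s a => (Real.sqrt (d (e s)) : ℂ) * star (U a (e s)), ?_⟩
  ext a b
  conv_lhs => rw [h]
  rw [Matrix.mul_apply, Matrix.mul_apply]
  simp only [Matrix.mul_diagonal, Matrix.conjTranspose_apply, Matrix.of_apply,
    star_mul', Complex.star_def, Complex.conj_ofReal, Complex.conj_conj]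
  rw [e.sum_comp (fun i : {i // d i ≠ 0} =>
      (Real.sqrt (d i) : ℂ) * U a i * ((Real.sqrt (d i) : ℂ) * conj (U b i))),
    ← Fintype.sum_subtype_add_sum_subtype (fun i => d i ≠ 0)]
  rw [add_eq_left.2 (Finset.sum_eq_zero fun i _ => by simp [not_not.1 i.2])]
  refine Finset.sum_congr rfl fun i _ => ?_
  have : (d i : ℂ) = Real.sqrt (d i) * Real.sqrt (d i) := by
    rw [← Complex.ofReal_mul, Real.mul_self_sqrt (hd0 i)]
  rw [this]
  ring

/-- A Hermitian matrix which is not a multiple of the identity can be shifted by a scalar to a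
singular positive or negative semidefinite matrix. -/
lemma Matrix.IsHermitian.exists_shift [Nonempty ι] {A : Matrix ι ι ℂ} (hA : A.IsHermitian)
    (hs : ∀ c : ℂ, A ≠ c • 1) :
    ∃ x y : ℝ, x < y ∧ (A - (x : ℂ) • 1).PosSemidef ∧ ((y : ℂ) • 1 - A).PosSemidef ∧
      (A - (x : ℂ) • 1).det = 0 ∧ ((y : ℂ) • 1 - A).det = 0 := by
  obtain ⟨U, hU1, hU2, h⟩ := hA.exists_diagonal
  set d := hA.eigenvalues with hd
  obtain ⟨i, hi⟩ := Finite.exists_min d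
  obtain ⟨j, hj⟩ := Finite.exists_max d
  have e : ∀ x : ℝ, A - (x : ℂ) • 1 = U * diagonal (fun i => ((d i - x : ℝ) : ℂ)) * Uᴴ := by
    intro x
    have : diagonal (fun i => ((d i - x : ℝ) : ℂ)) =
        diagonal (fun i => (d i : ℂ)) - (x : ℂ) • 1 := by
      ext a b; by_cases hab : a = b <;> simp [hab]
    rw [this, Matrix.mul_sub, Matrix.sub_mul, ← h]
    simp [hU2]
  have hdet : ∀ k, (A - (d k : ℂ) • 1).det = 0 := by
    intro k
    rw [e, det_mul, det_mul, det_diagonal, Finset.prod_eq_zero (Finset.mem_univ k) (by simp)]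
    simp
  have e' : ∀ x : ℝ, (x : ℂ) • 1 - A = U * diagonal (fun i => ((x - d i : ℝ) : ℂ)) * Uᴴ := by
    intro x
    rw [← neg_sub, e, ← Matrix.neg_mul, ← Matrix.mul_neg]
    congr 3
    ext a b; by_cases hab : a = b <;> simp [hab]
  refine ⟨d i, d j, lt_of_le_of_ne (hi j) fun hij => hs (d i) ?_, ?_, ?_, hdet i, ?_⟩
  · have : ∀ k, d k = d i := fun k => le_antisymm (hij ▸ hj k) (hi k)
    have h2 := e (d i)
    simp only [this, sub_self, Complex.ofReal_zero, diagonal_zero, Matrix.mul_zero,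
      Matrix.zero_mul] at h2
    exact sub_eq_zero.1 h2
  · rw [e]
    exact (PosSemidef.diagonal fun k => by
      simpa using hi k).mul_mul_conjTranspose_same U
  · rw [e']
    exact (PosSemidef.diagonal fun k => by
      simpa using hj k).mul_mul_conjTranspose_same U
  · rw [← neg_sub, det_neg, hdet, mul_zero]

lemma Matrix.rank_lt_of_det_eq_zero {κ : Type*} [Fintype κ] [DecidableEq κ] {A : Matrix κ κ ℂ}
    (h : A.det = 0) : A.rank < Fintype.card κ := by
  obtain ⟨v, hv, h0⟩ := exists_mulVec_eq_zero_iff.2 h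
  have h1 := A.mulVecLin.finrank_range_add_finrank_ker
  have h2 : 0 < Module.finrank ℂ (LinearMap.ker A.mulVecLin) :=
    Module.finrank_pos_iff_exists_ne_zero.2 ⟨⟨v, by simpa using h0⟩, by simpa using hv⟩
  simp only [Module.finrank_fintype_fun_eq_card] at h1
  rw [Matrix.rank]
  omega

omit [DecidableEq ι] in
lemma Matrix.rank_conjTranspose_mul_mul_le {r : ℕ} (X : Matrix (Fin r) ι ℂ)
    (C : Matrix (Fin r) (Fin r) ℂ) : (Xᴴ * C * X).rank ≤ C.rank :=
  (rank_mul_le_left _ _).trans (rank_mul_le_right _ _)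

end Spectral

section Split

variable {n m : ℕ}

lemma exists_isHermitian_pair {r r' : ℕ} (X : Matrix (Fin r) (Fin n × Fin m) ℂ)
    (Y : Matrix (Fin r') (Fin n × Fin m) ℂ) (hXY : pt (Xᴴ * X) = Yᴴ * Y)
    (hr : (n * m) ^ 2 + 2 ≤ r ^ 2 + r' ^ 2) :
    ∃ (C : Matrix (Fin r) (Fin r) ℂ) (C' : Matrix (Fin r') (Fin r') ℂ), C.IsHermitian ∧
      C'.IsHermitian ∧ pt (Xᴴ * C * X) = Yᴴ * C' * Y ∧
      ∀ c : ℂ, (C, C') ≠ c • ((1 : Matrix (Fin r) (Fin r) ℂ),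
        (1 : Matrix (Fin r') (Fin r') ℂ)) := by
  let L : (Matrix (Fin r) (Fin r) ℂ × Matrix (Fin r') (Fin r') ℂ) →ₗ[ℂ]
      Matrix (Fin n × Fin m) (Fin n × Fin m) ℂ :=
    { toFun := fun z => Xᴴ * z.1 * X - pt (Yᴴ * z.2 * Y)
      map_add' := fun z w => by
        ext a b
        simp [Matrix.mul_add, Matrix.add_mul]
        ring
      map_smul' := fun c z => by
        ext a b
        simp [mul_sub] }
  have hL : ∀ z, L z = 0 ↔ pt (Xᴴ * z.1 * X) = Yᴴ * z.2 * Y := by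
    intro z
    change Xᴴ * z.1 * X - pt (Yᴴ * z.2 * Y) = 0 ↔ _
    rw [sub_eq_zero]
    constructor
    · intro h; rw [h, pt_pt]
    · intro h; rw [← h, pt_pt]
  have hL1 : L (1, 1) = 0 := by
    rw [hL]; simpa using hXY
  have hLs : ∀ z, L z = 0 → L (z.1ᴴ, z.2ᴴ) = 0 := by
    intro z hz
    rw [hL] at hz ⊢
    have : Yᴴ * z.2ᴴ * Y = (Yᴴ * z.2 * Y)ᴴ := by
      simp [Matrix.mul_assoc]
    rw [this, ← hz]
    have : Xᴴ * z.1ᴴ * X = (Xᴴ * z.1 * X)ᴴ := by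
      simp [Matrix.mul_assoc]
    rw [this]
    rfl
  obtain ⟨z, hz, hzs⟩ : ∃ z, L z = 0 ∧ ∀ c : ℂ, z ≠ c • (1, 1) := by
    by_contra! hcon
    have h1 := L.finrank_range_add_finrank_ker
    have h2 : Module.finrank ℂ (LinearMap.ker L) ≤ 1 :=
      finrank_le_one ⟨(1, 1), hL1⟩ fun w => by
        obtain ⟨c, hc⟩ := hcon w.1 w.2
        exact ⟨c, Subtype.ext hc.symm⟩
    have h3 : Module.finrank ℂ (LinearMap.range L) ≤ _ := Submodule.finrank_le _
    rw [Module.finrank_matrix] at h3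
    rw [Module.finrank_prod, Module.finrank_matrix, Module.finrank_matrix] at h1
    simp only [Fintype.card_prod, Fintype.card_fin, Module.finrank_self, mul_one] at h1 h3
    nlinarith
  by_contra! hcon
  have hz' := hLs z hz
  obtain ⟨c, hc⟩ := hcon (z.1 + z.1ᴴ) (z.2 + z.2ᴴ) (by simp [IsHermitian, add_comm])
    (by simp [IsHermitian, add_comm])
    ((hL (_, _)).1 (by
      have := map_add L z (z.1ᴴ, z.2ᴴ)
      rwa [hz, hz', add_zero] at this))
  obtain ⟨d, hd⟩ := hcon (Complex.I • (z.1 - z.1ᴴ)) (Complex.I • (z.2 - z.2ᴴ))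
    (by simp [IsHermitian, conjTranspose_smul]; abel_nf; simp)
    (by simp [IsHermitian, conjTranspose_smul]; abel_nf; simp)
    ((hL (_, _)).1 (by
      have := map_smul L Complex.I (z - (z.1ᴴ, z.2ᴴ))
      rw [map_sub, hz, hz', sub_zero, smul_zero] at this; exact this))
  refine hzs ((c - Complex.I * d) / 2) ?_
  have e : z = (1 / 2 : ℂ) • ((z.1 + z.1ᴴ, z.2 + z.2ᴴ) -
      Complex.I • (Complex.I • (z.1 - z.1ᴴ), Complex.I • (z.2 - z.2ᴴ))) := by
    ext <;> simp [← mul_assoc] <;> ring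
  rw [e, hc, hd, smul_smul, ← sub_smul, smul_smul]
  congr 1
  ring

/-- If the ranks of a PPT state and of its partial transpose are large enough, the state is a sum
of two PPT states for which the sum of these ranks is smaller. -/
lemma exists_split_of_isPPT {ρ : Matrix (Fin n × Fin m) (Fin n × Fin m) ℂ} (h : IsPPT ρ)
    (hr : (n * m) ^ 2 + 2 ≤ ρ.rank ^ 2 + (pt ρ).rank ^ 2) :
    ∃ (c : ℝ) (ρ₁ ρ₂ : Matrix (Fin n × Fin m) (Fin n × Fin m) ℂ), 0 ≤ c ∧ IsPPT ρ₁ ∧ IsPPT ρ₂ ∧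
      ρ = (c : ℂ) • (ρ₁ + ρ₂) ∧
      ρ₁.rank + (pt ρ₁).rank < ρ.rank + (pt ρ).rank ∧
      ρ₂.rank + (pt ρ₂).rank < ρ.rank + (pt ρ).rank := by
  obtain ⟨X, hX⟩ := h.1.exists_factor
  obtain ⟨Y, hY⟩ := h.2.exists_factor
  generalize ρ.rank = r at *
  generalize (pt ρ).rank = r' at *
  obtain ⟨C, C', hC, hC', hCC, hCs⟩ := exists_isHermitian_pair X Y (by rw [← hX, ← hY]) hr
  have hH : (fromBlocks C 0 0 C').IsHermitian := by
    rw [IsHermitian, fromBlocks_conjTranspose, hC.eq, hC'.eq]; simp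
  have : Nonempty (Fin r ⊕ Fin r') := by
    rcases r with _ | r
    · rcases r' with _ | r'
      · simp at hr
      · exact ⟨Sum.inr 0⟩
    · exact ⟨Sum.inl 0⟩
  obtain ⟨x, y, hxy, hp1, hp2, hd1, hd2⟩ := hH.exists_shift fun c hc => hCs c (by
    rw [← fromBlocks_one, fromBlocks_smul] at hc
    rw [fromBlocks_inj] at hc
    exact Prod.ext hc.1 hc.2.2.2)
  have key : ∀ (s t : ℂ), (s • fromBlocks C 0 0 C' + t • 1).PosSemidef →
      (s • fromBlocks C 0 0 C' + t • 1).det = 0 → IsPPT (Xᴴ * (s • C + t • 1) * X) ∧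
        (Xᴴ * (s • C + t • 1) * X).rank + (pt (Xᴴ * (s • C + t • 1) * X)).rank < r + r' := by
    intro s t hp hd
    have e1 : s • fromBlocks C 0 0 C' + t • 1 =
        fromBlocks (s • C + t • 1) 0 0 (s • C' + t • 1) := by
      rw [← fromBlocks_one, fromBlocks_smul, fromBlocks_smul, fromBlocks_add]; simp
    have e2 : pt (Xᴴ * (s • C + t • 1) * X) = Yᴴ * (s • C' + t • 1) * Y := by
      have h1 : Xᴴ * (s • C + t • 1) * X = s • (Xᴴ * C * X) + t • ρ := by
        rw [hX]; simp [Matrix.mul_add, Matrix.add_mul]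
      have h2 : Yᴴ * (s • C' + t • 1) * Y = s • (Yᴴ * C' * Y) + t • pt ρ := by
        rw [hY]; simp [Matrix.mul_add, Matrix.add_mul]
      rw [h1, h2, ← hCC]
      rfl
    rw [e1] at hp hd
    rw [det_fromBlocks_zero₂₁, mul_eq_zero] at hd
    refine ⟨⟨(hp.submatrix Sum.inl).conjTranspose_mul_mul_same X, ?_⟩, ?_⟩
    · rw [e2]
      exact (hp.submatrix Sum.inr).conjTranspose_mul_mul_same Y
    · rw [e2]
      have h1 := rank_conjTranspose_mul_mul_le X (s • C + t • 1)
      have h2 := rank_conjTranspose_mul_mul_le Y (s • C' + t • 1)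
      have h3 := rank_le_width (s • C + t • (1 : Matrix (Fin r) (Fin r) ℂ))
      have h4 := rank_le_width (s • C' + t • (1 : Matrix (Fin r') (Fin r') ℂ))
      rcases hd with hd | hd
      · have := rank_lt_of_det_eq_zero hd
        rw [Fintype.card_fin] at this
        omega
      · have := rank_lt_of_det_eq_zero hd
        rw [Fintype.card_fin] at this
        omega
  have k1 := key 1 (-x) (by simpa [sub_eq_add_neg] using hp1) (by simpa [sub_eq_add_neg] using hd1)
  have k2 := key (-1) y (by simpa [sub_eq_add_neg, add_comm] using hp2)
    (by simpa [sub_eq_add_neg, add_comm] using hd2)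
  refine ⟨(y - x)⁻¹, _, _, inv_nonneg.2 (sub_nonneg.2 hxy.le), k1.1, k2.1, ?_, k1.2, k2.2⟩
  rw [← Matrix.add_mul, ← Matrix.mul_add]
  have : (1 : ℂ) • C + (-(x : ℂ)) • 1 + ((-1 : ℂ) • C + (y : ℂ) • 1) = ((y - x : ℝ) : ℂ) • 1 := by
    push_cast
    module
  rw [this, Matrix.mul_smul, Matrix.smul_mul, smul_smul, ← Complex.ofReal_mul,
    inv_mul_cancel₀ (sub_pos.2 hxy).ne']
  simp [← hX]

end Split

section TwoByM

variable {m : ℕ}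

lemma ne_zero_linearIndependent {n : ℕ} {e : Fin n → ℂ} (he : e ≠ 0) :
    LinearIndependent ℂ (fun _ : Fin 1 => e) :=
  linearIndependent_unique_iff.2 he

/-- A nonzero vector is the first column of an invertible matrix. -/
lemma exists_isUnit_col_zero {n : ℕ} {e : Fin (n + 1) → ℂ} (he : e ≠ 0) :
    ∃ P : Matrix (Fin (n + 1)) (Fin (n + 1)) ℂ, IsUnit P ∧ P.col 0 = e := by
  obtain ⟨P, hP, h⟩ := exists_isUnit_col (by omega) (ne_zero_linearIndependent he)
  exact ⟨P, hP, h 0⟩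

lemma separable_of_mulVec_eq_zero
    (H : ∀ σ : Matrix (Fin 2 × Fin m) (Fin 2 × Fin m) ℂ, IsPPT σ → Separable σ)
    {ρ : Matrix (Fin 2 × Fin (m + 1)) (Fin 2 × Fin (m + 1)) ℂ} (h : IsPPT ρ) {e : Fin 2 → ℂ}
    {f : Fin (m + 1) → ℂ} (he : e ≠ 0) (hf : f ≠ 0) (h0 : ρ *ᵥ prodVec e f = 0) :
    Separable ρ := by
  obtain ⟨P, hP, hPe⟩ := exists_isUnit_col_zero he
  obtain ⟨Q, hQ, hQf⟩ := exists_isUnit_col_zero hf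
  refine Separable.of_loc hP hQ (separable_of_block_of_forall H (h.loc P Q) 1 fun i hi => ?_)
  obtain rfl : i = 0 := by omega
  rw [loc_apply_eq_dotProduct]
  simp [hPe, hQf, h0]

lemma exists_prodVec_mulVec_eq_zero {r : ℕ} (hr : r ≤ m + 1)
    (X : Matrix (Fin r) (Fin 2 × Fin (m + 1)) ℂ) :
    ∃ (e : Fin 2 → ℂ) (f : Fin (m + 1) → ℂ), e ≠ 0 ∧ f ≠ 0 ∧ X *ᵥ prodVec e f = 0 := by
  set A : Fin 2 → Matrix (Fin r) (Fin (m + 1)) ℂ := fun i => X.submatrix id (Prod.mk i) with hA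
  have hX : ∀ e f, X *ᵥ prodVec e f = e 0 • A 0 *ᵥ f + e 1 • A 1 *ᵥ f := by
    intro e f
    ext s
    simp only [mulVec, dotProduct, Fintype.sum_prod_type, Fin.sum_univ_two, prodVec, hA,
      Matrix.submatrix_apply, id, Pi.add_apply, Pi.smul_apply, smul_eq_mul, Finset.mul_sum]
    congr 1 <;> exact Finset.sum_congr rfl fun _ _ => by ring
  by_cases hinj : ∃ f, f ≠ 0 ∧ A 0 *ᵥ f = 0
  · obtain ⟨f, hf, h0⟩ := hinj
    refine ⟨![1, 0], f, fun h => by simpa using congrFun h 0, hf, ?_⟩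
    simp [hX, h0]
  · push Not at hinj
    have hi : Function.Injective (A 0).mulVecLin := by
      refine (injective_iff_map_eq_zero _).2 fun f hf => ?_
      by_contra hne
      exact hinj f hne hf
    have := LinearMap.finrank_le_finrank_of_injective hi
    simp only [Module.finrank_fintype_fun_eq_card, Fintype.card_fin] at this
    obtain rfl : r = m + 1 := by omega
    have hu : IsUnit (A 0) := mulVec_injective_iff_isUnit.1 hi
    obtain ⟨x, hx⟩ := Module.End.exists_eigenvalue (Matrix.toLin' ((A 0)⁻¹ * A 1))
    obtain ⟨f, hf⟩ := hx.exists_hasEigenvector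
    refine ⟨![-x, 1], f, fun h => by simpa using congrFun h 1, hf.2, ?_⟩
    have h1 : ((A 0)⁻¹ * A 1) *ᵥ f = x • f := by simpa using hf.apply_eq_smul
    have h2 : A 1 *ᵥ f = x • A 0 *ᵥ f := by
      rw [← mulVec_smul, ← h1, mulVec_mulVec, mul_nonsing_inv_cancel_left _ _
        ((isUnit_iff_isUnit_det _).1 hu)]
    simp [hX, h2]

lemma separable_of_rank_le
    (H : ∀ σ : Matrix (Fin 2 × Fin m) (Fin 2 × Fin m) ℂ, IsPPT σ → Separable σ)
    {ρ : Matrix (Fin 2 × Fin (m + 1)) (Fin 2 × Fin (m + 1)) ℂ} (h : IsPPT ρ)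
    {r : ℕ} (hr : r ≤ m + 1) (X : Matrix (Fin r) (Fin 2 × Fin (m + 1)) ℂ) (hX : ρ = Xᴴ * X) :
    Separable ρ := by
  obtain ⟨e, f, he, hf, h0⟩ := exists_prodVec_mulVec_eq_zero hr X
  refine separable_of_mulVec_eq_zero H h he hf ?_
  rw [hX, ← mulVec_mulVec, h0, mulVec_zero]

/-- PPT states on `ℂ² ⊗ ℂ^(m+1)` are separable as soon as this holds on `ℂ² ⊗ ℂ^m` and for the
states of intermediate rank without product vectors in the kernel. -/
lemma separable_of_forall_of_rank
    (H : ∀ σ : Matrix (Fin 2 × Fin m) (Fin 2 × Fin m) ℂ, IsPPT σ → Separable σ)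
    (H' : ∀ σ : Matrix (Fin 2 × Fin (m + 1)) (Fin 2 × Fin (m + 1)) ℂ, IsPPT σ →
      m + 1 < σ.rank → m + 1 < (pt σ).rank →
      σ.rank ^ 2 + (pt σ).rank ^ 2 < (2 * (m + 1)) ^ 2 + 2 →
      (∀ e f, e ≠ 0 → f ≠ 0 → σ *ᵥ prodVec e f ≠ 0) → Separable σ)
    (ρ : Matrix (Fin 2 × Fin (m + 1)) (Fin 2 × Fin (m + 1)) ℂ) (h : IsPPT ρ) : Separable ρ := by
  induction hs : ρ.rank + (pt ρ).rank using Nat.strong_induction_on generalizing ρ with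
  | _ s ih =>
  by_cases h1 : ρ.rank ≤ m + 1
  · obtain ⟨X, hX⟩ := h.1.exists_factor
    exact separable_of_rank_le H h h1 X hX
  by_cases h2 : (pt ρ).rank ≤ m + 1
  · obtain ⟨X, hX⟩ := h.2.exists_factor
    exact (separable_of_rank_le H h.pt h2 X hX).pt
  by_cases h3 : (2 * (m + 1)) ^ 2 + 2 ≤ ρ.rank ^ 2 + (pt ρ).rank ^ 2
  · obtain ⟨c, ρ₁, ρ₂, hc, hp₁, hp₂, e, hr₁, hr₂⟩ := exists_split_of_isPPT h h3
    rw [e]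
    exact ((ih _ (by omega) ρ₁ hp₁ rfl).add (ih _ (by omega) ρ₂ hp₂ rfl)).smul hc
  by_cases h4 : ∃ e f, e ≠ 0 ∧ f ≠ 0 ∧ ρ *ᵥ prodVec e f = 0
  · obtain ⟨e, f, he, hf, h0⟩ := h4
    exact separable_of_mulVec_eq_zero H h he hf h0
  · push Not at h4
    exact H' ρ h (by omega) (by omega) (by omega) h4

lemma separable_two_one (ρ : Matrix (Fin 2 × Fin 1) (Fin 2 × Fin 1) ℂ) (h : IsPPT ρ) :
    Separable ρ := by
  obtain ⟨X, hX⟩ := h.1.exists_factor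
  refine ⟨_, fun s i => star (X s (i, 0)), fun _ _ => 1, hX.trans ?_⟩
  ext ⟨i, j⟩ ⟨k, l⟩
  obtain rfl : j = 0 := by omega
  obtain rfl : l = 0 := by omega
  simp [Matrix.mul_apply, Matrix.sum_apply, vecMulVec_apply, prodVec]

lemma separable_two_two (ρ : Matrix (Fin 2 × Fin 2) (Fin 2 × Fin 2) ℂ) (h : IsPPT ρ) :
    Separable ρ :=
  separable_of_forall_of_rank separable_two_one
    (fun σ _ h1 h2 h3 _ => by nlinarith) ρ h

end TwoByM

section NormalExtension

lemma exists_phase {x y : ℂ} (h : x * conj x = y * conj y) :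
    ∃ w : ℂ, w * conj w = 1 ∧ w * x = y := by
  by_cases hx : x = 0
  · refine ⟨1, by simp, ?_⟩
    rw [hx, zero_mul] at h
    rcases mul_eq_zero.1 h.symm with h | h
    · simp [hx, h]
    · simp [hx, (map_eq_zero _).1 h]
  · refine ⟨y / x, ?_, div_mul_cancel₀ _ hx⟩
    have : conj x ≠ 0 := (map_ne_zero _).2 hx
    rw [map_div₀, div_mul_div_comm, ← h, div_self (mul_ne_zero hx this)]

lemma mul_conj_lt_of_conj_mul {z s : ℂ} {n : ℝ} (hs : ‖s‖ < n) (h : conj z * s + z * n = 0) :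
    z = 0 := by
  by_contra hz
  have h1 : ‖z‖ * ‖s‖ = ‖z‖ * n := by
    have : conj z * s = -(z * n) := eq_neg_of_add_eq_zero_left h
    have := congrArg norm this
    simpa [abs_of_pos ((norm_nonneg s).trans_lt hs)] using this
  exact hs.ne (mul_left_cancel₀ (norm_ne_zero_iff.2 hz) h1)

lemma exists_normal_extension_aux {D : Matrix (Fin 3) (Fin 3) ℂ} {u b : Fin 3 → ℂ} {μ : ℂ}
    (hμ : μ ≠ 0) (hQ : D * Dᴴ - Dᴴ * D = diagonal ![μ, -μ, 0])
    (hub : vecMulVec u (star u) - vecMulVec b (star b) = diagonal ![μ, -μ, 0]) :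
    ∃ w h : ℂ, w * conj w = 1 ∧ Dᴴ *ᵥ (w • b) - D *ᵥ u = conj h • w • b - h • u := by
  have hD : μ * D 0 0 = μ * D 1 1 := by
    have h1 : ((D * Dᴴ - Dᴴ * D) * D).trace = 0 := by
      rw [Matrix.sub_mul, trace_sub, sub_eq_zero, Matrix.mul_assoc, trace_mul_comm]
    rw [hQ, Matrix.trace] at h1
    simp [Fin.sum_univ_three, Matrix.diag] at h1
    linear_combination h1
  have hD := mul_left_cancel₀ hμ hD
  have hT : μ * ((D * Dᴴ + Dᴴ * D) 0 0 - (D * Dᴴ + Dᴴ * D) 1 1) = 0 := by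
    have h1 : ((D * Dᴴ - Dᴴ * D) * (D * Dᴴ + Dᴴ * D)).trace = 0 := by
      have e : (D * Dᴴ - Dᴴ * D) * (D * Dᴴ + Dᴴ * D) =
          (D * (Dᴴ * D * Dᴴ) - Dᴴ * D * Dᴴ * D) + ((D * Dᴴ) * (Dᴴ * D) - (Dᴴ * D) * (D * Dᴴ)) := by
        noncomm_ring
      rw [e, trace_add, trace_sub, trace_sub, trace_mul_comm D, trace_mul_comm (D * Dᴴ)]
      simp
    rw [hQ, Matrix.trace] at h1
    generalize D * Dᴴ + Dᴴ * D = S at h1 ⊢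
    simp [Fin.sum_univ_three] at h1
    linear_combination h1
  have q := fun i j => congrFun (congrFun hQ i) j
  have v := fun i j => congrFun (congrFun hub i) j
  have hT := (mul_eq_zero.1 hT).resolve_left hμ
  have q01 := q 0 1
  have q22 := q 2 2
  have v00 := v 0 0
  have v01 := v 0 1
  have v10 := v 1 0
  have v11 := v 1 1
  have v02 := v 0 2
  have v12 := v 1 2
  have v22 := v 2 2
  have v20 := v 2 0
  simp [vecMulVec_apply, Matrix.mul_apply, Fin.sum_univ_three]
    at q01 q22 v00 v01 v10 v11 v02 v12 v22 v20 hT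
  have hu2 : u 2 = 0 := by
    have : μ * (u 2 * conj (u 2)) = 0 := by
      linear_combination -b 0 * conj (b 0) * v22 - u 2 * conj (u 2) * v00 + u 2 * conj (u 0) * v02 +
        b 0 * conj (b 2) * v20
    simpa [hμ] using this
  have hb2 : b 2 = 0 := by
    rw [hu2] at v22
    simpa using v22
  have hx : D 0 2 * conj (D 1 2) = conj (D 2 0) * D 2 1 := by
    have : conj (D 0 0) = conj (D 1 1) := by rw [hD]
    linear_combination q01 - conj (D 1 0) * hD + D 0 1 * this
  have hx' : conj (D 0 2) * D 1 2 = D 2 0 * conj (D 2 1) := by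
    simpa using congrArg conj hx
  have hb : b 1 * conj (b 1) - b 0 * conj (b 0) = μ := by
    refine mul_left_cancel₀ hμ ?_
    linear_combination (-u 0 * conj (u 0)) * v11 - (b 1 * conj (b 1) - μ) * v00 +
      u 1 * conj (u 0) * v01 + b 0 * conj (b 1) * v10
  have hn : b 0 * conj (b 0) + b 1 * conj (b 1) = u 0 * conj (u 0) + u 1 * conj (u 1) := by
    linear_combination -v00 - v11
  have hdet : u 0 * b 1 - u 1 * b 0 ≠ 0 := by
    intro h0
    have h1 : μ * (b 1 * conj (b 1)) = 0 := by
      linear_combination conj (b 1) * conj (u 0) * h0 - b 1 * conj (b 1) * v00 +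
        b 0 * conj (b 1) * v10
    have h2 : μ * (b 0 * conj (b 0)) = 0 := by
      linear_combination conj (b 0) * conj (u 1) * h0 + b 0 * conj (b 0) * v11 -
        b 1 * conj (b 0) * v01
    refine hμ (mul_self_eq_zero.1 ?_)
    linear_combination -μ * hb + h1 - h2
  obtain ⟨w, hw, hwx⟩ := exists_phase (x := conj (D 0 2) * b 0 + conj (D 1 2) * b 1)
    (y := D 2 0 * u 0 + D 2 1 * u 1) (by
      have hD' : conj (D 0 0) = conj (D 1 1) := by rw [hD]
      simp only [map_add, map_mul, Complex.conj_conj]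
      linear_combination -D 2 0 * conj (D 2 0) * v00 - D 2 1 * conj (D 2 1) * v11 -
        D 2 0 * conj (D 2 1) * v01 - D 2 1 * conj (D 2 0) * v10 + b 0 * conj (b 1) * hx' +
        b 1 * conj (b 0) * hx + (D 1 2 * conj (D 1 2) - D 2 1 * conj (D 2 1)) * hb -
        b 0 * conj (b 0) * q22 - μ / 2 * q22 - μ / 2 * hT +
        μ * (conj (D 0 0) * hD + D 1 1 * hD'))
  have hw0 : w ≠ 0 := left_ne_zero_of_mul_eq_one hw
  obtain ⟨c, hc⟩ : ∃ c : Fin 3 → ℂ, c = w • b := ⟨_, rfl⟩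
  have hc' : ∀ i, c i = w * b i := fun i => by rw [hc]; rfl
  have hcc : ∀ i j, c i * conj (c j) = b i * conj (b j) := fun i j => by
    rw [hc', hc', map_mul]; linear_combination b i * conj (b j) * hw
  have hcdet : u 0 * c 1 - u 1 * c 0 ≠ 0 := by
    rw [hc', hc']
    intro h0
    exact mul_ne_zero hw0 hdet (by linear_combination h0)
  obtain ⟨x, y, h0, h1⟩ : ∃ x y : ℂ, (Dᴴ *ᵥ c - D *ᵥ u) 0 = x * c 0 - y * u 0 ∧
      (Dᴴ *ᵥ c - D *ᵥ u) 1 = x * c 1 - y * u 1 := by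
    generalize (Dᴴ *ᵥ c - D *ᵥ u) 0 = r
    generalize (Dᴴ *ᵥ c - D *ᵥ u) 1 = s
    refine ⟨(u 0 * s - u 1 * r) / (u 0 * c 1 - u 1 * c 0),
      (c 0 * s - c 1 * r) / (u 0 * c 1 - u 1 * c 0), ?_, ?_⟩ <;> field_simp <;> ring
  have hc2 : c 2 = 0 := by rw [hc', hb2, mul_zero]
  have h2 : (Dᴴ *ᵥ c - D *ᵥ u) 2 = 0 := by
    simp only [Pi.sub_apply, mulVec, dotProduct, Fin.sum_univ_three, conjTranspose_apply, hc', hu2,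
      hb2, Complex.star_def]
    linear_combination hwx
  have hxy : x - conj y = 0 := by
    have hD' : conj (D 0 0) = conj (D 1 1) := by rw [hD]
    have h0' := congrArg conj h0
    have h1' := congrArg conj h1
    simp only [Pi.sub_apply, mulVec, dotProduct, Fin.sum_univ_three, conjTranspose_apply, hc2, hu2,
      Complex.star_def, map_sub, map_mul, map_add, Complex.conj_conj, map_zero] at h0 h1 h0' h1'
    set s := u 0 * conj (c 0) + u 1 * conj (c 1) with hs
    set n : ℝ := Complex.normSq (b 0) + Complex.normSq (b 1) with hn'
    have hnb : (n : ℂ) = c 0 * conj (c 0) + c 1 * conj (c 1) := by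
      rw [hn', hcc, hcc, Complex.mul_conj, Complex.mul_conj]; push_cast; rfl
    have hnu : (n : ℂ) = u 0 * conj (u 0) + u 1 * conj (u 1) := by
      rw [← hn, hn', Complex.mul_conj, Complex.mul_conj]; push_cast; rfl
    refine mul_conj_lt_of_conj_mul (s := s) (n := n) ?_ ?_
    · have e : s * conj s + (u 0 * c 1 - u 1 * c 0) * conj (u 0 * c 1 - u 1 * c 0) = n * n := by
        simp only [hs, map_sub, map_mul, map_add, Complex.conj_conj]
        linear_combination -(n : ℂ) * hnb - (c 0 * conj (c 0) + c 1 * conj (c 1)) * hnu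
      rw [Complex.mul_conj, Complex.mul_conj] at e
      have e : Complex.normSq s + Complex.normSq (u 0 * c 1 - u 1 * c 0) = n * n := by
        exact_mod_cast e
      have : 0 < Complex.normSq (u 0 * c 1 - u 1 * c 0) := Complex.normSq_pos.2 hcdet
      have hn0 : 0 ≤ n := add_nonneg (Complex.normSq_nonneg _) (Complex.normSq_nonneg _)
      rw [Complex.normSq_eq_norm_sq s] at e
      exact lt_of_pow_lt_pow_left₀ 2 hn0 (by linarith)
    · simp only [map_sub, Complex.conj_conj]
      linear_combination -conj (c 0) * h0 - conj (c 1) * h1 - u 0 * h0' - u 1 * h1' +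
        x * hnb - conj y * hnu + conj (D 0 0) * (hcc 0 0 - v00) + conj (D 1 0) * (hcc 1 0 - v10) +
        conj (D 0 1) * (hcc 0 1 - v01) + conj (D 1 1) * (hcc 1 1 - v11) - μ * hD'
  obtain rfl : x = conj y := sub_eq_zero.1 hxy
  refine ⟨w, y, hw, ?_⟩
  rw [← hc]
  ext i
  fin_cases i
  · exact h0
  · exact h1
  · simpa [hc2, hu2] using h2

end NormalExtension

section TwoByThree

lemma vecMulVec_mulVec_star {n m : ℕ} (A : Matrix (Fin m) (Fin n) ℂ) (x : Fin n → ℂ) :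
    vecMulVec (A *ᵥ x) (star (A *ᵥ x)) = A * vecMulVec x (star x) * Aᴴ := by
  rw [mul_vecMulVec, vecMulVec_mul, star_mulVec]

lemma exists_normal_extension {D : Matrix (Fin 3) (Fin 3) ℂ} {u b : Fin 3 → ℂ}
    (hQ : D * Dᴴ - Dᴴ * D = vecMulVec u (star u) - vecMulVec b (star b))
    (hne : D * Dᴴ ≠ Dᴴ * D) :
    ∃ w h : ℂ, w * conj w = 1 ∧ Dᴴ *ᵥ (w • b) - D *ᵥ u = conj h • w • b - h • u := by
  set Q := vecMulVec u (star u) - vecMulVec b (star b) with hQdef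
  have hQh : Q.IsHermitian := by
    rw [← hQ]
    simp [IsHermitian]
  obtain ⟨V, hV, hV', hd⟩ := hQh.exists_diagonal
  set d := hQh.eigenvalues with hddef
  have hdet : Q.det = 0 := by
    simp only [hQdef, det_fin_three, Matrix.sub_apply, vecMulVec_apply]
    ring
  rw [hQh.det_eq_prod_eigenvalues, Finset.prod_eq_zero_iff] at hdet
  obtain ⟨k, -, hk⟩ := hdet
  have htr : Q.trace = 0 := by
    rw [← hQ, trace_sub, trace_mul_comm, sub_self]
  rw [hQh.trace_eq_sum_eigenvalues] at htr
  obtain ⟨W, hW, hW', e, he, he2⟩ : ∃ W : Matrix (Fin 3) (Fin 3) ℂ, Wᴴ * W = 1 ∧ W * Wᴴ = 1 ∧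
      ∃ e : Fin 3 → ℂ, Q = W * diagonal e * Wᴴ ∧ e 2 = 0 ∧ e 0 + e 1 + e 2 = 0 := by
    let σ := Equiv.swap 2 k
    refine ⟨V.submatrix id σ, ?_, ?_, fun i => (d (σ i) : ℂ), ?_, ?_, ?_⟩
    · rw [conjTranspose_submatrix, ← submatrix_mul _ _ _ _ _ Function.bijective_id, hV,
        submatrix_one_equiv]
    · rw [conjTranspose_submatrix, submatrix_mul_equiv, hV', submatrix_id_id]
    · rw [← Function.comp_def (fun i => (d i : ℂ)) σ, ← submatrix_diagonal_equiv,
        conjTranspose_submatrix, submatrix_mul_equiv, submatrix_mul_equiv, submatrix_id_id]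
      exact hd
    · simpa [σ] using hk
    · rw [← Fin.sum_univ_three (fun i => (d (σ i) : ℂ)), Equiv.sum_comp σ (fun i => (d i : ℂ))]
      exact htr
  have hediag : diagonal e = diagonal ![e 0, -e 0, 0] := by
    congr 1
    ext i
    fin_cases i
    · simp
    · simp; linear_combination he2.2 - he2.1
    · simpa using he2.1
  have hWQ : Wᴴ * Q * W = diagonal ![e 0, -e 0, 0] := by
    rw [he, ← hediag]
    simp only [Matrix.mul_assoc, hW, Matrix.mul_one]
    rw [← Matrix.mul_assoc, hW, Matrix.one_mul]
  have hμ : e 0 ≠ 0 := by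
    intro h0
    apply hne
    rw [← sub_eq_zero, hQ, he, hediag, h0]
    have : diagonal ![(0 : ℂ), -0, 0] = 0 := by
      ext i j
      fin_cases i <;> fin_cases j <;> simp
    rw [this]
    simp
  have hWW : ∀ A : Matrix (Fin 3) (Fin 3) ℂ, W * (Wᴴ * A) = A := fun A => by
    rw [← Matrix.mul_assoc, hW', Matrix.one_mul]
  obtain ⟨w, h, hw, hh⟩ := exists_normal_extension_aux (D := Wᴴ * D * W) (u := Wᴴ *ᵥ u)
    (b := Wᴴ *ᵥ b) hμ (by
      rw [← hWQ, ← hQ]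
      simp only [conjTranspose_mul, conjTranspose_conjTranspose, Matrix.mul_assoc, hWW,
        Matrix.mul_sub, Matrix.sub_mul])
    (by
      rw [← hWQ, vecMulVec_mulVec_star, vecMulVec_mulVec_star, conjTranspose_conjTranspose, hQdef]
      simp only [Matrix.mul_sub, Matrix.sub_mul])
  refine ⟨w, h, hw, ?_⟩
  have := congrArg (W *ᵥ ·) hh
  simp only [conjTranspose_mul, conjTranspose_conjTranspose, mulVec_sub, mulVec_smul,
    mulVec_mulVec, Matrix.mul_assoc, hWW, hW', one_mulVec, Matrix.mul_one] at this
  simpa [mulVec_smul] using this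

/-- The block matrix with blocks `A i k` as a matrix on `ℂ^n ⊗ ℂ^m`. -/
def blk {n m : ℕ} (A : Fin n → Fin n → Matrix (Fin m) (Fin m) ℂ) :
    Matrix (Fin n × Fin m) (Fin n × Fin m) ℂ :=
  Matrix.of fun a b => A a.1 b.1 a.2 b.2

/-- Blocks of columns next to each other. -/
def blkRow {κ : Type*} {n m : ℕ} (X : Fin n → Matrix κ (Fin m) ℂ) :
    Matrix κ (Fin n × Fin m) ℂ :=
  Matrix.of fun s a => X a.1 s a.2

lemma conjTranspose_blkRow_mul {κ : Type*} [Fintype κ] {n m : ℕ}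
    (X : Fin n → Matrix κ (Fin m) ℂ) (C : Matrix κ κ ℂ) :
    (blkRow X)ᴴ * C * blkRow X = blk fun i k => (X i)ᴴ * C * X k := by
  ext a b
  simp [blk, blkRow, Matrix.mul_apply]

lemma pt_blk {n m : ℕ} (A : Fin n → Fin n → Matrix (Fin m) (Fin m) ℂ) :
    pt (blk A) = blk fun i k => A k i := rfl

lemma exists_unit_smul {ι : Type*} [Fintype ι] {v : ι → ℂ} (hv : v ≠ 0) :
    ∃ c : ℂ, c ≠ 0 ∧ star (c • v) ⬝ᵥ (c • v) = 1 := by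
  have h0 : 0 < star v ⬝ᵥ v := dotProduct_star_self_pos_iff.2 hv
  obtain ⟨h1, h2⟩ := Complex.pos_iff.1 h0
  have h3 : star v ⬝ᵥ v = ((star v ⬝ᵥ v).re : ℂ) := by
    apply Complex.ext <;> simp [h2]
  set s := (star v ⬝ᵥ v).re
  have hs : (Real.sqrt s) ≠ 0 := (Real.sqrt_pos.2 h1).ne'
  refine ⟨((Real.sqrt s)⁻¹ : ℝ), by exact_mod_cast inv_ne_zero hs, ?_⟩
  rw [star_smul, smul_dotProduct, dotProduct_smul, h3, Complex.star_def, Complex.conj_ofReal,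
    smul_eq_mul, smul_eq_mul]
  norm_cast
  field_simp
  exact (Real.sq_sqrt h1.le).symm

lemma exists_unit_vec_of_lt {r m : ℕ} (h : m < r) (X : Matrix (Fin m) (Fin r) ℂ) :
    ∃ v : Fin r → ℂ, X *ᵥ v = 0 ∧ star v ⬝ᵥ v = 1 := by
  obtain ⟨v, hv, hv0⟩ := (Submodule.ne_bot_iff _).1
    (LinearMap.ker_ne_bot_of_finrank_lt (f := X.mulVecLin) (by simpa using h))
  obtain ⟨c, -, hc⟩ := exists_unit_smul hv0
  refine ⟨c • v, ?_, hc⟩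
  rw [mulVec_smul, show X *ᵥ v = 0 from hv, smul_zero]

end TwoByThree

section NormalDilation

/-- A normal matrix has a unit vector that is an eigenvector of it and of its adjoint. -/
lemma exists_common_eigenvector {κ : Type*} [Fintype κ] [DecidableEq κ] [Nonempty κ]
    {N : Matrix κ κ ℂ} (hN : N * Nᴴ = Nᴴ * N) :
    ∃ (l : ℂ) (f : κ → ℂ), star f ⬝ᵥ f = 1 ∧ N *ᵥ f = l • f ∧ Nᴴ *ᵥ f = conj l • f := by
  obtain ⟨l, hl⟩ := Module.End.exists_eigenvalue (toLin' N)
  obtain ⟨f, hf⟩ := hl.exists_hasEigenvector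
  have h1 : N *ᵥ f = l • f := by simpa using hf.apply_eq_smul
  obtain ⟨c, -, hc⟩ := exists_unit_smul hf.2
  have h1' : N *ᵥ (c • f) = l • (c • f) := by rw [mulVec_smul, h1, smul_comm]
  refine ⟨l, c • f, hc, h1', ?_⟩
  set g := c • f
  set A := N - l • (1 : Matrix κ κ ℂ)
  have hA : A *ᵥ g = 0 := by simp [A, sub_mulVec, h1', smul_mulVec]
  have hA' : A * Aᴴ = Aᴴ * A := by
    simp only [A, conjTranspose_sub, conjTranspose_smul, conjTranspose_one, sub_mul, mul_sub,
      smul_mul_assoc, mul_smul_comm, one_mul, mul_one, hN]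
    module
  have : Aᴴ *ᵥ g = 0 := by
    rw [← self_mul_conjTranspose_mulVec_eq_zero, hA', ← mulVec_mulVec, hA, mulVec_zero]
  simpa [A, sub_mulVec, smul_mulVec, sub_eq_zero] using this

variable {m : ℕ}

lemma vecMulVec_prodVec_eq_blk (c : Fin 2 → ℂ) (v : Fin m → ℂ) :
    vecMulVec (prodVec c v) (star (prodVec c v)) =
      blk fun i k => (c i * conj (c k)) • vecMulVec v (star v) := by
  ext a b
  simp [blk, prodVec, vecMulVec_apply]
  ring

lemma blk_add (A B : Fin 2 → Fin 2 → Matrix (Fin m) (Fin m) ℂ) :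
    blk A + blk B = blk (A + B) := rfl

/-- A state with factor `[R, N R]` and `N` normal is separable. -/
lemma separable_of_normal {κ : Type*} [Fintype κ] [DecidableEq κ] [Nonempty κ]
    (H : ∀ σ : Matrix (Fin 2 × Fin m) (Fin 2 × Fin m) ℂ, IsPPT σ → Separable σ)
    (hκ : Fintype.card κ ≤ m + 2) {N : Matrix κ κ ℂ} (hN : N * Nᴴ = Nᴴ * N)
    (R : Matrix κ (Fin (m + 1)) ℂ) :
    Separable ((blkRow ![R, N * R])ᴴ * blkRow ![R, N * R]) := by
  obtain ⟨l, f, hf, hNf, hNf'⟩ := exists_common_eigenvector hN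
  set p : Matrix κ κ ℂ := 1 - vecMulVec f (star f) with hp
  have hpH : pᴴ = p := by simp [hp]
  have hpf : p *ᵥ f = 0 := by
    simp [hp, sub_mulVec, vecMulVec_mulVec, hf]
  have hpp : p * p = p := by
    conv_lhs => rw [hp, sub_mul, one_mul, vecMulVec_mul]
    have : star f ᵥ* p = 0 := by
      rw [← hpH, ← star_mulVec, hpf, star_zero]
    rw [hp] at this
    simp [this, hp]
  have hpN : p * N = N * p := by
    rw [hp, sub_mul, mul_sub, one_mul, mul_one, vecMulVec_mul, mul_vecMulVec, hNf,
      ← conjTranspose_conjTranspose N, ← star_mulVec, conjTranspose_conjTranspose, hNf']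
    simp [smul_vecMulVec, vecMulVec_smul]
  have hpN' : p * Nᴴ = Nᴴ * p := by
    have := congrArg conjTranspose hpN
    rw [conjTranspose_mul, conjTranspose_mul, hpH] at this
    exact this.symm
  have hppsd : p.PosSemidef := by
    rw [← hpp]
    nth_rw 1 [← hpH]
    exact posSemidef_conjTranspose_mul_self p
  have hrank : p.rank ≤ m + 1 := by
    have hf0 : f ≠ 0 := by
      rintro rfl
      simp at hf
    have := rank_lt_of_det_eq_zero (exists_mulVec_eq_zero_iff.1 ⟨f, hf0, hpf⟩)
    omega
  obtain ⟨Z, hZ⟩ := hppsd.exists_factor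
  have hsplit : (blkRow ![R, N * R])ᴴ * blkRow ![R, N * R] =
      vecMulVec (prodVec ![1, conj l] (Rᴴ *ᵥ f)) (star (prodVec ![1, conj l] (Rᴴ *ᵥ f))) +
        (blkRow ![R, N * R])ᴴ * p * blkRow ![R, N * R] := by
    have h1 : vecMulVec (prodVec ![1, conj l] (Rᴴ *ᵥ f)) (star (prodVec ![1, conj l] (Rᴴ *ᵥ f))) =
        (blkRow ![R, N * R])ᴴ * vecMulVec f (star f) * blkRow ![R, N * R] := by
      rw [conjTranspose_blkRow_mul, vecMulVec_prodVec_eq_blk]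
      congr 1
      have e : ∀ k, (![R, N * R] k)ᴴ *ᵥ f = (![1, conj l] k) • (Rᴴ *ᵥ f) := by
        intro k
        fin_cases k
        · simp
        · simp [conjTranspose_mul, ← mulVec_mulVec, hNf', mulVec_smul]
      ext i k : 2
      rw [mul_vecMulVec, vecMulVec_mul, ← conjTranspose_conjTranspose (![R, N * R] k),
        ← star_mulVec, e, e, star_smul, smul_vecMulVec,
        vecMulVec_smul, smul_smul]
      rfl
    rw [h1, ← Matrix.add_mul, ← Matrix.mul_add, hp, add_sub_cancel, Matrix.mul_one]
  rw [hsplit]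
  refine (separable_prodVec _ _).add (separable_of_rank_le H ⟨?_, ?_⟩ hrank
    (Z * blkRow ![R, N * R]) ?_)
  · exact hppsd.conjTranspose_mul_mul_same _
  · have : pt ((blkRow ![R, N * R])ᴴ * p * blkRow ![R, N * R]) =
        (blkRow ![R, Nᴴ * R])ᴴ * p * blkRow ![R, Nᴴ * R] := by
      rw [conjTranspose_blkRow_mul, conjTranspose_blkRow_mul, pt_blk]
      congr 1
      ext i k : 2
      fin_cases i <;> fin_cases k
      · simp
      · simp only [Fin.zero_eta, Fin.mk_one, cons_val_zero, cons_val_one, conjTranspose_mul,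
          Matrix.mul_assoc]
        rw [← Matrix.mul_assoc p, hpN', Matrix.mul_assoc]
      · simp only [Fin.zero_eta, Fin.mk_one, cons_val_zero, cons_val_one, conjTranspose_mul,
          Matrix.mul_assoc, conjTranspose_conjTranspose]
        rw [← Matrix.mul_assoc p, hpN, Matrix.mul_assoc]
      · change (N * R)ᴴ * p * (N * R) = (Nᴴ * R)ᴴ * p * (Nᴴ * R)
        have : Nᴴ * p * N = N * p * Nᴴ := by
          rw [← hpN', Matrix.mul_assoc, ← hN, ← Matrix.mul_assoc, hpN]
        calc (N * R)ᴴ * p * (N * R) = Rᴴ * (Nᴴ * p * N) * R := by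
              simp only [conjTranspose_mul, Matrix.mul_assoc]
          _ = _ := by
              simp only [this, conjTranspose_mul, Matrix.mul_assoc, conjTranspose_conjTranspose]
    rw [this]
    exact hppsd.conjTranspose_mul_mul_same _
  · rw [conjTranspose_mul, Matrix.mul_assoc _ Zᴴ, ← Matrix.mul_assoc Zᴴ, ← hZ, Matrix.mul_assoc]

end NormalDilation

section TwoByThreeSeparable

/-- A nonsingular positive semidefinite matrix is congruent to the identity. -/
lemma Matrix.PosSemidef.exists_conjTranspose_mul_mul_eq_one {ι : Type*} [Fintype ι] [DecidableEq ι]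
    {A : Matrix ι ι ℂ} (hA : A.PosSemidef) (h : ∀ v, A *ᵥ v = 0 → v = 0) :
    ∃ Q : Matrix ι ι ℂ, IsUnit Q ∧ Qᴴ * A * Q = 1 := by
  have hdet : A.det ≠ 0 := fun h0 => by
    obtain ⟨v, hv, h1⟩ := exists_mulVec_eq_zero_iff.2 h0
    exact hv (h v h1)
  have hP : A.PosDef := hA.posDef_iff_isUnit.2 ((isUnit_iff_isUnit_det A).2 hdet.isUnit)
  obtain ⟨U, hU, hU', hd⟩ := hA.1.exists_diagonal
  set d := hA.1.eigenvalues with hdd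
  have hd0 : ∀ i, 0 < d i := hP.eigenvalues_pos
  set T : Matrix ι ι ℂ := diagonal fun i => ((Real.sqrt (d i))⁻¹ : ℂ) with hT
  have h1 : (U * T)ᴴ * A * (U * T) = 1 := by
    have hTT : Tᴴ * diagonal (fun i => (d i : ℂ)) * T = 1 := by
      rw [hT, diagonal_conjTranspose, diagonal_mul_diagonal, diagonal_mul_diagonal, ← diagonal_one]
      congr 1
      ext i
      have h2 : ((Real.sqrt (d i) : ℝ) : ℂ) ≠ 0 := by exact_mod_cast (Real.sqrt_pos.2 (hd0 i)).ne'
      have h3 : ((d i : ℝ) : ℂ) = (Real.sqrt (d i) : ℂ) * (Real.sqrt (d i) : ℂ) := by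
        exact_mod_cast (Real.mul_self_sqrt (hd0 i).le).symm
      simp only [Pi.star_apply, star_inv₀, Complex.star_def, Complex.conj_ofReal]
      rw [h3]
      field_simp
    rw [hd, conjTranspose_mul]
    calc Tᴴ * Uᴴ * (U * diagonal (fun i => (d i : ℂ)) * Uᴴ) * (U * T)
        = Tᴴ * (Uᴴ * U) * diagonal (fun i => (d i : ℂ)) * (Uᴴ * U) * T := by
          simp only [Matrix.mul_assoc]
      _ = 1 := by rw [hU, Matrix.mul_one, Matrix.mul_one, hTT]
  exact ⟨U * T, IsUnit.of_mul_eq_one_right _ h1, h1⟩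

variable {m : ℕ}

/-- The `(i, k)` block of a matrix on `ℂ^n ⊗ ℂ^m`. -/
def bl {n : ℕ} (σ : Matrix (Fin n × Fin m) (Fin n × Fin m) ℂ) (i k : Fin n) :
    Matrix (Fin m) (Fin m) ℂ := Matrix.of fun j l => σ (i, j) (k, l)

lemma blk_bl (σ : Matrix (Fin 2 × Fin m) (Fin 2 × Fin m) ℂ) : blk (bl σ) = σ := rfl

lemma exists_vecMulVec_add_mul_conjTranspose {X : Matrix (Fin (m + 1)) (Fin m) ℂ}
    (h : Xᴴ * X = 1) : ∃ v, vecMulVec v (star v) + X * Xᴴ = 1 := by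
  obtain ⟨v, hv, hv1⟩ := exists_unit_vec_of_lt (Nat.lt_succ_self m) Xᴴ
  refine ⟨v, ?_⟩
  set M : Matrix (Fin (m + 1)) (Fin (m + 1)) ℂ :=
    Matrix.of fun i j => (Fin.cons (v i) (X i) : Fin (m + 1) → ℂ) j with hM
  have hv' : ∀ j, ∑ i, conj (X i j) * v i = 0 := fun j => congrFun hv j
  have h1 : Mᴴ * M = 1 := by
    ext i j
    refine Fin.cases ?_ (fun i => ?_) i <;> refine Fin.cases ?_ (fun j => ?_) j
    · simpa [Matrix.mul_apply, hM, dotProduct] using hv1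
    · have := congrArg conj (hv' j)
      simp only [map_sum, map_mul, Complex.conj_conj, map_zero] at this
      simpa [Matrix.mul_apply, hM, mul_comm, Matrix.one_apply, (Fin.succ_ne_zero j).symm] using this
    · simpa [Matrix.mul_apply, hM, Matrix.one_apply] using hv' i
    · have := congrFun (congrFun h i) j
      simpa [Matrix.mul_apply, hM, Matrix.one_apply] using this
  have h2 := mul_eq_one_comm.1 h1
  rw [← h2]
  ext i j
  simp [Matrix.mul_apply, hM, Fin.sum_univ_succ, vecMulVec_apply]

lemma exists_bl_eq_vecMulVec_add {σ : Matrix (Fin 2 × Fin m) (Fin 2 × Fin m) ℂ}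
    (hσ : σ.PosSemidef) (hr : σ.rank = m + 1) (h0 : bl σ 0 0 = 1) :
    ∃ u, bl σ 1 1 = vecMulVec u (star u) + (bl σ 0 1)ᴴ * bl σ 0 1 := by
  obtain ⟨X, hX⟩ := hσ.exists_factor
  generalize σ.rank = r at *
  subst hr
  set Y : Fin 2 → Matrix (Fin (m + 1)) (Fin m) ℂ := fun i => Matrix.of fun s j => X s (i, j) with hY
  have hb : ∀ i k, bl σ i k = (Y i)ᴴ * Y k := by
    intro i k
    ext j l
    simp [bl, hX, Matrix.mul_apply, hY]
  obtain ⟨v, hv⟩ := exists_vecMulVec_add_mul_conjTranspose ((hb 0 0).symm.trans h0)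
  refine ⟨(Y 1)ᴴ *ᵥ v, ?_⟩
  rw [vecMulVec_mulVec_star, hb 1 1, hb 0 1, conjTranspose_mul, conjTranspose_conjTranspose]
  calc (Y 1)ᴴ * Y 1 = (Y 1)ᴴ * (vecMulVec v (star v) + Y 0 * (Y 0)ᴴ) * Y 1 := by
        rw [hv, Matrix.mul_one]
    _ = _ := by
        simp only [Matrix.mul_add, Matrix.add_mul, Matrix.mul_assoc, conjTranspose_conjTranspose]

lemma rank_loc {n : ℕ} {P : Matrix (Fin n) (Fin n) ℂ} {Q : Matrix (Fin m) (Fin m) ℂ}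
    (hP : IsUnit P) (hQ : IsUnit Q) (ρ : Matrix (Fin n × Fin m) (Fin n × Fin m) ℂ) :
    (loc P Q ρ).rank = ρ.rank := by
  have h1 : IsUnit (P ⊗ₖ Q).det := by
    rw [det_kronecker]
    exact (((isUnit_iff_isUnit_det P).1 hP).pow _).mul (((isUnit_iff_isUnit_det Q).1 hQ).pow _)
  have h2 : IsUnit (P ⊗ₖ Q)ᴴ.det := by
    rw [det_conjTranspose]
    exact h1.star
  rw [loc, rank_mul_eq_left_of_isUnit_det _ _ h1, rank_mul_eq_right_of_isUnit_det _ _ h2]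

lemma separable_two_three_of_bl_eq_one {σ : Matrix (Fin 2 × Fin 3) (Fin 2 × Fin 3) ℂ}
    (h : IsPPT σ) (hr : σ.rank = 4) (hr' : (pt σ).rank = 4) (h0 : bl σ 0 0 = 1) :
    Separable σ := by
  obtain ⟨u, hu⟩ := exists_bl_eq_vecMulVec_add h.1 hr h0
  obtain ⟨b, hb⟩ := exists_bl_eq_vecMulVec_add h.2 hr' h0
  have e10 : bl σ 1 0 = (bl σ 0 1)ᴴ := by
    ext j l
    exact (h.1.1.apply (1, j) (0, l)).symm
  rw [show bl (pt σ) 1 1 = bl σ 1 1 from rfl, show bl (pt σ) 0 1 = bl σ 1 0 from rfl, e10,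
    conjTranspose_conjTranspose] at hb
  set D := bl σ 0 1 with hD
  have hQ : D * Dᴴ - Dᴴ * D = vecMulVec u (star u) - vecMulVec b (star b) := by
    exact sub_eq_sub_iff_add_eq_add.2 ((add_comm _ _).trans (hu.symm.trans hb).symm)
  by_cases hne : D * Dᴴ = Dᴴ * D
  · have e : σ = vecMulVec (prodVec ![0, 1] u) (star (prodVec ![0, 1] u)) +
        (blkRow ![1, D * 1])ᴴ * blkRow ![1, D * 1] := by
      have := conjTranspose_blkRow_mul ![1, D * 1] 1
      rw [Matrix.mul_one] at this
      rw [this, vecMulVec_prodVec_eq_blk, blk_add, ← blk_bl σ]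
      congr 1
      ext i k : 2
      fin_cases i <;> fin_cases k
      · simp [h0]
      · simp [hD]
      · simp [e10]
      · simp [hu]
    rw [e]
    exact (separable_prodVec _ _).add
      (separable_of_normal separable_two_two (by simp) hne 1)
  · obtain ⟨w, h', hw, hh⟩ := exists_normal_extension hQ hne
    set c := w • b with hc
    have hcc : vecMulVec c (star c) = vecMulVec b (star b) := by
      rw [hc, star_smul, smul_vecMulVec, vecMulVec_smul, smul_smul, Complex.star_def, hw, one_smul]
    rw [← hcc] at hQ
    have htr : star u ⬝ᵥ u = star c ⬝ᵥ c := by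
      have := congrArg trace hQ
      rw [trace_sub, trace_sub, trace_mul_comm, sub_self, trace_vecMulVec, trace_vecMulVec,
        eq_comm, sub_eq_zero] at this
      rw [dotProduct_comm, this, dotProduct_comm]
    set N : Matrix (Unit ⊕ Fin 3) (Unit ⊕ Fin 3) ℂ :=
      fromBlocks (of fun _ _ => h') (replicateRow Unit (star u)) (replicateCol Unit c) D with hN
    have hNN : N * Nᴴ = Nᴴ * N := by
      have h1 : D * Dᴴ + vecMulVec c (star c) = vecMulVec u (star u) + Dᴴ * D :=
        sub_eq_sub_iff_add_eq_add.1 hQ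
      have h2 : ∀ i, h' * conj (c i) + ∑ j, conj (u j) * conj (D i j) =
          conj h' * conj (u i) + ∑ j, conj (c j) * D j i := by
        intro i
        have := congrArg conj (congrFun hh i)
        simp [mulVec, dotProduct] at this
        simp only [mul_comm (conj (u _)), mul_comm (conj (c _)) (D _ _)]
        linear_combination -this
      have h3 : ∀ i j, (N * Nᴴ) (.inr i) j = (Nᴴ * N) (.inr i) j := by
        intro i j
        rcases j with j | j
        · have := congrArg conj (h2 i)
          simp only [map_add, map_mul, Complex.conj_conj, Fin.sum_univ_three] at this
          simp [hN, Matrix.mul_apply, Fin.sum_univ_three]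
          linear_combination this
        · have := congrFun (congrFun h1 i) j
          simp [vecMulVec_apply, Matrix.mul_apply] at this
          simp [hN, Matrix.mul_apply]
          linear_combination this
      ext i j
      rcases i with i | i
      · rcases j with j | j
        · simp [dotProduct] at htr
          simp [hN, Matrix.mul_apply]
          linear_combination htr
        · have e1 : (N * Nᴴ).IsHermitian := isHermitian_mul_conjTranspose_self N
          have e2 : (Nᴴ * N).IsHermitian := isHermitian_conjTranspose_mul_self N
          rw [← e1.apply, ← e2.apply, h3]
      · exact h3 i j
    set R : Matrix (Unit ⊕ Fin 3) (Fin 3) ℂ := fromRows 0 1 with hRdef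
    have e : σ = (blkRow ![R, N * R])ᴴ * blkRow ![R, N * R] := by
      have := conjTranspose_blkRow_mul ![R, N * R] 1
      rw [Matrix.mul_one] at this
      rw [this, ← blk_bl σ]
      congr 1
      ext i k : 2
      have hR : Rᴴ * R = 1 := by
        rw [hRdef, conjTranspose_fromRows_eq_fromCols_conjTranspose, fromCols_mul_fromRows]
        simp
      have hNR : N * R = fromRows (replicateRow Unit (star u)) D := by
        rw [hN, hRdef, fromBlocks_mul_fromRows]
        simp
      rw [hNR]
      have hRD : Rᴴ *
          fromRows (replicateRow Unit (star u)) D = D := by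
        rw [hRdef, conjTranspose_fromRows_eq_fromCols_conjTranspose, fromCols_mul_fromRows]
        simp
      have hDD : (fromRows (replicateRow Unit (star u)) D)ᴴ *
          fromRows (replicateRow Unit (star u)) D = vecMulVec u (star u) + Dᴴ * D := by
        rw [conjTranspose_fromRows_eq_fromCols_conjTranspose, fromCols_mul_fromRows]
        congr 1
        ext i j
        simp [Matrix.mul_apply, vecMulVec_apply]
      rw [Matrix.mul_one]
      fin_cases i <;> fin_cases k
      · exact h0.trans hR.symm
      · exact hRD.symm
      · refine e10.trans ?_
        have := congrArg conjTranspose hRD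
        rw [conjTranspose_mul, conjTranspose_conjTranspose] at this
        exact this.symm
      · exact hu.trans hDD.symm
    rw [e]
    exact separable_of_normal separable_two_two (by simp) hNN R

lemma separable_two_three (ρ : Matrix (Fin 2 × Fin 3) (Fin 2 × Fin 3) ℂ) (h : IsPPT ρ) :
    Separable ρ := by
  refine separable_of_forall_of_rank separable_two_two (fun σ hσ h1 h2 h3 h4 => ?_) ρ h
  have hr : σ.rank = 4 := by nlinarith
  have hr' : (pt σ).rank = 4 := by nlinarith
  have hb : (bl σ 0 0).PosSemidef := hσ.1.submatrix (Prod.mk 0)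
  obtain ⟨Q, hQ, hQ1⟩ := hb.exists_conjTranspose_mul_mul_eq_one fun v hv => by
    by_contra hv0
    refine h4 ![1, 0] v (by simp) hv0 ((hσ.1.dotProduct_mulVec_zero_iff _).1 ?_)
    have : star v ⬝ᵥ bl σ 0 0 *ᵥ v = 0 := by rw [hv, dotProduct_zero]
    refine Eq.trans ?_ this
    simp [dotProduct, mulVec, prodVec, Fintype.sum_prod_type, Fin.sum_univ_two, bl]
  refine Separable.of_loc isUnit_one hQ
    (separable_two_three_of_bl_eq_one (hσ.loc _ _) ?_ ?_ ?_)
  · rw [rank_loc isUnit_one hQ, hr]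
  · rw [pt_loc, rank_loc (by simp) hQ, hr']
  · rw [← hQ1]
    ext j l
    rw [bl, Matrix.of_apply, loc_one_apply]
    simp [Matrix.mul_apply, Finset.sum_mul, bl]

lemma separable_three_two (ρ : Matrix (Fin 3 × Fin 2) (Fin 3 × Fin 2) ℂ) (h : IsPPT ρ) :
    Separable ρ :=
  (separable_two_three _ h.swp).swp

end TwoByThreeSeparable

section Segre

open MvPolynomial

/-- The comorphism `z_{ij} ↦ x_i y_j` of the Segre embedding of `ℙ² × ℙ²`. -/
noncomputable def segre :
    MvPolynomial (Fin 3 × Fin 3) ℂ →ₐ[ℂ] MvPolynomial (Fin 3 ⊕ Fin 3) ℂ :=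
  aeval fun p => X (Sum.inl p.1) * X (Sum.inr p.2)

lemma segre_X (p : Fin 3 × Fin 3) : segre (X p) = X (Sum.inl p.1) * X (Sum.inr p.2) := by
  rw [segre, aeval_X]

/-- Setting the variables in `S` to zero. -/
noncomputable def killVars (S : Finset (Fin 3 ⊕ Fin 3)) :
    MvPolynomial (Fin 3 ⊕ Fin 3) ℂ →ₐ[ℂ] MvPolynomial (Fin 3 ⊕ Fin 3) ℂ :=
  aeval fun v => if v ∈ S then 0 else X v

lemma killVars_X (S : Finset (Fin 3 ⊕ Fin 3)) (v : Fin 3 ⊕ Fin 3) :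
    killVars S (X v) = if v ∈ S then 0 else X v := by
  rw [killVars, aeval_X]

lemma killVars_killVars {S T : Finset (Fin 3 ⊕ Fin 3)} (h : S ⊆ T)
    (p : MvPolynomial (Fin 3 ⊕ Fin 3) ℂ) : killVars T (killVars S p) = killVars T p := by
  have : (killVars T).comp (killVars S) = killVars T := by
    apply MvPolynomial.algHom_ext
    intro v
    rw [AlgHom.comp_apply, killVars_X, killVars_X]
    by_cases hv : v ∈ S
    · simp [hv, h hv]
    · simp [hv, killVars_X]
  exact congrArg (fun f => f p) this

/-- The prime ideal of the coordinate ring of the Segre cone where the variables in `S` vanish. -/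
noncomputable def segrePrime (S : Finset (Fin 3 ⊕ Fin 3)) : Ideal segre.range :=
  RingHom.ker ((killVars S).comp segre.range.val)

instance (S : Finset (Fin 3 ⊕ Fin 3)) : (segrePrime S).IsPrime := RingHom.ker_isPrime _

lemma mem_segrePrime {S : Finset (Fin 3 ⊕ Fin 3)} {a : segre.range} :
    a ∈ segrePrime S ↔ killVars S a.1 = 0 := Iff.rfl

/-- The generators `x_i y_j` of the coordinate ring of the Segre cone. -/
noncomputable def segreGen (p : Fin 3 × Fin 3) : segre.range := segre.rangeRestrict (X p)

lemma coe_segreGen (p : Fin 3 × Fin 3) :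
    (segreGen p : MvPolynomial (Fin 3 ⊕ Fin 3) ℂ) = X (Sum.inl p.1) * X (Sum.inr p.2) :=
  segre_X p

lemma segreGen_mem_segrePrime {S : Finset (Fin 3 ⊕ Fin 3)} {p : Fin 3 × Fin 3} :
    segreGen p ∈ segrePrime S ↔ Sum.inl p.1 ∈ S ∨ Sum.inr p.2 ∈ S := by
  rw [mem_segrePrime, coe_segreGen, map_mul, killVars_X, killVars_X, mul_eq_zero]
  split_ifs <;> simp [*]

lemma segrePrime_lt {S T : Finset (Fin 3 ⊕ Fin 3)} (h : S ⊆ T) (p : Fin 3 × Fin 3)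
    (h1 : Sum.inl p.1 ∈ T ∨ Sum.inr p.2 ∈ T) (h2 : ¬ (Sum.inl p.1 ∈ S ∨ Sum.inr p.2 ∈ S)) :
    segrePrime S < segrePrime T := by
  refine lt_of_le_of_ne (fun a ha => ?_) fun he => h2 ?_
  · rw [mem_segrePrime] at ha ⊢
    rw [← killVars_killVars h, ha, map_zero]
  · rw [← segreGen_mem_segrePrime, he, segreGen_mem_segrePrime]
    exact h1

lemma five_le_height_segrePrime_univ : 5 ≤ (segrePrime Finset.univ).height := by
  have step : ∀ {S T : Finset (Fin 3 ⊕ Fin 3)} {n : ℕ∞}, segrePrime S < segrePrime T →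
      n ≤ (segrePrime S).height → n + 1 ≤ (segrePrime T).height := fun hlt hn =>
    (add_le_add_left hn 1).trans (Ideal.height_add_one_le_of_lt_of_isPrime hlt)
  have h1 : segrePrime ∅ < segrePrime {.inl 2} := segrePrime_lt (by simp) (2, 0) (by simp) (by simp)
  have h2 : segrePrime {.inl 2} < segrePrime {.inl 1, .inl 2} :=
    segrePrime_lt (by decide) (1, 0) (by simp) (by simp)
  have h3 : segrePrime {.inl 1, .inl 2} < segrePrime {.inl 1, .inl 2, .inr 2} :=
    segrePrime_lt (by decide) (0, 2) (by simp) (by simp)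
  have h4 : segrePrime {.inl 1, .inl 2, .inr 2} < segrePrime {.inl 1, .inl 2, .inr 1, .inr 2} :=
    segrePrime_lt (by decide) (0, 1) (by simp) (by simp)
  have h5 : segrePrime {.inl 1, .inl 2, .inr 1, .inr 2} < segrePrime Finset.univ :=
    segrePrime_lt (by simp) (0, 0) (by simp) (by simp)
  exact step h5 (step h4 (step h3 (step h2 (step h1 (zero_le (a := (segrePrime ∅).height))))))

/-- Four bilinear forms on `ℂ³ × ℂ³` have a common nontrivial zero. -/
lemma exists_prodVec_mulVec_eq_zero_of_four (B : Matrix (Fin 4) (Fin 3 × Fin 3) ℂ) :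
    ∃ (φ ψ : Fin 3 → ℂ), φ ≠ 0 ∧ ψ ≠ 0 ∧ B *ᵥ prodVec φ ψ = 0 := by
  classical
  by_contra hB
  have hft : Algebra.FiniteType ℂ segre.range :=
    Algebra.FiniteType.of_surjective segre.rangeRestrict segre.rangeRestrict_surjective
  have : IsNoetherianRing segre.range := Algebra.FiniteType.isNoetherianRing ℂ _
  have hjac : IsJacobsonRing segre.range := isJacobsonRing_of_finiteType (A := ℂ)
  set b : Fin 4 → MvPolynomial (Fin 3 × Fin 3) ℂ := fun s => ∑ p, C (B s p) * X p with hb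
  set I : Ideal segre.range :=
    Ideal.span (Finset.univ.image fun s => segre.rangeRestrict (b s) : Finset segre.range) with hI
  have hbI : ∀ s, segre.rangeRestrict (b s) ∈ I := fun s =>
    Ideal.subset_span (by simp)
  have hmax : ∀ J : Ideal segre.range, J.IsMaximal → I ≤ J → segrePrime Finset.univ ≤ J := by
    intro J hJ hIJ
    have hJ' := Ideal.comap_isMaximal_of_surjective segre.rangeRestrict
      segre.rangeRestrict_surjective (K := J)
    obtain ⟨z, hz⟩ := isMaximal_iff_eq_vanishingIdeal_singleton.1 hJ'
    have hz' : ∀ p, segre.rangeRestrict p ∈ J ↔ aeval z p = 0 := fun p => by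
      rw [← mem_vanishingIdeal_singleton_iff, ← hz, Ideal.mem_comap]
    have hminor : ∀ i j k l, z (i, j) * z (k, l) = z (i, l) * z (k, j) := by
      intro i j k l
      have h0 : segre.rangeRestrict (X (i, j) * X (k, l) - X (i, l) * X (k, j)) = 0 := by
        apply Subtype.ext
        change segre _ = 0
        simp only [map_sub, map_mul, segre_X]
        ring
      have := (hz' (X (i, j) * X (k, l) - X (i, l) * X (k, j))).1 (h0 ▸ J.zero_mem)
      simpa [sub_eq_zero] using this
    have hBz : B *ᵥ z = 0 := by
      ext s
      simpa [hb, mulVec, dotProduct] using (hz' (b s)).1 (hIJ (hbI s))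
    have hz0 : z = 0 := by
      by_contra hne
      obtain ⟨⟨i, j⟩, hij⟩ := Function.ne_iff.1 hne
      refine hB ⟨fun k => z (k, j), fun l => z (i, l), fun h => hij (congrFun h i),
        fun h => hij (congrFun h j), ?_⟩
      have : prodVec (fun k => z (k, j)) (fun l => z (i, l)) = z (i, j) • z := by
        ext ⟨k, l⟩
        simp only [prodVec, Pi.smul_apply, smul_eq_mul]
        rw [mul_comm, ← hminor]
      rw [this, mulVec_smul, hBz, smul_zero]
    intro a ha
    obtain ⟨p, rfl⟩ := segre.rangeRestrict_surjective a
    rw [hz', hz0, aeval_zero]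
    rw [mem_segrePrime] at ha
    have h1 : ((killVars Finset.univ).comp segre) = aeval (0 : Fin 3 × Fin 3 → _) := by
      apply MvPolynomial.algHom_ext
      intro v
      simp [segre, killVars]
    have h2 : killVars Finset.univ (segre p) = 0 := ha
    rw [← AlgHom.comp_apply, h1, aeval_zero] at h2
    simpa using h2
  have hle : I ≤ segrePrime Finset.univ := by
    rw [hI, Ideal.span_le]
    intro a ha
    simp only [Finset.coe_image, Finset.coe_univ, Set.image_univ, Set.mem_range] at ha
    obtain ⟨s, rfl⟩ := ha
    change killVars Finset.univ (segre (b s)) = 0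
    simp [hb, segre_X, killVars_X]
  obtain ⟨P, hP, hPle⟩ := Ideal.exists_minimalPrimes_le hle
  have hPp : P.IsPrime := hP.1.1
  have hPeq : P = segrePrime Finset.univ := by
    refine le_antisymm hPle ?_
    rw [← hjac.out hPp.isRadical, Ideal.jacobson]
    exact le_sInf fun J hJ => hmax J hJ.2 (hP.1.2.trans hJ.1)
  have h4 := Ideal.height_le_card_of_mem_minimalPrimes_span_finset hP
  rw [hPeq] at h4
  have h5 := five_le_height_segrePrime_univ.trans h4
  have h6 : (Finset.univ.image fun s => segre.rangeRestrict (b s)).card ≤ 4 :=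
    Finset.card_image_le.trans (by simp)
  have h7 : (5 : ℕ) ≤ (Finset.univ.image fun s => segre.rangeRestrict (b s)).card := by
    exact_mod_cast h5
  omega

end Segre

section NormalForm

/-- The matrix `1 ⊕ U`. -/
def oneSum (U : Matrix (Fin 2) (Fin 2) ℂ) : Matrix (Fin 3) (Fin 3) ℂ :=
  Matrix.of fun i j => Fin.cases (Fin.cases 1 (fun _ => 0) j)
    (fun i' => Fin.cases 0 (fun j' => U i' j') j) i

section OneSum

variable (U V : Matrix (Fin 2) (Fin 2) ℂ) (i j : Fin 2)

@[simp] lemma oneSum_zero_zero : oneSum U 0 0 = 1 := rfl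
@[simp] lemma oneSum_zero_succ : oneSum U 0 j.succ = 0 := rfl
@[simp] lemma oneSum_succ_zero : oneSum U i.succ 0 = 0 := rfl
@[simp] lemma oneSum_succ_succ : oneSum U i.succ j.succ = U i j := rfl

lemma sum_fin_three (f : Fin 3 → ℂ) : ∑ i, f i = f 0 + ∑ i : Fin 2, f i.succ :=
  Fin.sum_univ_succ f

lemma oneSum_one : oneSum 1 = 1 := by
  ext i j
  refine Fin.cases ?_ (fun i => ?_) i <;> refine Fin.cases ?_ (fun j => ?_) j <;>
    simp [Matrix.one_apply, (Fin.succ_ne_zero _).symm]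

lemma oneSum_mul : oneSum U * oneSum V = oneSum (U * V) := by
  ext i j
  refine Fin.cases ?_ (fun i => ?_) i <;> refine Fin.cases ?_ (fun j => ?_) j <;>
    simp only [Matrix.mul_apply, sum_fin_three, oneSum_zero_zero, oneSum_zero_succ,
      oneSum_succ_zero, oneSum_succ_succ] <;> simp

variable {U}

lemma IsUnit.oneSum (hU : IsUnit U) : IsUnit (oneSum U) := by
  obtain ⟨V, hV⟩ := hU.exists_right_inv
  exact IsUnit.of_mul_eq_one _ (by rw [oneSum_mul, hV, oneSum_one])

end OneSum

section Gram

variable {ι κ : Type*} [Fintype ι] [DecidableEq ι] [Fintype κ] [DecidableEq κ]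

lemma Matrix.PosSemidef.sub_conjTranspose_mul {M : Matrix ι ι ℂ} (hM : M.PosSemidef) (e : κ → ι)
    (h : M.submatrix e e = 1) :
    (M - (M.submatrix e id)ᴴ * M.submatrix e id).PosSemidef := by
  obtain ⟨X, hX⟩ := hM.exists_factor
  set Y := X.submatrix id e
  have hY : Yᴴ * Y = 1 := (congrArg (·.submatrix e e) hX).symm.trans h
  have hMe : M.submatrix e id = Yᴴ * X := by
    ext i j
    simp [hX, Matrix.mul_apply, Y]
  set p := 1 - Y * Yᴴ with hp
  have hpH : pᴴ = p := by simp [hp]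
  have hpp : p * p = p := by
    simp only [hp, sub_mul, mul_sub, one_mul, mul_one]
    rw [Matrix.mul_assoc Y, ← Matrix.mul_assoc Yᴴ, hY, Matrix.one_mul]
    simp
  have : M - (M.submatrix e id)ᴴ * M.submatrix e id = (p * X)ᴴ * (p * X) := by
    rw [conjTranspose_mul, hpH, Matrix.mul_assoc, ← Matrix.mul_assoc p, hpp, hMe,
      conjTranspose_mul, conjTranspose_conjTranspose, hp, Matrix.sub_mul, Matrix.one_mul,
      Matrix.mul_sub, ← hX]
    simp only [Matrix.mul_assoc]
  rw [this]
  exact posSemidef_conjTranspose_mul_self _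

lemma Matrix.PosSemidef.eq_conjTranspose_mul_of_rank_le {M : Matrix ι ι ℂ} (hM : M.PosSemidef)
    (e : κ → ι) (h : M.submatrix e e = 1) (hr : M.rank ≤ Fintype.card κ) :
    M = (M.submatrix e id)ᴴ * M.submatrix e id := by
  obtain ⟨X, hX⟩ := hM.exists_factor
  set Y := X.submatrix id e
  have hY : Yᴴ * Y = 1 := (congrArg (·.submatrix e e) hX).symm.trans h
  have hMe : M.submatrix e id = Yᴴ * X := congrArg (·.submatrix e id) hX
  have hcard : Fintype.card (Fin M.rank) = Fintype.card κ := by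
    refine le_antisymm (by simpa using hr) ?_
    have h1 : (Yᴴ * Y).rank ≤ Fintype.card (Fin M.rank) :=
      (rank_mul_le_left _ _).trans (rank_le_card_width _)
    rwa [hY, rank_one] at h1
  have hYY := (mul_eq_one_comm_of_card_eq _ _ _ hcard.symm).1 hY
  rw [hMe, conjTranspose_mul, conjTranspose_conjTranspose, Matrix.mul_assoc, ← Matrix.mul_assoc Y,
    hYY, Matrix.one_mul]
  exact hX

end Gram

/-- The rows of the normal form of a rank four state with kernel vector `e₀ ⊗ e₀`. -/
def nfX (c : Fin 2 → Fin 2 → Fin 2 → ℂ) (D : Fin 2 → Matrix (Fin 2) (Fin 2) ℂ) :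
    Matrix (Fin 2 ⊕ Fin 2) (Fin 3 × Fin 3) ℂ :=
  Matrix.of fun s a => Sum.elim
    (fun m => (Fin.cases 0 (fun k => Fin.cases ((1 : Matrix (Fin 2) (Fin 2) ℂ) m k)
      (fun l => c m k l) a.2) a.1 : ℂ))
    (fun j => Fin.cases (Fin.cases 0 (fun l => (1 : Matrix (Fin 2) (Fin 2) ℂ) j l) a.2)
      (fun k => Fin.cases 0 (fun l => D k j l) a.2) a.1) s

/-- The positions of the identity block of the normal form. -/
def nfIdx : Fin 2 ⊕ Fin 2 → Fin 3 × Fin 3 := Sum.elim (fun m => (m.succ, 0)) fun j => (0, j.succ)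

/-- The normal form of a rank four state with kernel vector `e₀ ⊗ e₀`. -/
def nf (c : Fin 2 → Fin 2 → Fin 2 → ℂ) (D : Fin 2 → Matrix (Fin 2) (Fin 2) ℂ) :
    Matrix (Fin 3 × Fin 3) (Fin 3 × Fin 3) ℂ := (nfX c D)ᴴ * nfX c D

section NfX

variable (c : Fin 2 → Fin 2 → Fin 2 → ℂ) (D : Fin 2 → Matrix (Fin 2) (Fin 2) ℂ) (m j k l : Fin 2)

@[simp] lemma nfX_inl_zero (l : Fin 3) : nfX c D (.inl m) (0, l) = 0 := rfl
@[simp] lemma nfX_inl_succ_zero :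
    nfX c D (.inl m) (k.succ, 0) = (1 : Matrix (Fin 2) (Fin 2) ℂ) m k := rfl
@[simp] lemma nfX_inl_succ_succ : nfX c D (.inl m) (k.succ, l.succ) = c m k l := rfl
@[simp] lemma nfX_inr_zero (k : Fin 3) : nfX c D (.inr j) (k, 0) = 0 := by
  refine Fin.cases ?_ (fun k => ?_) k <;> rfl
@[simp] lemma nfX_inr_zero_succ :
    nfX c D (.inr j) (0, l.succ) = (1 : Matrix (Fin 2) (Fin 2) ℂ) j l := rfl
@[simp] lemma nfX_inr_succ_succ : nfX c D (.inr j) (k.succ, l.succ) = D k j l := rfl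

lemma nf_apply (a b : Fin 3 × Fin 3) :
    nf c D a b = (∑ m, conj (nfX c D (.inl m) a) * nfX c D (.inl m) b) +
      ∑ j, conj (nfX c D (.inr j) a) * nfX c D (.inr j) b := by
  simp [nf, Matrix.mul_apply]

lemma nf_succ_zero_succ_zero :
    nf c D (m.succ, 0) (k.succ, 0) = (1 : Matrix (Fin 2) (Fin 2) ℂ) m k := by
  simp [nf_apply, Matrix.one_apply, eq_comm]

lemma nf_zero_succ_zero_succ :
    nf c D (0, j.succ) (0, l.succ) = (1 : Matrix (Fin 2) (Fin 2) ℂ) j l := by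
  simp [nf_apply, Matrix.one_apply, eq_comm]

lemma nf_succ_zero_succ_succ : nf c D (m.succ, 0) (k.succ, l.succ) = c m k l := by
  simp [nf_apply, Matrix.one_apply]

lemma nf_zero_succ_succ_succ : nf c D (0, j.succ) (k.succ, l.succ) = D k j l := by
  simp [nf_apply, Matrix.one_apply]

lemma nf_zero_zero : nf c D (0, 0) (0, 0) = 0 := by
  simp [nf_apply]

end NfX

lemma submatrix_nfIdx_eq_one {M : Matrix (Fin 3 × Fin 3) (Fin 3 × Fin 3) ℂ} (h : IsPPT M)
    (h0 : M (0, 0) (0, 0) = 0)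
    (hP : ∀ m k : Fin 2, M (m.succ, 0) (k.succ, 0) = (1 : Matrix (Fin 2) (Fin 2) ℂ) m k)
    (hQ : ∀ j l : Fin 2, M (0, j.succ) (0, l.succ) = (1 : Matrix (Fin 2) (Fin 2) ℂ) j l) :
    M.submatrix nfIdx nfIdx = 1 := by
  have h1 := fun k l => h.apply_eq_zero h0 k l
  ext (s | s) (t | t)
  · simp [nfIdx, hP, Matrix.one_apply]
  · simpa [nfIdx] using h1 s.succ t.succ
  · have := congrArg conj (h1 t.succ s.succ)
    rw [← h.1.1.apply] at this
    simpa [nfIdx] using this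
  · simp [nfIdx, hQ, Matrix.one_apply]

lemma submatrix_nfIdx_id {M : Matrix (Fin 3 × Fin 3) (Fin 3 × Fin 3) ℂ} (h : IsPPT M)
    (h0 : M (0, 0) (0, 0) = 0)
    (hP : ∀ m k : Fin 2, M (m.succ, 0) (k.succ, 0) = (1 : Matrix (Fin 2) (Fin 2) ℂ) m k)
    (hQ : ∀ j l : Fin 2, M (0, j.succ) (0, l.succ) = (1 : Matrix (Fin 2) (Fin 2) ℂ) j l) :
    M.submatrix nfIdx id = nfX (fun m k l => M (m.succ, 0) (k.succ, l.succ))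
      fun k => Matrix.of fun j l => M (0, j.succ) (k.succ, l.succ) := by
  have h3 : ∀ k l, M (0, k) (l, 0) = 0 := fun k l => by
    have := congrArg conj (h.apply_eq_zero h0 l k)
    rw [← h.1.1.apply]
    simpa using this
  have h4 := fun k l => h.apply_eq_zero h0 k l
  ext (s | s) ⟨k, l⟩
  · refine Fin.cases ?_ (fun k => ?_) k
    · simpa [nfIdx] using h4 s.succ l
    · refine Fin.cases ?_ (fun l => ?_) l
      · simpa [nfIdx] using hP s k
      · rfl
  · refine Fin.cases ?_ (fun l => ?_) l
    · simpa [nfIdx] using h3 s.succ k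
    · refine Fin.cases ?_ (fun k => ?_) k
      · simpa [nfIdx] using hQ s l
      · rfl

/-- A rank four PPT state with normalised blocks is in normal form. -/
lemma eq_nf {M : Matrix (Fin 3 × Fin 3) (Fin 3 × Fin 3) ℂ} (h : IsPPT M)
    (hr : M.rank ≤ 4) (h0 : M (0, 0) (0, 0) = 0)
    (hP : ∀ m k : Fin 2, M (m.succ, 0) (k.succ, 0) = (1 : Matrix (Fin 2) (Fin 2) ℂ) m k)
    (hQ : ∀ j l : Fin 2, M (0, j.succ) (0, l.succ) = (1 : Matrix (Fin 2) (Fin 2) ℂ) j l) :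
    M = nf (fun m k l => M (m.succ, 0) (k.succ, l.succ))
      fun k => Matrix.of fun j l => M (0, j.succ) (k.succ, l.succ) := by
  rw [nf, ← submatrix_nfIdx_id h h0 hP hQ]
  exact h.1.eq_conjTranspose_mul_of_rank_le nfIdx (submatrix_nfIdx_eq_one h h0 hP hQ)
    (by simpa using hr)

end NormalForm

section PartialTranspose

variable {c : Fin 2 → Fin 2 → Fin 2 → ℂ} {D : Fin 2 → Matrix (Fin 2) (Fin 2) ℂ}

lemma trace_nf_transpose :
    (nf (fun m k => c k m) fun k => (D k)ᴴ).trace = (nf c D).trace := by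
  simp only [trace, diag, Fintype.sum_prod_type, sum_fin_three, Fin.sum_univ_two, nf_apply,
    nfX_inl_zero, nfX_inl_succ_zero, nfX_inl_succ_succ, nfX_inr_zero, nfX_inr_zero_succ,
    nfX_inr_succ_succ, conjTranspose_apply, Complex.star_def, Complex.conj_conj]
  ring

lemma trace_pt {n m : ℕ} (ρ : Matrix (Fin n × Fin m) (Fin n × Fin m) ℂ) :
    (pt ρ).trace = ρ.trace := rfl

/-- The partial transpose of a PPT normal form is again a normal form. -/
lemma pt_nf (h : IsPPT (nf c D)) :
    pt (nf c D) = nf (fun m k => c k m) fun k => (D k)ᴴ := by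
  have h0 : pt (nf c D) (0, 0) (0, 0) = 0 := nf_zero_zero c D
  have hP (m k : Fin 2) :
      pt (nf c D) (m.succ, 0) (k.succ, 0) = (1 : Matrix (Fin 2) (Fin 2) ℂ) m k := by
    rw [pt_apply, nf_succ_zero_succ_zero, Matrix.one_apply, Matrix.one_apply]
    simp [eq_comm]
  have hQ (j l : Fin 2) :
      pt (nf c D) (0, j.succ) (0, l.succ) = (1 : Matrix (Fin 2) (Fin 2) ℂ) j l :=
    nf_zero_succ_zero_succ c D j l
  have hX : (pt (nf c D)).submatrix nfIdx id = nfX (fun m k => c k m) fun k => (D k)ᴴ := by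
    rw [submatrix_nfIdx_id (IsPPT.pt h) h0 hP hQ]
    congr 1
    · funext m k l
      exact nf_succ_zero_succ_succ c D k m l
    · funext k
      ext j l
      rw [conjTranspose_apply, ← nf_zero_succ_succ_succ c D l k j]
      exact (h.1.1.apply _ _).symm
  have hpsd := (IsPPT.pt h).1.sub_conjTranspose_mul nfIdx
    (submatrix_nfIdx_eq_one (IsPPT.pt h) h0 hP hQ)
  rw [hX] at hpsd
  refine sub_eq_zero.1 (hpsd.trace_eq_zero_iff.1 ?_)
  rw [trace_sub, trace_pt, ← trace_nf_transpose]
  exact sub_self _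

/-- The quadratic equations satisfied by a PPT normal form. -/
lemma nf_equation (h : IsPPT (nf c D)) (k m j l : Fin 2) :
    (∑ i, conj (c i k j) * c i m l) + ((D k)ᴴ * D m) j l =
      (∑ i, conj (c m i j) * c k i l) + (D m * (D k)ᴴ) j l := by
  have := congrFun₂ (pt_nf h) (m.succ, j.succ) (k.succ, l.succ)
  rw [pt_apply, nf_apply, nf_apply] at this
  simpa [Matrix.mul_apply] using this

end PartialTranspose

section Rotation

variable (c : Fin 2 → Fin 2 → Fin 2 → ℂ) (D : Fin 2 → Matrix (Fin 2) (Fin 2) ℂ)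

/-- A normal form under a unitary change of both bases. -/
lemma loc_oneSum_nf {U V : Matrix (Fin 2) (Fin 2) ℂ} (hU : Uᴴ * U = 1) (hV : Vᴴ * V = 1) :
    loc (oneSum U) (oneSum V) (nf c D) =
      nf (fun m k l => ∑ m', ∑ k', ∑ l', conj (U m' m) * U k' k * V l' l * c m' k' l')
        fun k => ∑ k', U k' k • (Vᴴ * D k' * V) := by
  have hX : nfX (fun m k l => ∑ m', ∑ k', ∑ l', conj (U m' m) * U k' k * V l' l * c m' k' l')
      (fun k => ∑ k', U k' k • (Vᴴ * D k' * V)) =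
      (fromBlocks U 0 0 V)ᴴ * nfX c D * (oneSum U ⊗ₖ oneSum V) := by
    have hu := fun i j => congrFun₂ hU i j
    have hv := fun i j => congrFun₂ hV i j
    simp only [Matrix.mul_apply, conjTranspose_apply, Fin.sum_univ_two] at hu hv
    ext (s | s) ⟨k, l⟩ <;> refine Fin.cases ?_ (fun k => ?_) k <;>
      refine Fin.cases ?_ (fun l => ?_) l <;>
      first | rw [nfX_inl_succ_zero, ← hu] | rw [nfX_inr_zero_succ, ← hv] | skip
    all_goals
      simp only [nfX_inl_zero, nfX_inl_succ_zero, nfX_inl_succ_succ, nfX_inr_zero,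
        nfX_inr_zero_succ, nfX_inr_succ_succ, Matrix.mul_apply, Fintype.sum_prod_type,
        sum_fin_three, Fintype.sum_sum_type, conjTranspose_apply, kroneckerMap_apply,
        fromBlocks_apply₁₁, fromBlocks_apply₁₂, fromBlocks_apply₂₁, fromBlocks_apply₂₂,
        oneSum_zero_zero, oneSum_zero_succ, oneSum_succ_zero, oneSum_succ_succ,
        Fin.sum_univ_two, Matrix.add_apply, Matrix.smul_apply]
      simp
      try ring
  have hW : fromBlocks U 0 0 V * (fromBlocks U 0 0 V)ᴴ = 1 := by
    rw [fromBlocks_conjTranspose, fromBlocks_multiply]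
    simp [mul_eq_one_comm.1 hU, mul_eq_one_comm.1 hV]
  conv_rhs => rw [nf, hX]
  rw [loc, nf]
  simp only [conjTranspose_mul, conjTranspose_conjTranspose, Matrix.mul_assoc]
  congr 2
  rw [← Matrix.mul_assoc (fromBlocks U 0 0 V), hW, Matrix.one_mul]

end Rotation

section QuadraticCurve

lemma isPPT_blkRow {n m : ℕ} {Z : Fin n → Matrix (Fin m) (Fin m) ℂ}
    (h : ∀ i k, (Z k)ᴴ * Z i = Z i * (Z k)ᴴ) : IsPPT ((blkRow Z)ᴴ * blkRow Z) := by
  refine ⟨posSemidef_conjTranspose_mul_self _, ?_⟩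
  have e := conjTranspose_blkRow_mul Z 1
  have e' := conjTranspose_blkRow_mul (fun k => (Z k)ᴴ) 1
  simp only [Matrix.mul_one, conjTranspose_conjTranspose] at e e'
  rw [e, pt_blk]
  simp only [h, ← e']
  exact posSemidef_conjTranspose_mul_self _

variable {c : Fin 2 → Fin 2 → Fin 2 → ℂ} {D : Fin 2 → Matrix (Fin 2) (Fin 2) ℂ}

lemma eq_zero_of_sum_conj_mul_self {ι : Type*} [Fintype ι] {v : ι → ℂ}
    (h : ∑ i, conj (v i) * v i = 0) : v = 0 :=
  dotProduct_star_self_eq_zero.1 h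

lemma nf_offDiag_eq_zero (h : IsPPT (nf c D)) (h01 : c 0 1 = 0) : c 1 0 = 0 := by
  have h1 := nf_equation h 0 0 0 0
  have h2 := nf_equation h 0 0 1 1
  simp only [Matrix.mul_apply, conjTranspose_apply, Fin.sum_univ_two, h01, Complex.star_def,
    Pi.zero_apply] at h1 h2
  refine eq_zero_of_sum_conj_mul_self ?_
  rw [Fin.sum_univ_two]
  linear_combination h1 + h2

lemma separable_nf_of_offDiag_eq_zero (h : IsPPT (nf c D)) (h01 : c 0 1 = 0) :
    Separable (nf c D) := by
  have h10 := nf_offDiag_eq_zero h h01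
  have hD : ∀ k m, (D k)ᴴ * D m = D m * (D k)ᴴ := by
    intro k m
    ext j l
    have := nf_equation h k m j l
    fin_cases k <;> fin_cases m <;> simpa [h01, h10, Fin.sum_univ_two] using this
  let Z : Fin 3 → Matrix (Fin 2) (Fin 2) ℂ := Fin.cons 1 D
  have hZ : IsPPT ((blkRow Z)ᴴ * blkRow Z) := by
    refine isPPT_blkRow fun i k => ?_
    refine Fin.cases ?_ (fun i => ?_) i
    · simp [Z]
    · refine Fin.cases ?_ (fun k => ?_) k
      · simp [Z]
      · simpa [Z] using hD k i
  let J : Matrix (Fin 2) (Fin 3) ℂ := Matrix.of fun l => Fin.cons 0 ((1 : Matrix _ _ ℂ) l)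
  have hJ0 : ∀ l, J l 0 = 0 := fun l => rfl
  have hJ : ∀ l k : Fin 2, J l k.succ = (1 : Matrix _ _ ℂ) l k := fun l k => rfl
  let z : Fin 2 → Fin 3 × Fin 3 → ℂ := fun m =>
    prodVec (Pi.single m.succ 1) (Fin.cons 1 fun l => conj (c m m l))
  have key : nf c D = ∑ m, vecMulVec (z m) (star (z m)) +
      loc 1 J ((blkRow Z)ᴴ * blkRow Z) := by
    have hz : ∀ m a, z m a = conj (nfX c D (.inl m) a) := by
      intro m ⟨k, l⟩
      refine Fin.cases ?_ (fun k => ?_) k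
      · simp [z, prodVec, (Fin.succ_ne_zero m).symm]
      · refine Fin.cases ?_ (fun l => ?_) l
        · by_cases hmk : m = k <;> simp [z, prodVec, hmk, eq_comm]
        · rw [nfX_inl_succ_succ]
          fin_cases m <;> fin_cases k <;> simp [z, prodVec, h01, h10]
    have hy : ∀ j a, nfX c D (.inr j) a = ∑ l, Z a.1 j l * J l a.2 := by
      intro j ⟨k, l⟩
      refine Fin.cases ?_ (fun l => ?_) l
      · simp [hJ0]
      · refine Fin.cases ?_ (fun k => ?_) k <;> simp [Z, hJ, Matrix.one_apply]
    ext a b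
    rw [nf_apply, Matrix.add_apply, Matrix.sum_apply]
    congr 1
    · exact Finset.sum_congr rfl fun m _ => by simp [vecMulVec_apply, hz]
    · simp [hy, loc_one_apply, Matrix.mul_apply, blkRow, Fin.sum_univ_two]
      ring
  rw [key]
  exact (separable_sum _ _ fun m _ => separable_prodVec _ _).add
    ((separable_three_two _ hZ).loc 1 J)

/-- The quadratic curve attached to a normal form. -/
def quad (c : Fin 2 → Fin 2 → Fin 2 → ℂ) (x y : ℂ) (l : Fin 2) : ℂ :=
  y ^ 2 * c 0 1 l + x * y * (c 0 0 l - c 1 1 l) - x ^ 2 * c 1 0 l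

/-- The quadratic curve of a non-separable normal form avoids the origin. -/
lemma eq_zero_of_quad_eq_zero (h : IsPPT (nf c D)) (hs : ¬ Separable (nf c D)) {x y : ℂ}
    (hxy : quad c x y = 0) : x = 0 ∧ y = 0 := by
  by_contra hne
  have hv : ![x, y] ≠ 0 := fun h0 => hne ⟨congrFun h0 0, congrFun h0 1⟩
  obtain ⟨r, -, hr⟩ := exists_unit_smul hv
  have hr' : conj (r * x) * (r * x) + conj (r * y) * (r * y) = 1 := by
    simpa [dotProduct, Fin.sum_univ_two] using hr
  let U : Matrix (Fin 2) (Fin 2) ℂ := !![conj (r * y), r * x; -conj (r * x), r * y]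
  have hU : Uᴴ * U = 1 := by
    ext i j
    fin_cases i <;> fin_cases j <;> simp [U, Matrix.mul_apply, Fin.sum_univ_two] <;>
      simp at hr' <;> first | ring1 | linear_combination hr'
  refine hs ?_
  have hV : (1 : Matrix (Fin 2) (Fin 2) ℂ)ᴴ * 1 = 1 := by simp
  refine Separable.of_loc (IsUnit.oneSum (IsUnit.of_mul_eq_one_right _ hU))
    (IsUnit.oneSum isUnit_one) ?_
  have h' := h.loc (oneSum U) (oneSum 1)
  rw [loc_oneSum_nf c D hU hV] at h' ⊢
  refine separable_nf_of_offDiag_eq_zero h' ?_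
  funext l
  have := congrFun hxy l
  simp only [quad, Pi.zero_apply] at this
  simp [U, Fin.sum_univ_two, Matrix.one_apply]
  linear_combination r ^ 2 * this

end QuadraticCurve

section Unextendible

lemma exists_root_quadratic_form (r s t : ℂ) :
    ∃ x y : ℂ, ¬ (x = 0 ∧ y = 0) ∧ y ^ 2 * r + x * y * s - x ^ 2 * t = 0 := by
  by_cases hr : r = 0
  · exact ⟨0, 1, by simp, by simp [hr]⟩
  · obtain ⟨d, hd⟩ := IsAlgClosed.exists_eq_mul_self (discrim r s (-t))
    obtain ⟨y, hy⟩ := exists_quadratic_eq_zero hr ⟨d, hd⟩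
    exact ⟨1, y, by simp, by linear_combination hy⟩

variable {c : Fin 2 → Fin 2 → Fin 2 → ℂ} {D : Fin 2 → Matrix (Fin 2) (Fin 2) ℂ}

/-- The quadratic curve of a non-separable normal form is not contained in a line. -/
lemma false_of_collinear (h : IsPPT (nf c D)) (hs : ¬ Separable (nf c D)) {v : Fin 2 → ℂ}
    {r s t : ℂ} (h1 : ∀ l, c 0 1 l = r * v l) (h2 : ∀ l, c 0 0 l - c 1 1 l = s * v l)
    (h3 : ∀ l, c 1 0 l = t * v l) : False := by
  obtain ⟨x, y, hne, hxy⟩ := exists_root_quadratic_form r s t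
  refine hne (eq_zero_of_quad_eq_zero h hs ?_)
  funext l
  rw [quad, h1, h2, h3, Pi.zero_apply]
  linear_combination v l * hxy

lemma false_of_orthogonal (h : IsPPT (nf c D)) (hs : ¬ Separable (nf c D)) {p q : ℂ}
    (hpq : ¬ (p = 0 ∧ q = 0)) (h1 : p * c 0 1 0 + q * c 0 1 1 = 0)
    (h2 : p * (c 0 0 0 - c 1 1 0) + q * (c 0 0 1 - c 1 1 1) = 0)
    (h3 : p * c 1 0 0 + q * c 1 0 1 = 0) : False := by
  have key (z : Fin 2 → ℂ) (hz : p * z 0 + q * z 1 = 0) : ∃ r, ∀ l, z l = r * ![-q, p] l := by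
    by_cases hp : p = 0
    · have hq : q ≠ 0 := fun hq => hpq ⟨hp, hq⟩
      refine ⟨-z 0 / q, fun l => ?_⟩
      fin_cases l
      · simp [hq]
      · simpa [hp, hq] using hz
    · refine ⟨z 1 / p, fun l => ?_⟩
      fin_cases l
      · simp only [Fin.zero_eta, cons_val_zero]
        field_simp
        linear_combination hz
      · simp [hp]
  obtain ⟨r, hr⟩ := key (c 0 1) h1
  obtain ⟨s, hs'⟩ := key (c 0 0 - c 1 1) h2
  obtain ⟨t, ht⟩ := key (c 1 0) h3
  exact false_of_collinear h hs hr hs' ht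

lemma false_of_apply_zero_one (h : IsPPT (nf c D)) (hs : ¬ Separable (nf c D))
    (hD : ∀ k, D k 0 1 = 0) : False := by
  have hD' : ∀ k, D k 1 0 = 0 := by
    have h1 := nf_equation h 0 0 0 0
    have h2 := nf_equation h 1 1 0 0
    simp only [Matrix.mul_apply, conjTranspose_apply, Fin.sum_univ_two, hD,
      Complex.star_def] at h1 h2
    refine congrFun (eq_zero_of_sum_conj_mul_self (v := fun k => D k 1 0) ?_)
    rw [Fin.sum_univ_two]
    linear_combination h1 + h2
  have key (k m j l : Fin 2) :
      ∑ i, conj (c i k j) * c i m l = ∑ i, conj (c m i j) * c k i l := by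
    have := nf_equation h k m j l
    have e : ((D k)ᴴ * D m) j l = (D m * (D k)ᴴ) j l := by
      fin_cases j <;> fin_cases l <;>
        simp [Matrix.mul_apply, Fin.sum_univ_two, hD, hD', mul_comm]
    rwa [e, add_left_inj] at this
  have e1 (j l : Fin 2) : conj (c 1 0 j) * c 1 0 l = conj (c 0 1 j) * c 0 1 l := by
    have := key 0 0 j l
    simp only [Fin.sum_univ_two] at this
    linear_combination this
  have e2 (j l : Fin 2) :
      conj (c 0 0 j - c 1 1 j) * c 0 1 l = conj (c 1 0 j) * (c 0 0 l - c 1 1 l) := by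
    have := key 0 1 j l
    simp only [Fin.sum_univ_two] at this
    rw [map_sub]
    linear_combination this
  by_cases h0 : c 1 0 = 0
  · refine one_ne_zero (eq_zero_of_quad_eq_zero h hs (x := 1) (y := 0) ?_).1
    funext l
    simp [quad, h0]
  · obtain ⟨j, hj⟩ := Function.ne_iff.1 h0
    have hj' : conj (c 1 0 j) ≠ 0 := (map_ne_zero _).2 hj
    refine false_of_collinear h hs (v := c 0 1) (r := 1)
      (s := conj (c 0 0 j - c 1 1 j) / conj (c 1 0 j)) (t := conj (c 0 1 j) / conj (c 1 0 j))
      (fun l => (one_mul _).symm) (fun l => ?_) fun l => ?_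
    · rw [div_mul_eq_mul_div, eq_div_iff hj', e2, mul_comm]
    · rw [div_mul_eq_mul_div, eq_div_iff hj', ← e1, mul_comm]

lemma false_of_common_eigenvector (h : IsPPT (nf c D)) (hs : ¬ Separable (nf c D))
    {b μ : Fin 2 → ℂ} (hb : b ≠ 0) (hD : ∀ k, b ᵥ* D k = μ k • b) : False := by
  obtain ⟨r, -, hr⟩ := exists_unit_smul hb
  have hr' : conj (r * b 0) * (r * b 0) + conj (r * b 1) * (r * b 1) = 1 := by
    simpa [dotProduct, Fin.sum_univ_two] using hr
  let V : Matrix (Fin 2) (Fin 2) ℂ :=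
    !![conj (r * b 0), -(r * b 1); conj (r * b 1), r * b 0]
  have hV : Vᴴ * V = 1 := by
    ext i j
    fin_cases i <;> fin_cases j <;> simp [V, Matrix.mul_apply, Fin.sum_univ_two] <;>
      simp at hr' <;> first | ring1 | linear_combination hr'
  have hU : (1 : Matrix (Fin 2) (Fin 2) ℂ)ᴴ * 1 = 1 := by simp
  have h' := h.loc (oneSum 1) (oneSum V)
  have hs' := fun hs' => hs (Separable.of_loc (IsUnit.oneSum isUnit_one)
    (IsUnit.oneSum (IsUnit.of_mul_eq_one_right _ hV)) hs')
  rw [loc_oneSum_nf c D hU hV] at h' hs'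
  refine false_of_apply_zero_one h' hs' fun k => ?_
  have h0 := congrFun (hD k) 0
  have h1 := congrFun (hD k) 1
  simp only [vecMul, dotProduct, Fin.sum_univ_two, Pi.smul_apply, smul_eq_mul] at h0 h1
  have : (Vᴴ * D k * V) 0 1 = 0 := by
    simp [V, Matrix.mul_apply, Fin.sum_univ_two]
    linear_combination -r ^ 2 * b 1 * h0 + r ^ 2 * b 0 * h1
  rw [Finset.sum_eq_single k (fun k' _ hk => by rw [Matrix.one_apply_ne hk, zero_smul]) (by simp),
    Matrix.one_apply_eq, one_smul]
  exact this

/-- No product vector is orthogonal to the kernel of a non-separable normal form. -/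
lemma false_of_nf_functional (h : IsPPT (nf c D)) (hs : ¬ Separable (nf c D)) {a b : Fin 3 → ℂ}
    (ha : a ≠ 0) (hb : b ≠ 0) (h0 : a 0 * b 0 = 0)
    (hab : ∀ k l : Fin 2, a k.succ * b l.succ =
      b 0 * ∑ m : Fin 2, a m.succ * c m k l + a 0 * ∑ j : Fin 2, b j.succ * D k j l) : False := by
  have vec_ne (v : Fin 3 → ℂ) (hv : v ≠ 0) (hv0 : v 0 = 0) : ∃ i : Fin 2, v i.succ ≠ 0 := by
    by_contra! hall
    exact hv (funext fun i => Fin.cases hv0 hall i)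
  by_cases hb0 : b 0 = 0
  · obtain ⟨l₀, hl₀⟩ := vec_ne b hb hb0
    have ha0 : a 0 ≠ 0 := by
      intro ha0
      obtain ⟨k₀, hk₀⟩ := vec_ne a ha ha0
      have := hab k₀ l₀
      rw [hb0, ha0, zero_mul, zero_mul, add_zero] at this
      exact mul_ne_zero hk₀ hl₀ this
    refine false_of_common_eigenvector h hs (b := fun l => b l.succ)
      (μ := fun k => a k.succ / a 0) (fun hb' => hl₀ (congrFun hb' l₀)) fun k => ?_
    funext l
    have := hab k l
    rw [hb0, zero_mul, zero_add] at this
    simp only [vecMul, dotProduct, Pi.smul_apply, smul_eq_mul]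
    rw [div_mul_eq_mul_div, eq_div_iff ha0, this, mul_comm]
  · have ha0 : a 0 = 0 := (mul_eq_zero.1 h0).resolve_right hb0
    obtain ⟨k₀, hk₀⟩ := vec_ne a ha ha0
    have := eq_zero_of_quad_eq_zero h hs (x := -a (Fin.succ 1)) (y := a (Fin.succ 0)) ?_
    · refine hk₀ ?_
      fin_cases k₀
      · exact this.2
      · exact neg_eq_zero.1 this.1
    · funext l
      have e0 := hab 0 l
      have e1 := hab 1 l
      simp only [ha0, zero_mul, add_zero, Fin.sum_univ_two] at e0 e1
      refine mul_left_cancel₀ hb0 ?_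
      rw [quad, Pi.zero_apply, mul_zero]
      linear_combination a (Fin.succ 1) * e0 - a (Fin.succ 0) * e1

end Unextendible

section Tangent

lemma IsPPT.mulVec_eq_zero_of_tangent {n m : ℕ} {ρ : Matrix (Fin n × Fin m) (Fin n × Fin m) ℂ}
    (h : IsPPT ρ) {φ φ' : Fin n → ℂ} {ψ ψ' : Fin m → ℂ} (h1 : ρ *ᵥ prodVec φ ψ = 0)
    (h2 : ρ *ᵥ prodVec φ' ψ + ρ *ᵥ prodVec φ ψ' = 0) : ρ *ᵥ prodVec φ' ψ = 0 := by
  have h3 := (h.loc (Matrix.of fun i j => ![φ i, φ' i] j)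
    (Matrix.of fun i j => ![ψ i, ψ' i] j)).apply_eq_zero (i := 0) (j := 0) ?_ 1 1
  · rw [loc_apply_eq_dotProduct] at h3
    change star (prodVec φ' ψ) ⬝ᵥ ρ *ᵥ prodVec φ ψ' = 0 at h3
    rw [eq_neg_of_add_eq_zero_right h2, dotProduct_neg, neg_eq_zero] at h3
    exact (h.1.dotProduct_mulVec_zero_iff _).1 h3
  · rw [loc_apply_eq_dotProduct]
    change star (prodVec φ ψ) ⬝ᵥ ρ *ᵥ prodVec φ ψ = 0
    rw [h1, dotProduct_zero]

variable {c : Fin 2 → Fin 2 → Fin 2 → ℂ} {D : Fin 2 → Matrix (Fin 2) (Fin 2) ℂ}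

lemma nf_mulVec_eq_zero_iff {x : Fin 3 × Fin 3 → ℂ} :
    nf c D *ᵥ x = 0 ↔
      (∀ m : Fin 2, x (m.succ, 0) + ∑ k : Fin 2, ∑ l : Fin 2, c m k l * x (k.succ, l.succ) = 0) ∧
      ∀ j : Fin 2, x (0, j.succ) + ∑ k : Fin 2, ∑ l : Fin 2, D k j l * x (k.succ, l.succ) = 0 := by
  rw [nf, conjTranspose_mul_self_mulVec_eq_zero, funext_iff, Sum.forall]
  refine and_congr (forall_congr' fun m => Eq.congr_left ?_) (forall_congr' fun j =>
    Eq.congr_left ?_)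
  all_goals
    simp only [Matrix.mulVec, dotProduct, Fintype.sum_prod_type, sum_fin_three, nfX_inl_zero,
      nfX_inl_succ_zero, nfX_inl_succ_succ, nfX_inr_zero, nfX_inr_zero_succ, nfX_inr_succ_succ,
      Matrix.one_apply, ite_mul, one_mul, zero_mul, Finset.sum_ite_eq, Finset.mem_univ, if_true,
      Finset.sum_const_zero, Finset.sum_add_distrib, zero_add]

/-- The derivative of `quad` in direction `(u, v)`. -/
def quadD (c : Fin 2 → Fin 2 → Fin 2 → ℂ) (x y u v : ℂ) (l : Fin 2) : ℂ :=
  2 * y * v * c 0 1 l + (u * y + x * v) * (c 0 0 l - c 1 1 l) - 2 * x * u * c 1 0 l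

/-- The pencil of matrices spanned by `D 0` and `D 1`. -/
def pencil (D : Fin 2 → Matrix (Fin 2) (Fin 2) ℂ) (x y : ℂ) (i j : Fin 2) : ℂ :=
  x * D 0 i j + y * D 1 i j

/-- The binary quintic whose roots parametrise product vectors in the kernel. -/
def quintic (c : Fin 2 → Fin 2 → Fin 2 → ℂ) (D : Fin 2 → Matrix (Fin 2) (Fin 2) ℂ) (x y : ℂ) : ℂ :=
  quad c x y 1 ^ 2 * pencil D x y 1 0 +
    quad c x y 1 * quad c x y 0 * (pencil D x y 0 0 - pencil D x y 1 1) -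
    quad c x y 0 ^ 2 * pencil D x y 0 1

/-- The derivative of `quintic` in direction `(u, v)`. -/
def quinticD (c : Fin 2 → Fin 2 → Fin 2 → ℂ) (D : Fin 2 → Matrix (Fin 2) (Fin 2) ℂ)
    (x y u v : ℂ) : ℂ :=
  2 * quad c x y 1 * quadD c x y u v 1 * pencil D x y 1 0 + quad c x y 1 ^ 2 * pencil D u v 1 0 +
    (quadD c x y u v 1 * quad c x y 0 + quad c x y 1 * quadD c x y u v 0) *
      (pencil D x y 0 0 - pencil D x y 1 1) +
    quad c x y 1 * quad c x y 0 * (pencil D u v 0 0 - pencil D u v 1 1) -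
    2 * quad c x y 0 * quadD c x y u v 0 * pencil D x y 0 1 - quad c x y 0 ^ 2 * pencil D u v 0 1

lemma exists_eq_mul_of_det_eq_zero {p q r s : ℂ} (h : ¬ (p = 0 ∧ q = 0)) (hd : p * s = q * r) :
    ∃ z, r = z * p ∧ s = z * q := by
  by_cases hp : p = 0
  · have hq : q ≠ 0 := fun hq => h ⟨hp, hq⟩
    have hr : r = 0 := by simpa [hp, hq] using hd.symm
    exact ⟨s / q, by simp [hp, hr], by simp [hq]⟩
  · refine ⟨r / p, by simp [hp], ?_⟩
    field_simp
    linear_combination hd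

/-- The zeroth coordinate of the second factor of a product vector in the kernel. -/
def kerCoord (c : Fin 2 → Fin 2 → Fin 2 → ℂ) (x y : ℂ) : ℂ :=
  (x * c 0 0 0 + y * c 0 1 0) * (x * c 1 0 1 + y * c 1 1 1) -
    (x * c 0 0 1 + y * c 0 1 1) * (x * c 1 0 0 + y * c 1 1 0)

/-- The derivative of `kerCoord` in direction `(u, v)`. -/
def kerCoordD (c : Fin 2 → Fin 2 → Fin 2 → ℂ) (x y u v : ℂ) : ℂ :=
  (u * c 0 0 0 + v * c 0 1 0) * (x * c 1 0 1 + y * c 1 1 1) +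
    (x * c 0 0 0 + y * c 0 1 0) * (u * c 1 0 1 + v * c 1 1 1) -
    (u * c 0 0 1 + v * c 0 1 1) * (x * c 1 0 0 + y * c 1 1 0) -
    (x * c 0 0 1 + y * c 0 1 1) * (u * c 1 0 0 + v * c 1 1 0)

lemma nf_mulVec_prodVec_eq_zero_iff {a x y s p q : ℂ} :
    nf c D *ᵥ prodVec ![a, x, y] ![s, p, q] = 0 ↔
      (x * s + (x * (c 0 0 0 * p + c 0 0 1 * q) + y * (c 0 1 0 * p + c 0 1 1 * q)) = 0 ∧
        y * s + (x * (c 1 0 0 * p + c 1 0 1 * q) + y * (c 1 1 0 * p + c 1 1 1 * q)) = 0) ∧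
      a * p + (pencil D x y 0 0 * p + pencil D x y 0 1 * q) = 0 ∧
      a * q + (pencil D x y 1 0 * p + pencil D x y 1 1 * q) = 0 := by
  rw [nf_mulVec_eq_zero_iff]
  simp only [Fin.forall_fin_two, Fin.sum_univ_two, prodVec, pencil]
  refine and_congr (and_congr (Eq.congr_left ?_) (Eq.congr_left ?_))
    (and_congr (Eq.congr_left ?_) (Eq.congr_left ?_)) <;>
  · simp
    ring

/-- A root of the quintic yields a product vector in the kernel. -/
lemma nf_mulVec_prodVec_of_root {x y z : ℂ}
    (h0 : pencil D x y 0 0 * quad c x y 1 - pencil D x y 0 1 * quad c x y 0 = z * quad c x y 1)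
    (h1 : pencil D x y 1 0 * quad c x y 1 - pencil D x y 1 1 * quad c x y 0 = -z * quad c x y 0) :
    nf c D *ᵥ prodVec ![-z, x, y] ![kerCoord c x y, quad c x y 1, -quad c x y 0] = 0 := by
  rw [nf_mulVec_prodVec_eq_zero_iff]
  refine ⟨⟨?_, ?_⟩, ?_, ?_⟩
  · simp only [kerCoord, quad]; ring
  · simp only [kerCoord, quad]; ring
  · linear_combination h0
  · linear_combination h1

lemma exists_of_quintic_eq_zero (h : IsPPT (nf c D)) (hs : ¬ Separable (nf c D)) {x y : ℂ}
    (hxy : ¬ (x = 0 ∧ y = 0)) (hP : quintic c D x y = 0) :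
    ∃ z, pencil D x y 0 0 * quad c x y 1 - pencil D x y 0 1 * quad c x y 0 = z * quad c x y 1 ∧
      pencil D x y 1 0 * quad c x y 1 - pencil D x y 1 1 * quad c x y 0 = -z * quad c x y 0 := by
  obtain ⟨z, h0, h1⟩ := exists_eq_mul_of_det_eq_zero (p := quad c x y 1) (q := -quad c x y 0)
    (r := pencil D x y 0 0 * quad c x y 1 - pencil D x y 0 1 * quad c x y 0)
    (s := pencil D x y 1 0 * quad c x y 1 - pencil D x y 1 1 * quad c x y 0)
    (fun hq => hxy (eq_zero_of_quad_eq_zero h hs (funext fun l => by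
      fin_cases l
      · exact neg_eq_zero.1 hq.2
      · exact hq.1))) (by rw [quintic] at hP; linear_combination hP)
  exact ⟨z, h0, by linear_combination h1⟩

/-- The quintic of a non-separable normal form has no multiple roots. -/
lemma quinticD_ne_zero (h : IsPPT (nf c D)) (hs : ¬ Separable (nf c D)) {x y u v : ℂ}
    (hd : x * v - y * u ≠ 0) (hP : quintic c D x y = 0) : quinticD c D x y u v ≠ 0 := by
  intro hP'
  have hxy : ¬ (x = 0 ∧ y = 0) := fun hxy => hd (by rw [hxy.1, hxy.2]; ring)
  obtain ⟨z, h0, h1⟩ := exists_of_quintic_eq_zero h hs hxy hP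
  have hq : ¬ (quad c x y 1 = 0 ∧ -quad c x y 0 = 0) := fun hq =>
    hxy (eq_zero_of_quad_eq_zero h hs (funext fun l => by
      fin_cases l
      · exact neg_eq_zero.1 hq.2
      · exact hq.1))
  have hker := nf_mulVec_prodVec_of_root h0 h1
  obtain ⟨z', h0', h1'⟩ := exists_eq_mul_of_det_eq_zero
    (r := pencil D u v 0 0 * quad c x y 1 - pencil D u v 0 1 * quad c x y 0 +
      pencil D x y 0 0 * quadD c x y u v 1 - pencil D x y 0 1 * quadD c x y u v 0 -
      z * quadD c x y u v 1)
    (s := pencil D u v 1 0 * quad c x y 1 - pencil D u v 1 1 * quad c x y 0 +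
      pencil D x y 1 0 * quadD c x y u v 1 - pencil D x y 1 1 * quadD c x y u v 0 +
      z * quadD c x y u v 0) hq (by
        rw [quinticD] at hP'
        linear_combination hP' - quadD c x y u v 1 * h1 - quadD c x y u v 0 * h0)
  have hker' : nf c D *ᵥ prodVec ![-z', u, v] ![kerCoord c x y, quad c x y 1, -quad c x y 0] +
      nf c D *ᵥ prodVec ![-z, x, y] ![kerCoordD c x y u v, quadD c x y u v 1, -quadD c x y u v 0] =
      0 := by
    rw [← mulVec_add, nf_mulVec_eq_zero_iff]
    simp only [Fin.forall_fin_two, Fin.sum_univ_two, prodVec, Pi.add_apply]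
    simp only [pencil] at h0' h1'
    refine ⟨⟨?_, ?_⟩, ?_, ?_⟩ <;> simp
    · simp only [kerCoord, kerCoordD, quad, quadD]; ring
    · simp only [kerCoord, kerCoordD, quad, quadD]; ring
    · linear_combination h0'
    · linear_combination h1'
  have hker'' := h.mulVec_eq_zero_of_tangent hker hker'
  rw [nf_mulVec_prodVec_eq_zero_iff] at hker hker''
  obtain ⟨⟨e1, e2⟩, -⟩ := hker
  obtain ⟨⟨e3, e4⟩, -⟩ := hker''
  refine false_of_orthogonal h hs hq (mul_left_cancel₀ hd ?_) (mul_left_cancel₀ hd ?_)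
    (mul_left_cancel₀ hd ?_)
  · linear_combination x * e3 - u * e1
  · linear_combination v * e1 - y * e3 - x * e4 + u * e2
  · linear_combination v * e2 - y * e4

end Tangent

section Roots

open Polynomial in
/-- A quintic without multiple roots, also at infinity, has at least four finite roots. -/
lemma exists_four_roots {a₀ a₁ a₂ a₃ a₄ a₅ : ℂ}
    (h : ∀ T, a₀ + a₁ * T + a₂ * T ^ 2 + a₃ * T ^ 3 + a₄ * T ^ 4 + a₅ * T ^ 5 = 0 →
      a₁ + 2 * a₂ * T + 3 * a₃ * T ^ 2 + 4 * a₄ * T ^ 3 + 5 * a₅ * T ^ 4 ≠ 0)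
    (hinf : a₅ = 0 → a₄ ≠ 0) :
    ∃ T : Fin 4 → ℂ, Function.Injective T ∧ ∀ i,
      a₀ + a₁ * T i + a₂ * T i ^ 2 + a₃ * T i ^ 3 + a₄ * T i ^ 4 + a₅ * T i ^ 5 = 0 := by
  set p : ℂ[X] := C a₀ + C a₁ * X + C a₂ * X ^ 2 + C a₃ * X ^ 3 + C a₄ * X ^ 4 + C a₅ * X ^ 5
    with hp
  have heval (T : ℂ) :
      p.eval T = a₀ + a₁ * T + a₂ * T ^ 2 + a₃ * T ^ 3 + a₄ * T ^ 4 + a₅ * T ^ 5 := by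
    simp [hp]
  have hder (T : ℂ) : (derivative p).eval T =
      a₁ + 2 * a₂ * T + 3 * a₃ * T ^ 2 + 4 * a₄ * T ^ 3 + 5 * a₅ * T ^ 4 := by
    simp [hp]
    ring
  have h4 : p.coeff 4 = a₄ := by simp [hp, coeff_X_pow]
  have h5 : p.coeff 5 = a₅ := by simp [hp, coeff_X_pow]
  have hdeg : 4 ≤ p.natDegree := by
    by_cases ha : a₅ = 0
    · exact le_natDegree_of_ne_zero (h4 ▸ hinf ha)
    · exact (by norm_num : 4 ≤ 5).trans (le_natDegree_of_ne_zero (h5 ▸ ha))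
  have hp0 : p ≠ 0 := fun h0 => by simp [h0] at hdeg
  have hnd : p.roots.Nodup := by
    rw [Multiset.nodup_iff_count_le_one]
    intro T
    rw [count_roots]
    by_contra! hlt
    obtain ⟨e1, e2⟩ := (one_lt_rootMultiplicity_iff_isRoot hp0).1 hlt
    rw [IsRoot.def, heval] at e1
    rw [IsRoot.def, hder] at e2
    exact h T e1 e2
  have hcard : Fintype.card (Fin 4) ≤ Fintype.card p.roots.toFinset := by
    rw [Fintype.card_coe, Multiset.toFinset_card_of_nodup hnd,
      ← (IsAlgClosed.splits p).natDegree_eq_card_roots]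
    simpa using hdeg
  obtain ⟨f⟩ := Function.Embedding.nonempty_of_card_le hcard
  refine ⟨fun i => f i, fun i j hij => f.injective (Subtype.ext hij), fun i => ?_⟩
  have := (f i).2
  rw [Multiset.mem_toFinset, mem_roots hp0, IsRoot.def, heval] at this
  exact this

variable {c : Fin 2 → Fin 2 → Fin 2 → ℂ} {D : Fin 2 → Matrix (Fin 2) (Fin 2) ℂ}

lemma exists_quintic_coeff (c : Fin 2 → Fin 2 → Fin 2 → ℂ) (D : Fin 2 → Matrix (Fin 2) (Fin 2) ℂ) :
    ∃ a₀ a₁ a₂ a₃ a₄ a₅ : ℂ,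
      (∀ T, quintic c D 1 T =
        a₀ + a₁ * T + a₂ * T ^ 2 + a₃ * T ^ 3 + a₄ * T ^ 4 + a₅ * T ^ 5) ∧
      (∀ T, quinticD c D 1 T 0 1 =
        a₁ + 2 * a₂ * T + 3 * a₃ * T ^ 2 + 4 * a₄ * T ^ 3 + 5 * a₅ * T ^ 4) ∧
      quintic c D 0 1 = a₅ ∧ quinticD c D 0 1 1 0 = a₄ := by
  obtain ⟨A, hA⟩ : ∃ A : Fin 2 → ℂ, A = c 0 1 := ⟨_, rfl⟩
  obtain ⟨B, hB⟩ : ∃ B : Fin 2 → ℂ, B = c 0 0 - c 1 1 := ⟨_, rfl⟩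
  obtain ⟨G, hG⟩ : ∃ G : Fin 2 → ℂ, G = -c 1 0 := ⟨_, rfl⟩
  have hq (x y : ℂ) (l : Fin 2) : quad c x y l = y ^ 2 * A l + x * y * B l + x ^ 2 * G l := by
    simp [quad, hA, hB, hG]
    ring
  have hq' (x y u v : ℂ) (l : Fin 2) : quadD c x y u v l =
      2 * y * v * A l + (u * y + x * v) * B l + 2 * x * u * G l := by
    simp [quadD, hA, hB, hG]
    ring
  let L (i : Fin 2) : ℂ × ℂ × ℂ := (D i 1 0, D i 0 0 - D i 1 1, -D i 0 1)
  let Q (r : ℂ × ℂ × ℂ) (k : Fin 2 → Fin 2 → ℂ) : ℂ := r.1 * k 1 1 + r.2.1 * k 0 1 + r.2.2 * k 0 0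
  let q₀ (i j : Fin 2) : ℂ := G i * G j
  let q₁ (i j : Fin 2) : ℂ := B i * G j + G i * B j
  let q₂ (i j : Fin 2) : ℂ := B i * B j + A i * G j + G i * A j
  let q₃ (i j : Fin 2) : ℂ := A i * B j + B i * A j
  let q₄ (i j : Fin 2) : ℂ := A i * A j
  refine ⟨Q (L 0) q₀, Q (L 0) q₁ + Q (L 1) q₀, Q (L 0) q₂ + Q (L 1) q₁, Q (L 0) q₃ + Q (L 1) q₂,
    Q (L 0) q₄ + Q (L 1) q₃, Q (L 1) q₄, fun T => ?_, fun T => ?_, ?_, ?_⟩ <;>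
  · simp only [quintic, quinticD, hq, hq', pencil, L, Q, q₀, q₁, q₂, q₃, q₄]
    ring

/-- The quintic of a non-separable normal form has four distinct finite roots. -/
lemma exists_roots_quintic (h : IsPPT (nf c D)) (hs : ¬ Separable (nf c D)) :
    ∃ T : Fin 4 → ℂ, Function.Injective T ∧ ∀ i, quintic c D 1 (T i) = 0 := by
  obtain ⟨a₀, a₁, a₂, a₃, a₄, a₅, h1, h2, h3, h4⟩ := exists_quintic_coeff c D
  simp only [h1]
  refine exists_four_roots (fun T hT => ?_) fun h5 => ?_
  · rw [← h1] at hT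
    rw [← h2]
    exact quinticD_ne_zero h hs (by simp) hT
  · rw [← h4]
    exact quinticD_ne_zero h hs (by simp) (h3.trans h5)

end Roots

section Span

open Polynomial in
lemma cubic_coeff_eq_zero {a₀ a₁ a₂ a₃ : ℂ} {T : Fin 4 → ℂ} (hT : Function.Injective T)
    (h : ∀ i, a₀ + a₁ * T i + a₂ * T i ^ 2 + a₃ * T i ^ 3 = 0) :
    a₀ = 0 ∧ a₁ = 0 ∧ a₂ = 0 ∧ a₃ = 0 := by
  set p : ℂ[X] := C a₀ + C a₁ * X + C a₂ * X ^ 2 + C a₃ * X ^ 3 with hp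
  have hdeg : p.natDegree ≤ 3 := by
    rw [hp]
    compute_degree
  have h0 : p = 0 := eq_zero_of_natDegree_lt_card_of_eval_eq_zero p hT
    (fun i => by simpa [hp] using h i) (by simpa using Nat.lt_succ_of_le hdeg)
  have hc (k : ℕ) : p.coeff k = 0 := by rw [h0, coeff_zero]
  refine ⟨?_, ?_, ?_, ?_⟩
  · simpa [hp] using hc 0
  · simpa [hp, coeff_X_pow, coeff_C] using hc 1
  · simpa [hp, coeff_X_pow, coeff_X, coeff_C] using hc 2
  · simpa [hp, coeff_X_pow, coeff_X, coeff_C] using hc 3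

variable {c : Fin 2 → Fin 2 → Fin 2 → ℂ} {D : Fin 2 → Matrix (Fin 2) (Fin 2) ℂ}

/-- A bilinear form vanishing at `((1, T), (quad 1, -quad 0))` for four values of `T` is zero. -/
lemma bilinear_eq_zero (h : IsPPT (nf c D)) (hs : ¬ Separable (nf c D)) {T : Fin 4 → ℂ}
    (hT : Function.Injective T) {p q r s : ℂ}
    (hb : ∀ i, p * quad c 1 (T i) 1 - q * quad c 1 (T i) 0 +
      T i * (r * quad c 1 (T i) 1 - s * quad c 1 (T i) 0) = 0) :
    (p = 0 ∧ q = 0) ∧ r = 0 ∧ s = 0 := by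
  obtain ⟨h0, h1, h2, h3⟩ := cubic_coeff_eq_zero hT
    (a₀ := q * c 1 0 0 - p * c 1 0 1)
    (a₁ := p * (c 0 0 1 - c 1 1 1) - q * (c 0 0 0 - c 1 1 0) + (s * c 1 0 0 - r * c 1 0 1))
    (a₂ := p * c 0 1 1 - q * c 0 1 0 + (r * (c 0 0 1 - c 1 1 1) - s * (c 0 0 0 - c 1 1 0)))
    (a₃ := r * c 0 1 1 - s * c 0 1 0) fun i => by
      have := hb i
      simp only [quad] at this
      linear_combination this
  have orth (a b : ℂ) (e1 : a * c 0 1 1 - b * c 0 1 0 = 0)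
      (e2 : a * (c 0 0 1 - c 1 1 1) - b * (c 0 0 0 - c 1 1 0) = 0)
      (e3 : b * c 1 0 0 - a * c 1 0 1 = 0) : a = 0 ∧ b = 0 := by
    by_contra hab
    exact false_of_orthogonal h hs (p := -b) (q := a)
      (fun h' => hab ⟨h'.2, neg_eq_zero.1 h'.1⟩) (by linear_combination e1)
      (by linear_combination e2) (by linear_combination -e3)
  have hpq : p = 0 ∧ q = 0 := by
    by_contra hne
    by_cases hd : p * s = q * r
    · obtain ⟨z, rfl, rfl⟩ := exists_eq_mul_of_det_eq_zero hne hd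
      have e2 : p * (c 0 0 1 - c 1 1 1) - q * (c 0 0 0 - c 1 1 0) = 0 := by
        linear_combination h1 - z * h0
      exact hne (orth p q (by linear_combination h2 - z * e2) e2 h0)
    · have hroot := eq_zero_of_quad_eq_zero h hs (x := p * c 0 1 1 - q * c 0 1 0)
        (y := -(p * (c 0 0 1 - c 1 1 1) - q * (c 0 0 0 - c 1 1 0))) ?_
      · exact hne (orth p q hroot.1 (neg_eq_zero.1 hroot.2) h0)
      · set x := p * c 0 1 1 - q * c 0 1 0 with hx
        set y := -(p * (c 0 0 1 - c 1 1 1) - q * (c 0 0 0 - c 1 1 0)) with hy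
        have e1 : p * quad c x y 1 - q * quad c x y 0 = 0 := by
          simp only [quad]
          linear_combination -(y ^ 2) * hx - x * y * hy + x ^ 2 * h0
        have e2 : r * quad c x y 1 - s * quad c x y 0 = 0 := by
          simp only [quad]
          linear_combination y ^ 2 * h3 + x * y * h2 + x ^ 2 * h1 + x * y * hx + x ^ 2 * hy
        funext l
        refine mul_left_cancel₀ (sub_ne_zero.2 hd) ?_
        fin_cases l
        · simp only [Fin.zero_eta, Pi.zero_apply]
          linear_combination r * e1 - p * e2
        · simp only [Fin.mk_one, Pi.zero_apply]
          linear_combination s * e1 - q * e2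
  obtain ⟨rfl, rfl⟩ := hpq
  simp only [zero_mul, sub_zero, zero_add] at h1 h2
  exact ⟨⟨rfl, rfl⟩, orth r s h3 h2 h1⟩

end Span

section NormalFormUPB

variable {c : Fin 2 → Fin 2 → Fin 2 → ℂ} {D : Fin 2 → Matrix (Fin 2) (Fin 2) ℂ}

/-- The coefficients of the functional `g` on the kernel of `nf c D`, in the free coordinates. -/
def nfCoeff (c : Fin 2 → Fin 2 → Fin 2 → ℂ) (D : Fin 2 → Matrix (Fin 2) (Fin 2) ℂ)
    (g : Fin 3 × Fin 3 → ℂ) (k l : Fin 2) : ℂ :=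
  g (k.succ, l.succ) - ∑ m : Fin 2, g (m.succ, 0) * c m k l - ∑ j : Fin 2, g (0, j.succ) * D k j l

lemma dotProduct_of_nf_mulVec_eq_zero (g : Fin 3 × Fin 3 → ℂ) {x : Fin 3 × Fin 3 → ℂ}
    (hx : nf c D *ᵥ x = 0) :
    g ⬝ᵥ x = g (0, 0) * x (0, 0) +
      ∑ k : Fin 2, ∑ l : Fin 2, nfCoeff c D g k l * x (k.succ, l.succ) := by
  obtain ⟨h1, h2⟩ := nf_mulVec_eq_zero_iff.1 hx
  simp only [dotProduct, Fintype.sum_prod_type, sum_fin_three, nfCoeff, Fin.sum_univ_two,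
    Fin.forall_fin_two] at h1 h2 ⊢
  linear_combination g (Fin.succ 0, 0) * h1.1 + g (Fin.succ 1, 0) * h1.2 +
    g (0, Fin.succ 0) * h2.1 + g (0, Fin.succ 1) * h2.2

/-- The kernel of a non-separable normal form contains five product vectors such that every
functional vanishing on them vanishes on the kernel. -/
lemma exists_prodVec_nf (h : IsPPT (nf c D)) (hs : ¬ Separable (nf c D)) :
    ∃ φ ψ : Fin 5 → Fin 3 → ℂ, (∀ i, φ i ≠ 0) ∧ (∀ i, ψ i ≠ 0) ∧
      (∀ i, nf c D *ᵥ prodVec (φ i) (ψ i) = 0) ∧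
      ∀ g : Fin 3 × Fin 3 → ℂ, (∀ i, g ⬝ᵥ prodVec (φ i) (ψ i) = 0) →
        g (0, 0) = 0 ∧ ∀ k l, nfCoeff c D g k l = 0 := by
  obtain ⟨T, hT, hroot⟩ := exists_roots_quintic h hs
  have h1T (i) : ¬ ((1 : ℂ) = 0 ∧ T i = 0) := by simp
  choose z hz0 hz1 using fun i => exists_of_quintic_eq_zero h hs (h1T i) (hroot i)
  have hker (i) := nf_mulVec_prodVec_of_root (hz0 i) (hz1 i)
  have h00 : nf c D *ᵥ prodVec ![1, 0, 0] ![1, 0, 0] = 0 := by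
    rw [nf_mulVec_eq_zero_iff]
    simp [prodVec, Fin.forall_fin_two]
  refine ⟨Fin.cons ![1, 0, 0] fun i => ![-z i, 1, T i],
    Fin.cons ![1, 0, 0] fun i => ![kerCoord c 1 (T i), quad c 1 (T i) 1, -quad c 1 (T i) 0],
    Fin.forall_fin_succ.2 ⟨fun h0 => ?_, fun i h0 => ?_⟩,
    Fin.forall_fin_succ.2 ⟨fun h0 => ?_, fun i h0 => ?_⟩, Fin.cases h00 hker, fun g hg => ?_⟩
  · exact one_ne_zero (α := ℂ) (congr_fun h0 0)
  · exact one_ne_zero (α := ℂ) (congr_fun h0 1)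
  · exact one_ne_zero (α := ℂ) (congr_fun h0 0)
  · refine h1T i (eq_zero_of_quad_eq_zero h hs (funext fun l => ?_))
    fin_cases l
    · exact neg_eq_zero.1 (congr_fun h0 2)
    · exact congr_fun h0 1
  · have hg0 : g (0, 0) = 0 := by
      have := hg 0
      rw [Fin.cons_zero, Fin.cons_zero, dotProduct_of_nf_mulVec_eq_zero g h00] at this
      simpa [prodVec] using this
    obtain ⟨⟨h1, h2⟩, h3, h4⟩ := bilinear_eq_zero h hs hT (p := nfCoeff c D g 0 0)
      (q := nfCoeff c D g 0 1) (r := nfCoeff c D g 1 0) (s := nfCoeff c D g 1 1) fun i => by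
        have := hg i.succ
        rw [Fin.cons_succ, Fin.cons_succ, dotProduct_of_nf_mulVec_eq_zero g (hker i), hg0] at this
        simp only [prodVec, Fin.sum_univ_two, Fin.succ_zero_eq_one, Fin.succ_one_eq_two,
          cons_val_one, cons_val] at this
        linear_combination this
    exact ⟨hg0, by simp [Fin.forall_fin_two, h1, h2, h3, h4]⟩

/-- A vector `v` in the kernel lies in a span as soon as all functionals vanishing on the span
vanish at `v`. -/
lemma mem_span_of_dotProduct {ι κ : Type*} [Fintype ι] [DecidableEq ι] {w : κ → ι → ℂ} {v : ι → ℂ}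
    (h : ∀ g : ι → ℂ, (∀ i, g ⬝ᵥ w i = 0) → g ⬝ᵥ v = 0) :
    v ∈ Submodule.span ℂ (Set.range w) := by
  by_contra hv
  obtain ⟨f, hfv, hf⟩ := Submodule.exists_le_ker_of_notMem hv
  have hdot (y : ι → ℂ) : (fun a => f (Pi.single a 1)) ⬝ᵥ y = f y := by
    rw [LinearMap.pi_apply_eq_sum_univ f y]
    refine Finset.sum_congr rfl fun a _ => ?_
    have hsingle : (Pi.single a 1 : ι → ℂ) = fun j => if a = j then 1 else 0 :=
      funext fun j => by simp [Pi.single_apply, eq_comm]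
    beta_reduce
    rw [hsingle, smul_eq_mul, mul_comm]
  refine hfv ?_
  rw [← hdot]
  exact h _ fun i => by
    rw [hdot]
    exact hf (Submodule.subset_span ⟨i, rfl⟩)

/-- The kernel of a non-separable normal form is spanned by a general unextendible product basis. -/
lemma exists_upb_nf (h : IsPPT (nf c D)) (hs : ¬ Separable (nf c D)) :
    ∃ φ ψ : Fin 5 → Fin 3 → ℂ, (∀ i, φ i ≠ 0) ∧ (∀ i, ψ i ≠ 0) ∧
      (∀ i, nf c D *ᵥ prodVec (φ i) (ψ i) = 0) ∧
      (∀ x, nf c D *ᵥ x = 0 →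
        x ∈ Submodule.span ℂ (Set.range fun i => prodVec (φ i) (ψ i))) ∧
      ∀ a b : Fin 3 → ℂ, a ≠ 0 → b ≠ 0 →
        ¬ ∀ i, prodVec a b ⬝ᵥ prodVec (φ i) (ψ i) = 0 := by
  obtain ⟨φ, ψ, hφ, hψ, hker, hg⟩ := exists_prodVec_nf h hs
  refine ⟨φ, ψ, hφ, hψ, hker, fun x hx => mem_span_of_dotProduct fun g h0 => ?_,
    fun a b ha hb h0 => ?_⟩
  · simp [dotProduct_of_nf_mulVec_eq_zero g hx, hg g h0]
  · obtain ⟨h00, hkl⟩ := hg _ h0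
    refine false_of_nf_functional h hs ha hb h00 fun k l => ?_
    have := hkl k l
    simp only [nfCoeff, prodVec, Fin.sum_univ_two] at this ⊢
    linear_combination this

end NormalFormUPB

section Normalization

variable {ρ : Matrix (Fin 3 × Fin 3) (Fin 3 × Fin 3) ℂ}

lemma swp_loc {n m : ℕ} (P : Matrix (Fin n) (Fin n) ℂ) (Q : Matrix (Fin m) (Fin m) ℂ)
    (σ : Matrix (Fin n × Fin m) (Fin n × Fin m) ℂ) : swp (loc P Q σ) = loc Q P (swp σ) := by
  ext a b
  rw [swp, submatrix_apply, loc_apply, loc_apply, Finset.sum_comm]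
  refine Finset.sum_congr rfl fun l _ => Finset.sum_congr rfl fun k _ => ?_
  rw [Finset.sum_comm]
  refine Finset.sum_congr rfl fun j _ => Finset.sum_congr rfl fun i _ => ?_
  simp [swp, mul_comm]

/-- The compression of `ρ` to the vectors `e ⊗ e₀` with `e` orthogonal to `e₀`. -/
def cornerBlock (ρ : Matrix (Fin 3 × Fin 3) (Fin 3 × Fin 3) ℂ) : Matrix (Fin 2) (Fin 2) ℂ :=
  ρ.submatrix (fun m => (m.succ, 0)) fun k => (k.succ, 0)

lemma cornerBlock_loc_oneSum (U V : Matrix (Fin 2) (Fin 2) ℂ) :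
    cornerBlock (loc (oneSum U) (oneSum V) ρ) = Uᴴ * cornerBlock ρ * U := by
  ext m k
  simp only [cornerBlock, submatrix_apply, loc_apply, Matrix.mul_apply, sum_fin_three,
    Fin.sum_univ_two, conjTranspose_apply, oneSum_zero_zero, oneSum_zero_succ, oneSum_succ_zero,
    oneSum_succ_succ, star_zero, mul_zero, zero_mul, add_zero, zero_add, mul_one]
  ring

lemma loc_oneSum_zero_zero (U V : Matrix (Fin 2) (Fin 2) ℂ) :
    loc (oneSum U) (oneSum V) ρ (0, 0) (0, 0) = ρ (0, 0) (0, 0) := by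
  simp only [loc_apply, sum_fin_three, Fin.sum_univ_two, oneSum_zero_zero, oneSum_succ_zero,
    star_zero, star_one, mul_zero, zero_mul, add_zero, mul_one, one_mul]

lemma exists_cornerBlock_eq_one (h : IsPPT ρ) (hs : ¬ Separable ρ) (h0 : ρ (0, 0) (0, 0) = 0) :
    ∃ U : Matrix (Fin 2) (Fin 2) ℂ, IsUnit U ∧ Uᴴ * cornerBlock ρ * U = 1 := by
  refine (h.1.submatrix _).exists_conjTranspose_mul_mul_eq_one fun v hv => ?_
  by_contra hv0
  obtain ⟨U, hU, hUv⟩ := exists_isUnit_col_zero hv0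
  refine hs (Separable.of_loc hU.oneSum isUnit_one.oneSum
    (separable_of_block_of_forall separable_three_two (h.loc _ _) 2 fun i hi => ?_))
  obtain rfl | rfl : i = 0 ∨ i = 1 := by omega
  · rw [loc_oneSum_zero_zero, h0]
  · have hcol : (cornerBlock ρ * U).col 0 = 0 := by
      rw [← hv, ← hUv]
      rfl
    have : cornerBlock (loc (oneSum U) (oneSum 1) ρ) 0 0 = 0 := by
      rw [cornerBlock_loc_oneSum, Matrix.mul_assoc, Matrix.mul_apply]
      exact Finset.sum_eq_zero fun k _ => mul_eq_zero_of_right _ (congr_fun hcol k)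
    exact this

/-- A non-separable PPT state of rank four is locally equivalent to a normal form. -/
lemma exists_loc_eq_nf (h : IsPPT ρ) (hs : ¬ Separable ρ) (hr : ρ.rank = 4) :
    ∃ (P Q : Matrix (Fin 3) (Fin 3) ℂ) (c : Fin 2 → Fin 2 → Fin 2 → ℂ)
      (D : Fin 2 → Matrix (Fin 2) (Fin 2) ℂ), IsUnit P ∧ IsUnit Q ∧ loc P Q ρ = nf c D := by
  obtain ⟨X, hX⟩ : ∃ X : Matrix (Fin 4) (Fin 3 × Fin 3) ℂ, ρ = Xᴴ * X := hr ▸ h.1.exists_factor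
  obtain ⟨φ, ψ, hφ, hψ, hker⟩ := exists_prodVec_mulVec_eq_zero_of_four X
  obtain ⟨P, hP, hPφ⟩ := exists_isUnit_col_zero hφ
  obtain ⟨Q, hQ, hQψ⟩ := exists_isUnit_col_zero hψ
  have h0 : loc P Q ρ (0, 0) (0, 0) = 0 := by
    rw [loc_apply_eq_dotProduct]
    simp only [hPφ, hQψ]
    rw [hX, ← mulVec_mulVec, hker, mulVec_zero, dotProduct_zero]
  have hσ := h.loc P Q
  have hσs : ¬ Separable (loc P Q ρ) := fun hsep => hs (hsep.of_loc hP hQ)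
  obtain ⟨U, hU, hU1⟩ := exists_cornerBlock_eq_one hσ hσs h0
  obtain ⟨V, hV, hV1⟩ := exists_cornerBlock_eq_one hσ.swp (fun hsep => hσs hsep.swp) h0
  refine ⟨P * oneSum U, Q * oneSum V, _, _, hP.mul hU.oneSum, hQ.mul hV.oneSum,
    (loc_loc ..).symm.trans (eq_nf (hσ.loc _ _) ?_ ?_ (fun m k => ?_) fun j l => ?_)⟩
  · rw [rank_loc hU.oneSum hV.oneSum, rank_loc hP hQ, hr]
  · rw [loc_oneSum_zero_zero, h0]
  · rw [← hU1, ← cornerBlock_loc_oneSum U V]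
    rfl
  · rw [← hV1, ← cornerBlock_loc_oneSum V U, ← swp_loc]
    rfl

end Normalization

section Transfer

variable {n m : ℕ}

lemma loc_mulVec_eq_zero_iff {P : Matrix (Fin n) (Fin n) ℂ} {Q : Matrix (Fin m) (Fin m) ℂ}
    (hP : IsUnit P) (hQ : IsUnit Q) (ρ : Matrix (Fin n × Fin m) (Fin n × Fin m) ℂ)
    (x : Fin n × Fin m → ℂ) : loc P Q ρ *ᵥ x = 0 ↔ ρ *ᵥ (P ⊗ₖ Q) *ᵥ x = 0 := by
  have hS : IsUnit (P ⊗ₖ Q)ᴴ := by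
    rw [isUnit_iff_isUnit_det, det_conjTranspose, det_kronecker]
    exact (((isUnit_iff_isUnit_det P).1 hP).pow _ |>.mul
      (((isUnit_iff_isUnit_det Q).1 hQ).pow _)).star
  rw [loc, ← mulVec_mulVec, ← mulVec_mulVec]
  exact (mulVec_injective_of_isUnit hS).eq_iff' (mulVec_zero _)

lemma mulVec_ne_zero_of_isUnit {P : Matrix (Fin n) (Fin n) ℂ} (hP : IsUnit P) {v : Fin n → ℂ}
    (hv : v ≠ 0) : P *ᵥ v ≠ 0 := fun h0 =>
  hv (mulVec_injective_of_isUnit hP (h0.trans (mulVec_zero _).symm))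

lemma hinner_kronecker_mulVec (P : Matrix (Fin n) (Fin n) ℂ) (Q : Matrix (Fin m) (Fin m) ℂ)
    (x : Fin n × Fin m → ℂ) (f : Fin n → ℂ) (g : Fin m → ℂ) :
    hinner ((P ⊗ₖ Q) *ᵥ x) (prodVec f g) =
      star (prodVec (Pᵀ *ᵥ star f) (Qᵀ *ᵥ star g) ⬝ᵥ x) := by
  rw [← kronecker_mulVec_prodVec, kroneckerMap_transpose, mulVec_transpose, ← dotProduct_mulVec]
  simp [hinner, dotProduct, prodVec, mul_comm]

end Transfer

theorem stmt11 (ρ : Matrix (Fin 3 × Fin 3) (Fin 3 × Fin 3) ℂ)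
    (hne : ρ ≠ 0) (hpsd : ρ.PosSemidef) (hppt : (pt ρ).PosSemidef)
    (hrank : ρ.rank = 4) (hsep : ¬ Separable ρ) :
    ∃ (φ ψ : Fin 5 → Fin 3 → ℂ),
      (∀ i, φ i ≠ 0) ∧ (∀ i, ψ i ≠ 0) ∧
      (∀ i, ρ.mulVec (prodVec (φ i) (ψ i)) = 0) ∧
      Submodule.span ℂ (Set.range fun i => prodVec (φ i) (ψ i)) =
        LinearMap.ker ρ.mulVecLin ∧
      (¬ ∃ (f g : Fin 3 → ℂ), f ≠ 0 ∧ g ≠ 0 ∧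
        ∀ i, hinner (prodVec (φ i) (ψ i)) (prodVec f g) = 0) ∧
      (∀ f g : Fin 3 → ℂ, f ≠ 0 → g ≠ 0 → ¬ ∃ x, ρ.mulVec x = prodVec f g) := by
  obtain ⟨P, Q, c, D, hP, hQ, hnf⟩ := exists_loc_eq_nf ⟨hpsd, hppt⟩ hsep hrank
  obtain ⟨φ, ψ, hφ, hψ, hker, hspan, horth⟩ := exists_upb_nf (c := c) (D := D)
    (hnf ▸ IsPPT.loc ⟨hpsd, hppt⟩ P Q) fun h => hsep (Separable.of_loc hP hQ (hnf ▸ h))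
  have hS (x) : nf c D *ᵥ x = 0 ↔ ρ *ᵥ (P ⊗ₖ Q) *ᵥ x = 0 := by
    rw [← hnf, loc_mulVec_eq_zero_iff hP hQ]
  have hker' (i) : ρ *ᵥ prodVec (P *ᵥ φ i) (Q *ᵥ ψ i) = 0 := by
    rw [← kronecker_mulVec_prodVec, ← hS, hker]
  have hupb (f g : Fin 3 → ℂ) (hf : f ≠ 0) (hg : g ≠ 0) :
      ¬ ∀ i, hinner (prodVec (P *ᵥ φ i) (Q *ᵥ ψ i)) (prodVec f g) = 0 := fun h0 => by
    refine horth _ _ (mulVec_ne_zero_of_isUnit ((isUnit_transpose _).2 hP) (star_ne_zero.2 hf))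
      (mulVec_ne_zero_of_isUnit ((isUnit_transpose _).2 hQ) (star_ne_zero.2 hg)) fun i => ?_
    rw [← star_eq_zero, ← hinner_kronecker_mulVec, kronecker_mulVec_prodVec, h0]
  refine ⟨fun i => P *ᵥ φ i, fun i => Q *ᵥ ψ i, fun i => mulVec_ne_zero_of_isUnit hP (hφ i),
    fun i => mulVec_ne_zero_of_isUnit hQ (hψ i), hker', le_antisymm ?_ fun x hx => ?_, ?_, ?_⟩
  · rw [Submodule.span_le]
    rintro _ ⟨i, rfl⟩
    exact hker' i
  · obtain ⟨y, rfl⟩ : ∃ y, (P ⊗ₖ Q) *ᵥ y = x := by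
      refine mulVec_surjective_iff_isUnit.2 ?_ x
      rw [isUnit_iff_isUnit_det, det_kronecker]
      exact ((isUnit_iff_isUnit_det P).1 hP).pow _ |>.mul (((isUnit_iff_isUnit_det Q).1 hQ).pow _)
    have hy := Submodule.mem_map_of_mem (f := (P ⊗ₖ Q).mulVecLin) (hspan y ((hS y).2 hx))
    rw [Submodule.map_span, ← Set.range_comp] at hy
    simpa only [Function.comp_def, mulVecLin_apply, kronecker_mulVec_prodVec] using hy
  · rintro ⟨f, g, hf, hg, h0⟩
    exact hupb f g hf hg h0
  · rintro f g hf hg ⟨x, hx⟩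
    refine hupb f g hf hg fun i => ?_
    rw [← hx]
    change star (prodVec (P *ᵥ φ i) (Q *ᵥ ψ i)) ⬝ᵥ ρ *ᵥ x = 0
    rw [dotProduct_mulVec, ← hpsd.1.eq, ← star_mulVec, hker', star_zero, zero_dotProduct]
end

section
/- Let p, q, r, s ∈ ℂ and define vectors in ℂ^3 by φ_1 = e_1, φ_2 = e_2, φ_3 = e_3, φ_4 = e_1 + e_2 + e_3, φ_5 = e_1 + p·e_2 + q·e_3, and ψ_1 = e_1, ψ_2 = e_2, ψ_3 = e_3, ψ_4 = e_1 + e_2 + e_3, ψ_5 = e_1 + r·e_2 + s·e_3. If there exists a non-separable PPT state ρ of rank 4 on ℂ^3 ⊗ ℂ^3 such that φ_i ⊗ ψ_i lies in the kernel of ρ for all i = 1, …, 5, then p, q, r and s are all real numbers. -/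
open scoped ComplexConjugate ComplexOrder

/-- Product vectors in the kernel of a PPT state give product vectors in the kernel of its
partial transpose. -/
lemma pt_mulVec_prodVec_eq_zero {n m : ℕ} {ρ : Matrix (Fin n × Fin m) (Fin n × Fin m) ℂ}
    (hppt : (pt ρ).PosSemidef) {φ : Fin n → ℂ} {ψ : Fin m → ℂ}
    (h : ρ.mulVec (prodVec φ ψ) = 0) : (pt ρ).mulVec (prodVec (star φ) ψ) = 0 := by
  rw [← hppt.dotProduct_mulVec_zero_iff]
  have h0 : star (prodVec φ ψ) ⬝ᵥ ρ.mulVec (prodVec φ ψ) = 0 := by simp [h]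
  rw [← h0]
  simp only [dotProduct, Matrix.mulVec, Finset.mul_sum, ← Finset.univ_product_univ,
    Finset.sum_product, pt, prodVec, Matrix.of_apply, Pi.star_apply, star_mul', star_star]
  have hswap : ∀ f : Fin n → Fin m → Fin n → Fin m → ℂ,
      ∑ i, ∑ j, ∑ k, ∑ l, f i j k l = ∑ i, ∑ j, ∑ k, ∑ l, f k j i l := fun f => by
    rw [Finset.sum_comm, Finset.sum_comm (s := Finset.univ (α := Fin n))]
    exact Finset.sum_congr rfl fun j _ => Finset.sum_comm
  rw [hswap]
  refine Finset.sum_congr rfl fun i _ => Finset.sum_congr rfl fun j _ =>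
    Finset.sum_congr rfl fun k _ => Finset.sum_congr rfl fun l _ => ?_
  ring

/-- The first factors of the six product vectors supported on the edges of the hexagon. -/
def edgeLeft : Fin 6 → Fin 3 → ℂ :=
  ![![1, 0, 0], ![1, -1, 0], ![0, 1, 0], ![0, 1, -1], ![0, 0, 1], ![1, 0, -1]]

/-- The second factors of the six product vectors supported on the edges of the hexagon. -/
def edgeRight : Fin 6 → Fin 3 → ℂ :=
  ![![0, 1, -1], ![0, 0, 1], ![1, 0, -1], ![1, 0, 0], ![1, -1, 0], ![0, 1, 0]]

/-- The Laplacian of the weighted hexagon with vertices `(i, j)`, `i ≠ j`. -/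
noncomputable def hexLaplacian (w : Fin 6 → ℝ) : Matrix (Fin 3 × Fin 3) (Fin 3 × Fin 3) ℂ :=
  ∑ t, (w t : ℂ) • Matrix.vecMulVec (prodVec (edgeLeft t) (edgeRight t))
    (star (prodVec (edgeLeft t) (edgeRight t)))

/-- With nonnegative weights, the hexagon Laplacian is separable. -/
lemma separable_hexLaplacian {w : Fin 6 → ℝ} (hw : ∀ t, 0 ≤ w t) :
    Separable (hexLaplacian w) := by
  refine ⟨6, fun t => ((√(w t) : ℝ) : ℂ) • edgeLeft t, edgeRight, ?_⟩
  refine Finset.sum_congr rfl fun t _ => ?_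
  ext a b
  have h : ((w t : ℝ) : ℂ) = (√(w t) : ℝ) * (√(w t) : ℝ) := by
    rw [← Complex.ofReal_mul, Real.mul_self_sqrt (hw t)]
  simp only [Matrix.smul_apply, Matrix.vecMulVec_apply, prodVec, Pi.star_apply, Pi.smul_apply,
    smul_eq_mul, star_mul', h, Complex.star_def, Complex.conj_ofReal]
  ring

/-- The position of `(i, j)`, `i ≠ j`, on the hexagon. -/
def hexPos : Fin 3 → Fin 3 → ℕ :=
  ![![0, 0, 1], ![3, 0, 2], ![4, 5, 0]]

/-- Cutting the hexagon at two edges: testing positivity on the indicator of one side. -/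
lemma hexLaplacian_cut {w : Fin 6 → ℝ} (h : (hexLaplacian w).PosSemidef) {i j : Fin 6}
    (hij : i < j) : 0 ≤ w i + w j := by
  have h1 := h.dotProduct_mulVec_nonneg
    (fun a => if i.val < hexPos a.1 a.2 ∧ hexPos a.1 a.2 ≤ j.val then (1 : ℂ) else 0)
  rw [← Complex.zero_le_real]
  refine h1.trans_eq ?_
  fin_cases i <;> fin_cases j <;> first
    | (exact absurd hij (by decide))
    | (simp [dotProduct, Matrix.mulVec, ← Finset.univ_product_univ, Finset.sum_product,
        Fin.sum_univ_succ, hexLaplacian, hexPos, edgeLeft, edgeRight, prodVec,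
        Matrix.vecMulVec_apply, Matrix.add_apply]
       try ring)

lemma nonneg_of_eq_zero {w : Fin 6 → ℝ} (h : (hexLaplacian w).PosSemidef) {i : Fin 6}
    (hi : w i = 0) (j : Fin 6) : 0 ≤ w j := by
  rcases lt_trichotomy i j with hij | rfl | hij
  · simpa [hi] using hexLaplacian_cut h hij
  · exact hi.ge
  · simpa [hi] using hexLaplacian_cut h hij

set_option maxHeartbeats 1000000 in
/-- A PPT state whose kernel contains `e_i ⊗ e_i` and `(e_1 + e_2 + e_3) ⊗ (e_1 + e_2 + e_3)` is
the Laplacian of a weighted hexagon. -/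
lemma eq_hexLaplacian {ρ : Matrix (Fin 3 × Fin 3) (Fin 3 × Fin 3) ℂ}
    (hpsd : ρ.PosSemidef) (hppt : (pt ρ).PosSemidef)
    (hdiag : ∀ i : Fin 3, ρ.mulVec (prodVec (Pi.single i 1) (Pi.single i 1)) = 0)
    (hone : ρ.mulVec (prodVec 1 1) = 0) : ∃ w, ρ = hexLaplacian w := by
  have hH : ∀ a b, ρ b a = star (ρ a b) := fun a b => (hpsd.1.apply b a).symm
  have hk : ∀ i a, ρ a (i, i) = 0 := fun i a => by
    have := congrFun (hdiag i) a
    simpa [Matrix.mulVec, dotProduct, prodVec, ← Finset.univ_product_univ, Finset.sum_product,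
      Pi.single_apply] using this
  have hk' : ∀ i a, ρ (i, i) a = 0 := fun i a => by rw [hH a, hk, star_zero]
  have hp : ∀ i b k, ρ (i, b) (k, i) = 0 := fun i b k => by
    have := congrFun (pt_mulVec_prodVec_eq_zero hppt (hdiag i)) (k, b)
    simpa [Matrix.mulVec, dotProduct, prodVec, pt, ← Finset.univ_product_univ,
      Finset.sum_product, Pi.single_apply] using this
  have hp' : ∀ i b k, ρ (k, i) (i, b) = 0 := fun i b k => by rw [hH (i, b), hp, star_zero]
  have h1 : ∀ a, ∑ i, ∑ j, ρ a (i, j) = 0 := fun a => by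
    have := congrFun hone a
    simpa [Matrix.mulVec, dotProduct, prodVec, ← Finset.univ_product_univ,
      Finset.sum_product] using this
  have h2 : ∀ k l, ∑ i, ∑ j, ρ (i, l) (k, j) = 0 := fun k l => by
    have := congrFun (pt_mulVec_prodVec_eq_zero hppt hone) (k, l)
    simpa [Matrix.mulVec, dotProduct, prodVec, pt, ← Finset.univ_product_univ,
      Finset.sum_product] using this
  simp only [Fin.sum_univ_three, hk, hp, add_zero, zero_add] at h1 h2
  have a0 := h1 (0, 1)
  have a1 := h1 (0, 2)
  have a2 := h1 (1, 2)
  have a3 := h1 (1, 0)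
  have a4 := h1 (2, 0)
  have a5 := h1 (2, 1)
  have b01 := h2 0 1
  have b02 := h2 0 2
  have b10 := h2 1 0
  have b12 := h2 1 2
  have b20 := h2 2 0
  have b21 := h2 2 1
  simp only [hk, hp, hp', hk', add_zero, zero_add] at a0 a1 a2 a3 a4 a5 b01 b02 b10 b12 b20 b21
  have hre : ∀ a b, ρ a b = ρ b a → ∃ w : ℝ, ρ a b = -(w : ℂ) := fun a b hab => by
    refine ⟨-(ρ a b).re, ?_⟩
    rw [Complex.ofReal_neg, neg_neg, eq_comm, ← Complex.conj_eq_iff_re, ← Complex.star_def,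
      ← hH, hab]
  have s1 : ρ (0, 2) (1, 2) = ρ (1, 2) (0, 2) := by linear_combination a1 - b02
  have s3 : ρ (1, 0) (2, 0) = ρ (2, 0) (1, 0) := by linear_combination a3 - b10
  have s5 : ρ (2, 1) (0, 1) = ρ (0, 1) (2, 1) := by linear_combination b01 - a0
  have s0 : ρ (0, 1) (0, 2) = ρ (0, 2) (0, 1) := by
    have := congrArg star a0
    simp only [star_add, ← hH, star_zero] at this
    linear_combination a0 - this + s5
  have s2 : ρ (1, 2) (1, 0) = ρ (1, 0) (1, 2) := by
    have := congrArg star a2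
    simp only [star_add, ← hH, star_zero] at this
    linear_combination a2 - this + s1
  have s4 : ρ (2, 0) (2, 1) = ρ (2, 1) (2, 0) := by
    have := congrArg star a4
    simp only [star_add, ← hH, star_zero] at this
    linear_combination a4 - this + s3
  obtain ⟨w0, hw0⟩ := hre _ _ s0
  obtain ⟨w1, hw1⟩ := hre _ _ s1
  obtain ⟨w2, hw2⟩ := hre _ _ s2
  obtain ⟨w3, hw3⟩ := hre _ _ s3
  obtain ⟨w4, hw4⟩ := hre _ _ s4
  obtain ⟨w5, hw5⟩ := hre _ _ s5
  rw [hw0, eq_comm] at s0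
  rw [hw1, eq_comm] at s1
  rw [hw2, eq_comm] at s2
  rw [hw3, eq_comm] at s3
  rw [hw4, eq_comm] at s4
  rw [hw5, eq_comm] at s5
  refine ⟨![w0, w1, w2, w3, w4, w5], ?_⟩
  have d0 : ρ (0, 1) (0, 1) = w0 + w5 := by linear_combination a0 - hw0 - s5
  have d1 : ρ (0, 2) (0, 2) = w0 + w1 := by linear_combination a1 - hw1 - s0
  have d2 : ρ (1, 2) (1, 2) = w1 + w2 := by linear_combination a2 - hw2 - s1
  have d3 : ρ (1, 0) (1, 0) = w2 + w3 := by linear_combination a3 - hw3 - s2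
  have d4 : ρ (2, 0) (2, 0) = w3 + w4 := by linear_combination a4 - hw4 - s3
  have d5 : ρ (2, 1) (2, 1) = w4 + w5 := by linear_combination a5 - hw5 - s4
  clear h1 h2 a0 a1 a2 a3 a4 a5 b01 b02 b10 b12 b20 b21 hH hdiag hone hpsd hppt hre
  ext ⟨i, j⟩ ⟨k, l⟩
  fin_cases i <;> fin_cases j <;> fin_cases k <;> fin_cases l <;>
    simp [hexLaplacian, Fin.sum_univ_succ, prodVec, edgeLeft, edgeRight,
      Matrix.vecMulVec_apply, Matrix.add_apply] <;>
    first
    | assumption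
    | exact hk _ _
    | exact hk' _ _
    | exact hp _ _ _
    | exact hp' _ _ _

theorem stmt12 (p q r s : ℂ)
    (ρ : Matrix (Fin 3 × Fin 3) (Fin 3 × Fin 3) ℂ)
    (hne : ρ ≠ 0) (hpsd : ρ.PosSemidef) (hppt : (pt ρ).PosSemidef)
    (hrank : ρ.rank = 4) (hsep : ¬ Separable ρ)
    (hker : ∀ i : Fin 5,
      ρ.mulVec
        (prodVec (![![(1 : ℂ), 0, 0], ![0, 1, 0], ![0, 0, 1], ![1, 1, 1], ![1, p, q]] i)
                 (![![(1 : ℂ), 0, 0], ![0, 1, 0], ![0, 0, 1], ![1, 1, 1], ![1, r, s]] i)) = 0) :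
    p.im = 0 ∧ q.im = 0 ∧ r.im = 0 ∧ s.im = 0 := by
  have e0 : (Pi.single 0 1 : Fin 3 → ℂ) = ![1, 0, 0] := by ext i; fin_cases i <;> rfl
  have e1 : (Pi.single 1 1 : Fin 3 → ℂ) = ![0, 1, 0] := by ext i; fin_cases i <;> rfl
  have e2 : (Pi.single 2 1 : Fin 3 → ℂ) = ![0, 0, 1] := by ext i; fin_cases i <;> rfl
  have e3 : (1 : Fin 3 → ℂ) = ![1, 1, 1] := by ext i; fin_cases i <;> rfl
  obtain ⟨w, rfl⟩ := eq_hexLaplacian hpsd hppt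
    (Fin.forall_fin_succ.2 ⟨by rw [e0]; exact hker 0, Fin.forall_fin_succ.2
      ⟨by simpa [e1] using hker 1, Fin.forall_fin_one.2 (by simpa [e2] using hker 2)⟩⟩)
    (by rw [e3]; exact hker 3)
  have hw : ∀ t, w t ≠ 0 := fun t ht =>
    hsep (separable_hexLaplacian (nonneg_of_eq_zero hpsd ht))
  have k4 : (hexLaplacian w).mulVec (prodVec ![1, p, q] ![1, r, s]) = 0 := hker 4
  have a := congrFun k4
  have b := congrFun (pt_mulVec_prodVec_eq_zero hppt k4)
  have a0 := a (0, 1)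
  have a1 := a (0, 2)
  have a2 := a (1, 2)
  have a3 := a (1, 0)
  have a4 := a (2, 0)
  have b01 := b (0, 1)
  have b02 := b (0, 2)
  have b10 := b (1, 0)
  have b20 := b (2, 0)
  simp [Matrix.mulVec, dotProduct, ← Finset.univ_product_univ, Finset.sum_product, pt,
    Fin.sum_univ_succ, hexLaplacian, edgeLeft, edgeRight, prodVec,
    Matrix.vecMulVec_apply, Matrix.add_apply] at a0 a1 a2 a3 a4 b01 b02 b10 b20
  have hw' : ∀ t, (w t : ℂ) ≠ 0 := fun t => Complex.ofReal_ne_zero.2 (hw t)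
  by_cases hc : (w 0 : ℂ) * (s - r) = 0
  · have hsr : s = r := sub_eq_zero.1 ((mul_eq_zero.1 hc).resolve_left (hw' 0))
    subst hsr
    have hrq : s * (1 - q) = 0 :=
      (mul_eq_zero.1 (show (w 5 : ℂ) * (s * (1 - q)) = 0 by linear_combination a0)).resolve_left
        (hw' 5)
    have hps : p * (1 - s) = 0 :=
      (mul_eq_zero.1 (show (w 2 : ℂ) * (p * (1 - s)) = 0 by
        linear_combination -a2 - a1)).resolve_left (hw' 2)
    have hqp : q - p = 0 :=
      (mul_eq_zero.1 (show (w 3 : ℂ) * (q - p) = 0 by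
        linear_combination -a3 - a2 - a1)).resolve_left (hw' 3)
    obtain rfl := sub_eq_zero.1 hqp
    rcases mul_eq_zero.1 hrq with rfl | h
    · have : q = 0 := by simpa using hps
      simp [this]
    · obtain rfl := sub_eq_zero.1 h
      have : s = 1 := by
        rw [one_mul] at hps
        exact (sub_eq_zero.1 hps).symm
      simp [this]
  · have hr : r ≠ 0 := by
      rintro rfl
      exact hc (by linear_combination -a0)
    have hs : s ≠ 0 := by
      rintro rfl
      exact hc (by linear_combination a1)
    have hp : p ≠ 0 := by
      rintro rfl
      exact hc (by linear_combination a1 + a2)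
    have hq : q ≠ 0 := by
      rintro rfl
      exact hc (by linear_combination a1 + a2 + a3 + a4)
    have b10' := congrArg conj b10
    have b20' := congrArg conj b20
    simp only [map_add, map_neg, map_mul, map_zero, Complex.conj_conj, Complex.conj_ofReal]
      at b10' b20'
    refine ⟨?_, ?_, ?_, ?_⟩ <;> rw [← Complex.conj_eq_iff_im, ← sub_eq_zero]
    · exact (mul_eq_zero.1 (show (w 1 * s : ℂ) * (conj p - p) = 0 by
        linear_combination a1 - b02)).resolve_left (mul_ne_zero (hw' 1) hs)
    · exact (mul_eq_zero.1 (show (w 5 * r : ℂ) * (conj q - q) = 0 by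
        linear_combination a0 - b01)).resolve_left (mul_ne_zero (hw' 5) hr)
    · exact (mul_eq_zero.1 (show (w 4 * q : ℂ) * (conj r - r) = 0 by
        linear_combination a4 - b20')).resolve_left (mul_ne_zero (hw' 4) hq)
    · exact (mul_eq_zero.1 (show (w 2 * p : ℂ) * (conj s - s) = 0 by
        linear_combination a3 - b10')).resolve_left (mul_ne_zero (hw' 2) hp)
end

section
/- Let α_1, …, α_5 ∈ ℂ^3 be vectors such that every triple of them is linearly independent. Then the following are equivalent: (i) there exist a matrix A ∈ SL(3,ℂ) and nonzero scalars c_1, …, c_5 ∈ ℂ such that the vectors v_i = c_i·(A α_i) satisfy the pentagon orthogonality relations ⟨v_i, v_{(i mod 5)+1}⟩ = 0 for all i = 1, …, 5; (ii) the invariants s_1 and s_2 computed from α_1, …, α_5 are positive real numbers. -/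
open scoped ComplexConjugate

/-- Determinant of the 3×3 matrix with columns `u`, `v`, `w`. -/
noncomputable def det3 (u v w : Fin 3 → ℂ) : ℂ :=
  Matrix.det (Matrix.of fun i j => ![u, v, w] j i)

/-- The invariant `s₁` of five vectors in `ℂ^3`. -/
noncomputable def s1 (φ : Fin 5 → Fin 3 → ℂ) : ℂ :=
  (-(det3 (φ 0) (φ 1) (φ 3) * det3 (φ 0) (φ 2) (φ 4))) /
    (det3 (φ 0) (φ 1) (φ 4) * det3 (φ 0) (φ 2) (φ 3))

/-- The invariant `s₂` of five vectors in `ℂ^3`. -/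
noncomputable def s2 (φ : Fin 5 → Fin 3 → ℂ) : ℂ :=
  (-(det3 (φ 0) (φ 1) (φ 2) * det3 (φ 1) (φ 3) (φ 4))) /
    (det3 (φ 0) (φ 1) (φ 3) * det3 (φ 1) (φ 2) (φ 4))

/-- The invariant `s₃` of five vectors in `ℂ^3`. -/
noncomputable def s3 (ψ : Fin 5 → Fin 3 → ℂ) : ℂ :=
  (-(det3 (ψ 0) (ψ 2) (ψ 1) * det3 (ψ 0) (ψ 4) (ψ 3))) /
    (det3 (ψ 0) (ψ 2) (ψ 3) * det3 (ψ 0) (ψ 4) (ψ 1))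

/-- The invariant `s₄` of five vectors in `ℂ^3`. -/
noncomputable def s4 (ψ : Fin 5 → Fin 3 → ℂ) : ℂ :=
  (-(det3 (ψ 0) (ψ 2) (ψ 4) * det3 (ψ 2) (ψ 1) (ψ 3))) /
    (det3 (ψ 0) (ψ 2) (ψ 1) * det3 (ψ 2) (ψ 4) (ψ 3))

/-- A complex number is a positive real. -/
def IsPosReal (z : ℂ) : Prop := z.im = 0 ∧ 0 < z.re

lemma det3_expand (u v w : Fin 3 → ℂ) :
    det3 u v w = u 0 * (v 1 * w 2 - v 2 * w 1) - v 0 * (u 1 * w 2 - u 2 * w 1) +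
      w 0 * (u 1 * v 2 - u 2 * v 1) := by
  simp [det3, Matrix.det_fin_three]
  ring

lemma hinner_fin_three (x y : Fin 3 → ℂ) :
    hinner x y = conj (x 0) * y 0 + conj (x 1) * y 1 + conj (x 2) * y 2 := by
  simp [hinner, Fin.sum_univ_three]

lemma hinner_conj_symm {ι : Type*} [Fintype ι] (x y : ι → ℂ) :
    conj (hinner x y) = hinner y x := by
  simp [hinner, mul_comm]

lemma hinner_smul_smul {ι : Type*} [Fintype ι] (a b : ℂ) (x y : ι → ℂ) :
    hinner (a • x) (b • y) = conj a * b * hinner x y := by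
  simp only [hinner, Finset.mul_sum, Pi.smul_apply, smul_eq_mul, map_mul]
  exact Finset.sum_congr rfl fun _ _ => by ring

lemma hinner_self_eq_ofReal {ι : Type*} [Fintype ι] (x : ι → ℂ) :
    hinner x x = ((∑ a, Complex.normSq (x a) : ℝ) : ℂ) := by
  simp [hinner, Complex.normSq_eq_conj_mul_self]

/-- The product of a determinant with a conjugate determinant is a mixed Gram determinant. -/
lemma det3_mul_conj_det3 (u v w x y z : Fin 3 → ℂ) :
    det3 u v w * conj (det3 x y z) =
      hinner x u * (hinner y v * hinner z w - hinner y w * hinner z v) -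
      hinner x v * (hinner y u * hinner z w - hinner y w * hinner z u) +
      hinner x w * (hinner y u * hinner z v - hinner y v * hinner z u) := by
  simp only [det3_expand, hinner_fin_three, map_add, map_sub, map_mul]
  ring

lemma det3_smul_mulVec (A : Matrix (Fin 3) (Fin 3) ℂ) (a b c : ℂ) (u v w : Fin 3 → ℂ) :
    det3 (a • A.mulVec u) (b • A.mulVec v) (c • A.mulVec w) =
      a * b * c * A.det * det3 u v w := by
  simp only [det3_expand, Matrix.det_fin_three, Matrix.mulVec, dotProduct, Fin.sum_univ_three,
    Pi.smul_apply, smul_eq_mul]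
  ring

/-- Cramer's rule in dimension three. -/
lemma det3_smul_eq (a b c u : Fin 3 → ℂ) :
    det3 a b c • u = det3 u b c • a + det3 a u c • b + det3 a b u • c := by
  ext i
  fin_cases i <;> simp [det3_expand] <;> ring

lemma det3_ne_zero {a b c : Fin 3 → ℂ} (h : LinearIndependent ℂ ![a, b, c]) :
    det3 a b c ≠ 0 := by
  have h2 : IsUnit (Matrix.of ![a, b, c]) :=
    Matrix.linearIndependent_rows_iff_isUnit.1 h
  have h3 := ((Matrix.isUnit_iff_isUnit_det _).1 h2).ne_zero
  rw [← Matrix.det_transpose] at h3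
  exact h3

lemma det3_ne_zero_of_triples {ι : Type*} [DecidableEq ι] {α : ι → Fin 3 → ℂ}
    (h : ∀ S : Finset ι, S.card = 3 → LinearIndependent ℂ (fun i : {x // x ∈ S} => α i.1))
    {i j k : ι} (hij : i ≠ j) (hik : i ≠ k) (hjk : j ≠ k) :
    det3 (α i) (α j) (α k) ≠ 0 := by
  apply det3_ne_zero
  have hS := h {i, j, k} (Finset.card_eq_three.2 ⟨i, j, k, hij, hik, hjk, rfl⟩)
  let f : Fin 3 → {x // x ∈ ({i, j, k} : Finset ι)} :=
    ![⟨i, by simp⟩, ⟨j, by simp⟩, ⟨k, by simp⟩]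
  have hf : Function.Injective f := by
    intro x y
    fin_cases x <;> fin_cases y <;> simp [f, hij, hik, hjk, hij.symm, hik.symm, hjk.symm]
  convert hS.comp f hf using 1
  ext x
  fin_cases x <;> rfl

lemma isPosReal_ofReal {r : ℝ} (hr : 0 < r) : IsPosReal (r : ℂ) := by
  simpa [IsPosReal] using hr

lemma IsPosReal.eq_ofReal {z : ℂ} (hz : IsPosReal z) : z = (z.re : ℂ) :=
  Complex.ext rfl (by simpa using hz.1)

lemma IsPosReal.inv {z : ℂ} (hz : IsPosReal z) : IsPosReal z⁻¹ := by
  rw [hz.eq_ofReal, ← Complex.ofReal_inv]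
  exact isPosReal_ofReal (inv_pos.2 hz.2)

lemma isPosReal_s1_of_orthogonal {v : Fin 5 → Fin 3 → ℂ}
    (h01 : hinner (v 0) (v 1) = 0) (h12 : hinner (v 1) (v 2) = 0)
    (h23 : hinner (v 2) (v 3) = 0) (h34 : hinner (v 3) (v 4) = 0)
    (h40 : hinner (v 4) (v 0) = 0)
    (d012 : det3 (v 0) (v 1) (v 2) ≠ 0) (d014 : det3 (v 0) (v 1) (v 4) ≠ 0)
    (d023 : det3 (v 0) (v 2) (v 3) ≠ 0) (d024 : det3 (v 0) (v 2) (v 4) ≠ 0) :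
    IsPosReal (s1 v) := by
  have symm : ∀ {i j}, hinner (v i) (v j) = 0 → hinner (v j) (v i) = 0 := fun {i j} h => by
    rw [← hinner_conj_symm, h, map_zero]
  have h10 := symm h01
  have h43 := symm h34
  have h04 := symm h40
  have e1 := det3_mul_conj_det3 (v 0) (v 1) (v 3) (v 0) (v 1) (v 4)
  have e2 := det3_mul_conj_det3 (v 0) (v 1) (v 4) (v 0) (v 1) (v 4)
  have e3 := det3_mul_conj_det3 (v 0) (v 2) (v 4) (v 0) (v 1) (v 2)
  have e4 := det3_mul_conj_det3 (v 0) (v 2) (v 3) (v 0) (v 1) (v 2)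
  simp only [h01, h12, h23, h40, h10, h43, h04, mul_zero, zero_mul, sub_zero,
    zero_sub, add_zero] at e1 e2 e3 e4
  have c012 := (map_ne_zero (starRingEnd ℂ)).2 d012
  have c014 := (map_ne_zero (starRingEnd ℂ)).2 d014
  have n3 := mul_ne_zero d024 c012
  have n4 := mul_ne_zero d023 c012
  have g14 : hinner (v 1) (v 4) ≠ 0 := by
    intro h
    rw [e3, h] at n3
    simp at n3
  have g00 : hinner (v 0) (v 0) ≠ 0 := by
    intro h
    have := mul_ne_zero d014 c014
    rw [e2, h] at this
    simp at this
  have key : s1 v * (Complex.normSq (det3 (v 0) (v 1) (v 4)) : ℂ) =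
      hinner (v 0) (v 0) * (Complex.normSq (hinner (v 1) (v 4)) : ℂ) := by
    have e5 : det3 (v 0) (v 2) (v 4) * hinner (v 1) (v 3) =
        det3 (v 0) (v 2) (v 3) * hinner (v 1) (v 4) := by
      apply mul_right_cancel₀ c012
      linear_combination hinner (v 1) (v 3) * e3 - hinner (v 1) (v 4) * e4
    rw [Complex.normSq_eq_conj_mul_self, Complex.normSq_eq_conj_mul_self, hinner_conj_symm, s1]
    field_simp
    linear_combination (-det3 (v 0) (v 2) (v 4)) * e1 +
      hinner (v 0) (v 0) * hinner (v 4) (v 1) * e5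
  rw [hinner_self_eq_ofReal] at key g00
  have hr : 0 < ∑ a, Complex.normSq (v 0 a) :=
    lt_of_le_of_ne (Finset.sum_nonneg fun _ _ => Complex.normSq_nonneg _)
      fun h => g00 (by rw [← h]; simp)
  have hd := Complex.normSq_pos.2 d014
  have hs : s1 v = ((∑ a, Complex.normSq (v 0 a)) * Complex.normSq (hinner (v 1) (v 4)) /
      Complex.normSq (det3 (v 0) (v 1) (v 4)) : ℝ) := by
    push_cast at key ⊢
    rw [← key, mul_div_cancel_right₀]
    exact_mod_cast hd.ne'
  rw [hs]
  exact isPosReal_ofReal (div_pos (mul_pos hr (Complex.normSq_pos.2 g14)) hd)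

/-- Reflecting the pentagon interchanges `s₁` with the inverse of `s₂`. -/
lemma s1_reflect (v : Fin 5 → Fin 3 → ℂ) :
    s1 ![v 1, v 0, v 4, v 3, v 2] = (s2 v)⁻¹ := by
  have swap : ∀ x y z, det3 x y z = -det3 y x z := fun x y z => by
    simp only [det3_expand]; ring
  have swap' : ∀ x y z, det3 x y z = -det3 x z y := fun x y z => by
    simp only [det3_expand]; ring
  simp only [s1, s2, inv_div]
  change -(det3 (v 1) (v 0) (v 3) * det3 (v 1) (v 4) (v 2)) /
    (det3 (v 1) (v 0) (v 2) * det3 (v 1) (v 4) (v 3)) = _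
  rw [swap (v 1) (v 0), swap' (v 1) (v 4), swap (v 1) (v 0), swap' (v 1) (v 4), neg_mul_neg,
    neg_mul_neg, neg_div, div_neg]

lemma s1_smul_mulVec {A : Matrix (Fin 3) (Fin 3) ℂ} {c : Fin 5 → ℂ} (hA : A.det ≠ 0)
    (hc : ∀ i, c i ≠ 0) (α : Fin 5 → Fin 3 → ℂ) :
    s1 (fun i => c i • A.mulVec (α i)) = s1 α := by
  have h := mul_ne_zero (pow_ne_zero 2 hA) (mul_ne_zero (pow_ne_zero 2 (hc 0))
    (mul_ne_zero (mul_ne_zero (hc 1) (hc 2)) (mul_ne_zero (hc 3) (hc 4))))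
  simp only [s1, det3_smul_mulVec]
  refine Eq.trans ?_ (mul_div_mul_left _ _ h)
  congr 1 <;> ring

lemma s2_smul_mulVec {A : Matrix (Fin 3) (Fin 3) ℂ} {c : Fin 5 → ℂ} (hA : A.det ≠ 0)
    (hc : ∀ i, c i ≠ 0) (α : Fin 5 → Fin 3 → ℂ) :
    s2 (fun i => c i • A.mulVec (α i)) = s2 α := by
  have h := mul_ne_zero (pow_ne_zero 2 hA) (mul_ne_zero (pow_ne_zero 2 (hc 1))
    (mul_ne_zero (mul_ne_zero (hc 0) (hc 2)) (mul_ne_zero (hc 3) (hc 4))))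
  simp only [s2, det3_smul_mulVec]
  refine Eq.trans ?_ (mul_div_mul_left _ _ h)
  congr 1 <;> ring

/-- Any basis can be carried to any other, up to a common factor, by a matrix in `SL(3, ℂ)`. -/
lemma exists_det_one_mulVec {a b c x y z : Fin 3 → ℂ} (h : det3 a b c ≠ 0)
    (h' : det3 x y z ≠ 0) :
    ∃ (A : Matrix (Fin 3) (Fin 3) ℂ) (μ : ℂ), A.det = 1 ∧
      A.mulVec a = μ • x ∧ A.mulVec b = μ • y ∧ A.mulVec c = μ • z := by
  let P : Matrix (Fin 3) (Fin 3) ℂ := Matrix.of fun i j => ![a, b, c] j i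
  let X : Matrix (Fin 3) (Fin 3) ℂ := Matrix.of fun i j => ![x, y, z] j i
  have hP : P.det ≠ 0 := h
  have hX : X.det ≠ 0 := h'
  obtain ⟨ν, hν⟩ := IsAlgClosed.exists_pow_nat_eq (P.det * X.det⁻¹) (n := 3) (by norm_num)
  have col : ∀ j, (ν • (X * P⁻¹)).mulVec (P.mulVec (Pi.single j 1)) =
      ν • X.mulVec (Pi.single j 1) := fun j => by
    rw [Matrix.smul_mulVec, Matrix.mulVec_mulVec, Matrix.mul_assoc,
      Matrix.nonsing_inv_mul _ (isUnit_iff_ne_zero.2 hP), Matrix.mul_one]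
  simp only [Matrix.mulVec_single_one] at col
  refine ⟨ν • (X * P⁻¹), ν, ?_, col 0, col 1, col 2⟩
  rw [Matrix.det_smul, Matrix.det_mul, Matrix.det_nonsing_inv, Fintype.card_fin, hν,
    Ring.inverse_eq_inv']
  field_simp

lemma exists_orthogonal_pentagon {α : Fin 5 → Fin 3 → ℂ}
    (d : ∀ {i j k : Fin 5}, i ≠ j → i ≠ k → j ≠ k → det3 (α i) (α j) (α k) ≠ 0)
    {p q : ℝ} (hp : 0 < p) (hq : 0 < q) (h1 : s1 α = p) (h2 : s2 α = q) :
    ∃ A : Matrix (Fin 3) (Fin 3) ℂ, A.det = 1 ∧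
      ∀ i : Fin 5, hinner (A.mulVec (α i)) (A.mulVec (α (i + 1))) = 0 := by
  have d012 : det3 (α 0) (α 1) (α 2) ≠ 0 := d (by decide) (by decide) (by decide)
  have e012 := d012
  have b0 : det3 (α 3) (α 1) (α 2) ≠ 0 := d (by decide) (by decide) (by decide)
  have b1 : det3 (α 0) (α 3) (α 2) ≠ 0 := d (by decide) (by decide) (by decide)
  have b2 : det3 (α 0) (α 1) (α 3) ≠ 0 := d (by decide) (by decide) (by decide)
  have c0 : det3 (α 4) (α 1) (α 2) ≠ 0 := d (by decide) (by decide) (by decide)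
  have c2 : det3 (α 0) (α 1) (α 4) ≠ 0 := d (by decide) (by decide) (by decide)
  have r1 : det3 (α 0) (α 4) (α 2) * det3 (α 0) (α 1) (α 3) =
      -p * (det3 (α 0) (α 1) (α 4) * det3 (α 0) (α 3) (α 2)) := by
    rw [s1, div_eq_iff (mul_ne_zero c2 (d (by decide) (by decide) (by decide)))] at h1
    simp only [det3_expand] at h1 ⊢
    linear_combination h1
  have r2 : det3 (α 0) (α 1) (α 4) * det3 (α 3) (α 1) (α 2) =
      (1 + q) * (det3 (α 0) (α 1) (α 3) * det3 (α 4) (α 1) (α 2)) := by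
    rw [s2, div_eq_iff (mul_ne_zero b2 (d (by decide) (by decide) (by decide)))] at h2
    simp only [det3_expand] at h2 ⊢
    linear_combination h2
  have cramer3 := det3_smul_eq (α 0) (α 1) (α 2) (α 3)
  have cramer4 := det3_smul_eq (α 0) (α 1) (α 2) (α 4)
  generalize det3 (α 0) (α 1) (α 2) = D at d012 cramer3 cramer4
  generalize det3 (α 3) (α 1) (α 2) = β₀ at *
  generalize det3 (α 0) (α 3) (α 2) = β₁ at *
  generalize det3 (α 0) (α 1) (α 3) = β₂ at *
  generalize det3 (α 4) (α 1) (α 2) = δ₀ at *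
  generalize det3 (α 0) (α 4) (α 2) = δ₁ at *
  generalize det3 (α 0) (α 1) (α 4) = δ₂ at *
  obtain ⟨r, hr, hr2⟩ : ∃ r : ℝ, r ≠ 0 ∧ r * r = q :=
    ⟨√q, (Real.sqrt_pos.2 hq).ne', Real.mul_self_sqrt hq.le⟩
  obtain ⟨t, ht, ht2⟩ : ∃ t : ℝ, t ≠ 0 ∧ p * (1 + q) * (t * t) = q := by
    have hpos : 0 < q / (p * (1 + q)) := by positivity
    refine ⟨√(q / (p * (1 + q))), (Real.sqrt_pos.2 hpos).ne', ?_⟩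
    rw [Real.mul_self_sqrt hpos.le]
    field_simp
  have hr' : (r : ℂ) ≠ 0 := by exact_mod_cast hr
  have ht' : (t : ℂ) ≠ 0 := by exact_mod_cast ht
  obtain ⟨A, μ, hA, a0, a1, a2⟩ := exists_det_one_mulVec (a := α 0) (b := α 1) (c := α 2)
    (x := β₀⁻¹ • ![(r : ℂ), 0, -1]) (y := β₁⁻¹ • ![0, (t : ℂ), 0]) (z := β₂⁻¹ • ![0, 0, 1])
    e012 (by simp [det3_expand, b0, b1, b2, hr', ht'])
  have a3 : A.mulVec (α 3) = (D⁻¹ * μ) • ![(r : ℂ), t, 0] := by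
    rw [mul_smul, eq_inv_smul_iff₀ d012, ← Matrix.mulVec_smul, cramer3]
    simp only [Matrix.mulVec_add, Matrix.mulVec_smul, a0, a1, a2]
    ext i
    fin_cases i <;> simp <;> field_simp
    ring
  have a4 : A.mulVec (α 4) =
      (D⁻¹ * (μ * (δ₀ * β₀⁻¹))) • ![(r : ℂ), -(p * (1 + q) * t), q] := by
    have ratio2 : δ₂ * β₂⁻¹ = (1 + q) * (δ₀ * β₀⁻¹) := by
      field_simp
      linear_combination r2
    have ratio1 : δ₁ * β₁⁻¹ = -p * (δ₂ * β₂⁻¹) := by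
      field_simp
      linear_combination r1
    rw [mul_smul, eq_inv_smul_iff₀ d012, ← Matrix.mulVec_smul, cramer4]
    simp only [Matrix.mulVec_add, Matrix.mulVec_smul, a0, a1, a2]
    ext i
    fin_cases i <;> simp
    · ring
    · linear_combination μ * t * ratio1 - μ * t * p * ratio2
    · linear_combination μ * ratio2
  rw [smul_smul] at a0 a1 a2
  have hr3 : (r : ℂ) * r = q := by exact_mod_cast hr2
  have ht3 : (p : ℂ) * (1 + q) * (t * t) = q := by exact_mod_cast ht2
  refine ⟨A, hA, fun i => ?_⟩
  fin_cases i
  · change hinner (A.mulVec (α 0)) (A.mulVec (α 1)) = 0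
    rw [a0, a1, hinner_smul_smul]
    simp [hinner_fin_three]
  · change hinner (A.mulVec (α 1)) (A.mulVec (α 2)) = 0
    rw [a1, a2, hinner_smul_smul]
    simp [hinner_fin_three]
  · change hinner (A.mulVec (α 2)) (A.mulVec (α 3)) = 0
    rw [a2, a3, hinner_smul_smul]
    simp [hinner_fin_three]
  · change hinner (A.mulVec (α 3)) (A.mulVec (α 4)) = 0
    rw [a3, a4, hinner_smul_smul]
    apply mul_eq_zero_of_right
    simp [hinner_fin_three]
    linear_combination hr3 - ht3
  · change hinner (A.mulVec (α 4)) (A.mulVec (α 0)) = 0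
    rw [a4, a0, hinner_smul_smul]
    apply mul_eq_zero_of_right
    simp [hinner_fin_three]
    linear_combination hr3

theorem stmt13 (α : Fin 5 → Fin 3 → ℂ)
    (htriple : ∀ S : Finset (Fin 5), S.card = 3 →
      LinearIndependent ℂ (fun i : {x // x ∈ S} => α i.1)) :
    (∃ (A : Matrix (Fin 3) (Fin 3) ℂ) (c : Fin 5 → ℂ),
      A.det = 1 ∧ (∀ i, c i ≠ 0) ∧
      ∀ i : Fin 5,
        hinner (c i • A.mulVec (α i)) (c (i + 1) • A.mulVec (α (i + 1))) = 0) ↔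
      (IsPosReal (s1 α) ∧ IsPosReal (s2 α)) := by
  have d : ∀ {i j k : Fin 5}, i ≠ j → i ≠ k → j ≠ k → det3 (α i) (α j) (α k) ≠ 0 :=
    det3_ne_zero_of_triples htriple
  constructor
  · rintro ⟨A, c, hA, hc, h⟩
    have hA' : A.det ≠ 0 := by simp [hA]
    rw [← s1_smul_mulVec hA' hc α, ← s2_smul_mulVec hA' hc α]
    have d' : ∀ {i j k : Fin 5}, i ≠ j → i ≠ k → j ≠ k →
        det3 (c i • A.mulVec (α i)) (c j • A.mulVec (α j)) (c k • A.mulVec (α k)) ≠ 0 := by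
      intro i j k hij hik hjk
      rw [det3_smul_mulVec]
      exact mul_ne_zero (mul_ne_zero (mul_ne_zero (mul_ne_zero (hc i) (hc j)) (hc k)) hA')
        (d hij hik hjk)
    have symm : ∀ i : Fin 5,
        hinner (c (i + 1) • A.mulVec (α (i + 1))) (c i • A.mulVec (α i)) = 0 := fun i => by
      rw [← hinner_conj_symm, h, map_zero]
    refine ⟨isPosReal_s1_of_orthogonal (h 0) (h 1) (h 2) (h 3) (h 4) ?_ ?_ ?_ ?_, ?_⟩
    iterate 4 exact d' (by decide) (by decide) (by decide)
    rw [← inv_inv (s2 _), ← s1_reflect]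
    apply IsPosReal.inv
    refine isPosReal_s1_of_orthogonal (symm 0) (symm 4) (symm 3) (symm 2) (symm 1) ?_ ?_ ?_ ?_
    all_goals exact d' (by decide) (by decide) (by decide)
  · rintro ⟨h1, h2⟩
    obtain ⟨A, hA, h⟩ := exists_orthogonal_pentagon d h1.2 h2.2 h1.eq_ofReal h2.eq_ofReal
    exact ⟨A, 1, hA, by simp, by simpa using h⟩
end
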